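/- The fundamental group π₁(ℂ² \ (H_{B₀} ∪ ℓ₁ ∪ ℓ₂)), where H_{B₀} = h⁻¹({0, 4, 4i}), is isomorphic to ℤ² × F₃, the direct product of a free abelian group of rank 2 and a free group of rank 3. -/

import Mathlib

open Complex

/-- The polynomial map `h(u,v) = v³ - 6v²u + 9vu² - 2u³ + 6u` on `ℂ²`. -/
noncomputable def h : ℂ × ℂ → ℂ :=
  fun p => p.2 ^ 3 - 6 * p.2 ^ 2 * p.1 + 9 * p.2 * p.1 ^ 2 - 2 * p.1 ^ 3 + 6 * p.1

/-- The line `ℓ₁ = {v = 4u}` in `ℂ²`. -/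
def ell₁ : Set (ℂ × ℂ) := {p | p.2 = 4 * p.1}

/-- The line `ℓ₂ = {v = 0}` in `ℂ²`. -/
def ell₂ : Set (ℂ × ℂ) := {p | p.2 = 0}

/-- `W B = ℂ² \ (h⁻¹(B) ∪ ℓ₁ ∪ ℓ₂)`. -/
def W (B : Set ℂ) : Set (ℂ × ℂ) := {p | h p ∉ B ∧ p ∉ ell₁ ∧ p ∉ ell₂}

open CategoryTheory
noncomputable section
namespace P17
abbrev Hm {X : Type} [TopologicalSpace X] (x y : X) : Type :=
  (FundamentalGroupoid.mk x ⟶ FundamentalGroupoid.mk y)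
section tau
variable {X Y Z Z' : Type} [TopologicalSpace X] [TopologicalSpace Y] [TopologicalSpace Z]
  [TopologicalSpace Z'] [SimplyConnectedSpace Z] [SimplyConnectedSpace Z']
def cls {x y : X} (p : Path x y) : Hm x y := (⟦p⟧ : Path.Homotopic.Quotient x y)
lemma exists_cls {x y : X} (m : Hm x y) : ∃ p : Path x y, m = cls p := by
  obtain ⟨p, hp⟩ := Quotient.exists_rep (s := Path.Homotopic.setoid x y) m
  exact ⟨p, hp.symm⟩
instance subs (z z' : Z) : Subsingleton (Hm z z') :=
  inferInstanceAs (Subsingleton (Path.Homotopic.Quotient z z'))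
def mp (f : C(X, Y)) {x x' : X} (m : Hm x x') : Hm (f x) (f x') :=
  (FundamentalGroupoid.map f).map m
lemma mp_cls (f : C(X, Y)) {x x' : X} (p : Path x x') : mp f (cls p) = cls (p.map f.continuous) :=
  rfl
@[simp] lemma mp_comp (f : C(X, Y)) {x x' x'' : X} (m : Hm x x') (n : Hm x' x'') :
    mp f (m ≫ n) = mp f m ≫ mp f n := (FundamentalGroupoid.map f).map_comp m n
@[simp] lemma mp_id (f : C(X, Y)) (x : X) : mp f (𝟙 (FundamentalGroupoid.mk x)) = 𝟙 _ :=
  (FundamentalGroupoid.map f).map_id _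
@[simp] lemma mp_inv (f : C(X, Y)) {x x' : X} (m : Hm x x') : mp f (inv m) = inv (mp f m) :=
  (FundamentalGroupoid.map f).map_inv m
lemma mp_mp {T : Type} [TopologicalSpace T] (g : C(Y, T)) (f : C(X, Y)) {x x' : X} (m : Hm x x') :
    mp g (mp f m) = mp (g.comp f) m := by
  obtain ⟨p, rfl⟩ := exists_cls m
  rfl
def tau0 (F : C(Z, X)) (z z' : Z) : Hm (F z) (F z') :=
  mp F (cls (PathConnectedSpace.somePath z z'))
def tau (F : C(Z, X)) (z z' : Z) {x y : X} (hx : F z = x) (hy : F z' = y) : Hm x y :=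
  hx ▸ hy ▸ tau0 F z z'
lemma tau_rfl (F : C(Z, X)) (z z' : Z) : tau F z z' rfl rfl = tau0 F z z' := rfl
lemma tau_eq (F : C(Z, X)) (z z' : Z) (m : Hm z z') : mp F m = tau F z z' rfl rfl := by
  rw [tau_rfl]; unfold tau0; congr 1; exact Subsingleton.elim _ _
lemma tau_comp (F : C(Z, X)) {z z' z'' : Z} {x y t : X} (hx : F z = x) (hy : F z' = y)
    (hy' : F z' = y) (ht : F z'' = t) : tau F z z' hx hy ≫ tau F z' z'' hy' ht = tau F z z'' hx ht := by
  subst hx hy ht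
  rw [tau_rfl, tau_rfl, tau0, tau0, ← mp_comp, tau_eq]
lemma tau_refl (F : C(Z, X)) (z : Z) {x : X} (hx hx' : F z = x) : tau F z z hx hx' = 𝟙 _ := by
  subst hx
  rw [← tau_eq F z z (𝟙 _), mp_id]
lemma tau_inv (F : C(Z, X)) (z z' : Z) {x y : X} (hx : F z = x) (hy : F z' = y) :
    inv (tau F z z' hx hy) = tau F z' z hy hx := by
  rw [IsIso.inv_eq_of_hom_inv_id]; rw [tau_comp, tau_refl]
lemma mp_tau (f : C(X, Y)) (F : C(Z, X)) (z z' : Z) {x y : X} (hx : F z = x) (hy : F z' = y) :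
    mp f (tau F z z' hx hy) = tau (f.comp F) z z' (by simp [hx]) (by simp [hy]) := by
  subst hx hy
  rw [tau_rfl, tau0, mp_mp, tau_eq]
lemma tau_pre (F : C(Z, X)) (G : C(Z', X)) (g : Z' → Z) (hg : Continuous g)
    (h : ∀ t, G t = F (g t)) {a b : Z'} {x y : X}
    (hx : G a = x) (hy : G b = y) :
    tau G a b hx hy = tau F (g a) (g b) (by rw [← h, hx]) (by rw [← h, hy]) := by
  obtain rfl : G = F.comp ⟨g, hg⟩ := by ext t; exact h t
  subst hx hy
  rw [← tau_eq _ _ _ (cls (PathConnectedSpace.somePath a b)), ← mp_mp, tau_eq]; rfl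
lemma cls_eq_tau (F : C(Z, X)) {z z' : Z} (p : Path z z') {x y : X} (hx : F z = x) (hy : F z' = y)
    (q : Path x y) (h : ∀ t, q t = F (p t)) : cls q = tau F z z' hx hy := by
  subst hx hy
  rw [← tau_eq F z z' (cls p), mp_cls]; congr 1; ext t; exact h t
instance ui_contr : ContractibleSpace unitInterval :=
  (convex_Icc (0 : ℝ) 1).contractibleSpace ⟨0, by simp⟩
instance icc_contr (a b : ℝ) [h : Fact (a ≤ b)] : ContractibleSpace (Set.Icc a b) :=
  (convex_Icc a b).contractibleSpace ⟨a, by simpa using h.out⟩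
lemma cls_eq_tau_self {x y : X} (q : Path x y) :
    cls q = tau (Z := unitInterval) q.toContinuousMap 0 1 q.source q.target := by
  refine cls_eq_tau (Z := unitInterval) q.toContinuousMap
    (⟨⟨id, continuous_id⟩, rfl, rfl⟩ : Path (0 : unitInterval) 1) _ _ q (fun t => rfl)
end tau
/-! ### Path induction on open sets -/
section pathind
variable {E : Type} [NormedAddCommGroup E] [NormedSpace ℝ E]
def seg {A C : Set E} (h : C ⊆ A) : C(C, A) := ⟨Set.inclusion h, continuous_inclusion h⟩
instance ball_contr (q : E) (ε : ℝ) [h : Fact (0 < ε)] : ContractibleSpace (Metric.ball q ε) :=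
  (convex_ball q ε).contractibleSpace ⟨q, Metric.mem_ball_self h.out⟩
theorem pathInduct {A : Set E} {x0 : A} (S : ∀ q : A, Hm x0 q → Prop)
    (h0 : S x0 (𝟙 _))
    (hloc : ∀ q : A, ∃ ε : ℝ, ∃ _ : Fact (0 < ε), ∃ hB : Metric.ball (q : E) ε ⊆ A,
      ∀ q1 q2 : Metric.ball (q : E) ε, ∀ m : Hm x0 (seg hB q1), S _ m →
        S (seg hB q2) (m ≫ tau (seg hB) q1 q2 rfl rfl))
    (q : A) (m : Hm x0 q) : S q m := by
  obtain ⟨p, rfl⟩ := exists_cls m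
  choose ε hε hB hS using hloc
  obtain ⟨t, ht0, htm, ⟨N, htN⟩, hsub⟩ := exists_monotone_Icc_subset_open_cover_unitInterval
    (c := fun q : A => p ⁻¹' (Subtype.val ⁻¹' Metric.ball (q : E) (ε q)))
    (fun q => (Metric.isOpen_ball.preimage continuous_subtype_val).preimage p.continuous)
    (fun s _ => Set.mem_iUnion.2 ⟨p s, by simpa using (hε (p s)).out⟩)
  have key : ∀ n, S (p (t n)) (tau (Z := unitInterval) p.toContinuousMap 0 (t n) p.source rfl) := by
    intro n
    induction n with
    | zero =>
      have : ∀ s : unitInterval, s = 0 → S (p s)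
        (tau (Z := unitInterval) p.toContinuousMap 0 s p.source rfl) := by
        rintro s rfl
        have hp : p 0 = x0 := p.source
        have : ∀ y (hy : p 0 = y), S y (tau (Z := unitInterval) p.toContinuousMap 0 0 p.source hy) := by
          intro y hy
          obtain rfl : y = x0 := by rw [← hy, hp]
          rw [tau_refl]; exact h0
        exact this _ rfl
      exact this _ ht0
    | succ n ih =>
      obtain ⟨c, hc⟩ := hsub n
      have hle : t n ≤ t (n+1) := htm (Nat.le_succ n)
      have : Fact ((t n : ℝ) ≤ t (n+1)) := ⟨hle⟩
      have hI : ∀ s : Set.Icc (t n : ℝ) (t (n+1)), (s : ℝ) ∈ unitInterval := fun s =>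
        ⟨(t n).2.1.trans s.2.1, s.2.2.trans (t (n+1)).2.2⟩
      have hmem : ∀ s : Set.Icc (t n : ℝ) (t (n+1)), (p ⟨s, hI s⟩ : E) ∈ Metric.ball (c : E) (ε c) :=
        fun s => hc ⟨s.2.1, s.2.2⟩
      have ha : (t n : ℝ) ∈ Set.Icc (t n : ℝ) (t (n+1)) := ⟨le_rfl, hle⟩
      have hb : (t (n+1) : ℝ) ∈ Set.Icc (t n : ℝ) (t (n+1)) := ⟨hle, le_rfl⟩
      have := hS c ⟨p (t n), hmem ⟨_, ha⟩⟩ ⟨p (t (n+1)), hmem ⟨_, hb⟩⟩ _ ih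
      let G : C(Set.Icc (t n : ℝ) (t (n+1)), A) := ⟨fun s => p ⟨s, hI s⟩, by fun_prop⟩
      have e1 := tau_pre (Z := unitInterval) p.toContinuousMap G (fun s => ⟨s, hI s⟩) (by fun_prop)
        (fun s => rfl) (a := ⟨_, ha⟩) (b := ⟨_, hb⟩) rfl rfl
      have e2 := tau_pre (seg (hB c)) G (fun s => ⟨p ⟨s, hI s⟩, hmem s⟩) (by fun_prop) (fun s => rfl)
        (a := ⟨_, ha⟩) (b := ⟨_, hb⟩) rfl rfl
      rw [show tau (seg (hB c)) ⟨p (t n), hmem ⟨_, ha⟩⟩ ⟨p (t (n+1)), hmem ⟨_, hb⟩⟩ rfl rfl = _ from e2.symm.trans e1] at this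
      rw [← tau_comp (Z := unitInterval) p.toContinuousMap p.source (z' := t n) rfl rfl rfl]
      exact this
  have := key N
  rw [cls_eq_tau_self]
  have hN : t N = 1 := htN N le_rfl
  have : ∀ s : unitInterval, s = 1 → S (p s)
        (tau (Z := unitInterval) p.toContinuousMap 0 s p.source rfl) →
        S q (tau (Z := unitInterval) p.toContinuousMap 0 1 p.source p.target) := by
    rintro s rfl hs
    have : ∀ y (hy : p 1 = y), S y (tau (Z := unitInterval) p.toContinuousMap 0 1 p.source hy) := by
      rintro y rfl; exact hs
    exact this _ _
  exact this _ hN (key N)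
end pathind
def sg (b : Bool) : ℝ := if b then 1 else -1
lemma sg_sq (b : Bool) : sg b * sg b = 1 := by cases b <;> simp [sg]
@[simp] lemma sg_t : sg true = 1 := by simp [sg]
@[simp] lemma sg_f : sg false = -1 := by simp [sg]
structure Marks (P ι : Type) [NormedAddCommGroup P] [NormedSpace ℝ P] where
  z : ι → P → ℂ
  hz : ∀ i, Continuous (z i)
  ρ : P → ℝ
  hρ : Continuous ρ
  hc : ConvexOn ℝ Set.univ ρ
  h0 : ∀ w, 0 < ρ w
  bd : ∀ i w, |(z i w).im| < ρ w
namespace Marks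
variable {P ι : Type} [NormedAddCommGroup P] [NormedSpace ℝ P] (M : Marks P ι)
def Y : Set (P × ℂ) := {q | ∀ i, q.2 ≠ M.z i q.1}
def En (b : Bool) : Set (P × ℂ) := {q | M.ρ q.1 < sg b * q.2.im}
lemma En_sub (b : Bool) : M.En b ⊆ M.Y := by
  intro q hq i hi
  have h1 := M.bd i q.1
  have hq' : M.ρ q.1 < sg b * q.2.im := hq
  rw [← hi] at h1
  cases b <;> simp at hq' <;> cases abs_lt.1 h1 <;> linarith
lemma En_convex (b : Bool) : Convex ℝ (M.En b) := by
  intro q hq q' hq' s t hs ht hst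
  have h := M.hc.2 (Set.mem_univ q.1) (Set.mem_univ q'.1) hs ht hst
  have hq1 : M.ρ q.1 < sg b * q.2.im := hq
  have hq2 : M.ρ q'.1 < sg b * q'.2.im := hq'
  change M.ρ (s • q.1 + t • q'.1) < sg b * (s • q.2 + t • q'.2).im
  simp only [Complex.add_im, Complex.real_smul, Complex.mul_im, Complex.ofReal_re, Complex.ofReal_im,
    smul_eq_mul] at h ⊢
  refine h.trans_lt ?_
  rcases hs.eq_or_lt with rfl | hs
  · obtain rfl : t = 1 := by linarith
    simpa using hq2
  · nlinarith [mul_lt_mul_of_pos_left hq1 hs, mul_le_mul_of_nonneg_left hq2.le ht]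
def base (b : Bool) : P × ℂ := (0, ⟨0, sg b * (M.ρ 0 + 1)⟩)
lemma base_mem (b : Bool) : M.base b ∈ M.En b := by
  simp only [En, base, Set.mem_ofPred_eq]
  rw [← mul_assoc, sg_sq]; linarith
instance (b : Bool) : ContractibleSpace (M.En b) := (M.En_convex b).contractibleSpace ⟨_, M.base_mem b⟩
def pb (b : Bool) : M.Y := ⟨M.base b, M.En_sub b (M.base_mem b)⟩
def RGood (b : Bool) (w : P) (f : ℝ → ℝ) (h : ℝ) : Prop :=
  ∀ i, 0 ≤ sg b * ((M.z i w).im - h) → f (M.z i w).im ≠ (M.z i w).re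
lemma RGood.mem {M : Marks P ι} {b w f h} (hg : M.RGood b w f h) {s : ℝ} (hs : 0 ≤ s) :
    ((w, ⟨f (h + sg b * s), h + sg b * s⟩) : P × ℂ) ∈ M.Y := by
  intro i hi
  have h1 : (M.z i w).im = h + sg b * s := by rw [← hi]
  refine hg i ?_ ?_
  · rw [h1]; ring_nf; have := sg_sq b; rw [← sq] at this; rw [this]; simpa
  · rw [h1, ← hi]
lemma RGood.mem0 {M : Marks P ι} {b w f h} (hg : M.RGood b w f h)  :
    ((w, ⟨f h, h⟩) : P × ℂ) ∈ M.Y := by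
  simpa using hg.mem (s := 0) le_rfl
lemma cont_mk {Z : Type} [TopologicalSpace Z] {f g : Z → ℝ} (hf : Continuous f) (hg : Continuous g) :
    Continuous (fun t => (⟨f t, g t⟩ : ℂ)) := by
  have : (fun t => (⟨f t, g t⟩ : ℂ)) = fun t => (f t : ℂ) + (g t : ℂ) * Complex.I := by
    ext t; exact Complex.mk_eq_add_mul_I _ _
  rw [this]; fun_prop
def rmap (b : Bool) (w : P) (f : ℝ → ℝ) (hf : Continuous f) (h : ℝ) (hg : M.RGood b w f h) :
    C(ℝ, M.Y) :=
  ⟨fun s => ⟨(w, ⟨f (h + sg b * max s 0), h + sg b * max s 0⟩), hg.mem (le_max_right _ _)⟩, by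
    refine Continuous.subtype_mk (Continuous.prodMk continuous_const (cont_mk ?_ ?_)) _ <;> fun_prop⟩
lemma rmap_end {b w f hf h} (hg : M.RGood b w f h) {s : ℝ} (hs : M.ρ w + |h| < s) :
    (M.rmap b w f hf h hg s : P × ℂ) ∈ M.En b := by
  change M.ρ w < sg b * (h + sg b * max s 0)
  have := M.h0 w
  rw [max_eq_left (by have := abs_nonneg h; linarith)]
  have e : sg b * (h + sg b * s) = sg b * h + s := by
    have := sg_sq b; linear_combination s * this
  rw [e]
  have : - |h| ≤ sg b * h := by cases b <;> simp <;> [exact le_abs_self h; exact neg_abs_le h]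
  linarith
def ray (b : Bool) (w : P) (f : ℝ → ℝ) (hf : Continuous f) (h : ℝ) (hg : M.RGood b w f h) :
    Hm (M.pb b) (⟨(w, ⟨f h, h⟩), hg.mem0⟩ : M.Y) :=
  tau (seg (M.En_sub b)) ⟨_, M.base_mem b⟩ ⟨_, M.rmap_end (hf := hf) hg (lt_add_one _)⟩ rfl
    (y := M.rmap b w f hf h hg (M.ρ w + |h| + 1)) rfl ≫
  tau (M.rmap b w f hf h hg) _ 0 rfl (by simp [rmap])
def ray_left (b : Bool) (w : P) (f : ℝ → ℝ) (hf : Continuous f) (h : ℝ) (hg : M.RGood b w f h) :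
    Hm (M.pb b) (M.rmap b w f hf h hg (M.ρ w + |h| + 1)) :=
  tau (seg (M.En_sub b)) ⟨_, M.base_mem b⟩ ⟨_, M.rmap_end (hf := hf) hg (lt_add_one _)⟩ rfl rfl
lemma hom_aux {X : Type} [TopologicalSpace X] {p a0 a1 c0 c1 : X} (A0 : Hm p a0) (A1 : Hm p a1)
    {B0 : Hm a0 c0} {B1 : Hm a1 c1} {C : Hm c0 c1} (D : Hm a0 a1) (h1 : A0 ≫ D = A1)
    (h2 : B0 ≫ C = D ≫ B1) : (A0 ≫ B0) ≫ C = A1 ≫ B1 := by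
  rw [Category.assoc, h2, ← h1, Category.assoc]
section
variable {Z : Type} [TopologicalSpace Z] [ContractibleSpace Z]
def emap {b : Bool} {w : Z → P} {f : Z → ℝ → ℝ} {h : Z → ℝ} (hw : Continuous w)
    (hf : Continuous fun p : Z × ℝ => f p.1 p.2) (hh : Continuous h)
    (hg : ∀ t, M.RGood b (w t) (f t) (h t)) : C(Z, M.Y) :=
  ⟨fun t => ⟨(w t, ⟨f t (h t), h t⟩), (hg t).mem0⟩, by
    refine Continuous.subtype_mk (Continuous.prodMk hw (cont_mk ?_ hh)) _
    exact hf.comp (continuous_id.prodMk hh)⟩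
theorem ray_homotopy {b : Bool} {w : Z → P} {f : Z → ℝ → ℝ} {h : Z → ℝ} (hw : Continuous w)
    (hf : Continuous fun p : Z × ℝ => f p.1 p.2) (hh : Continuous h)
    (hg : ∀ t, M.RGood b (w t) (f t) (h t)) (hf' : ∀ t, Continuous (f t)) (t0 t1 : Z) :
    M.ray b (w t0) (f t0) (hf' t0) (h t0) (hg t0) ≫ tau (M.emap hw hf hh hg) t0 t1 rfl rfl =
      M.ray b (w t1) (f t1) (hf' t1) (h t1) (hg t1) := by
  let F : C(Z × ℝ, M.Y) := ⟨fun p => M.rmap b (w p.1) (f p.1) (hf' _) (h p.1) (hg p.1) p.2, by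
    refine Continuous.subtype_mk (Continuous.prodMk (hw.comp continuous_fst) (cont_mk ?_ ?_)) _
    · exact hf.comp (continuous_fst.prodMk (show Continuous fun p : Z × ℝ => h p.1 + sg b * max p.2 0 by fun_prop))
    · fun_prop⟩
  let R : Z → ℝ := fun t => M.ρ (w t) + |h t| + 1
  have hR : Continuous R := by have := M.hρ; fun_prop
  have hF : ∀ t, (F (t, R t) : P × ℂ) ∈ M.En b := fun t => M.rmap_end (hf := hf' t) (hg t) (lt_add_one _)
  have e0 : ∀ t, F (t, 0) = M.emap hw hf hh hg t := by intro t; simp [F, rmap, emap]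
  have e1 : ∀ t x y hx hy, tau (M.rmap b (w t) (f t) (hf' t) (h t) (hg t)) (R t) 0 (x := x) (y := y) hx hy =
      tau F (t, R t) (t, 0) hx hy := fun t x y hx hy =>
    tau_pre F _ (fun s => (t, s)) (by fun_prop) (fun s => rfl) hx hy
  have e2 : tau (M.emap hw hf hh hg) t0 t1 rfl rfl = tau F (t0, 0) (t1, 0) (e0 _) (e0 _) :=
    tau_pre F _ (fun t => (t, 0)) (by fun_prop) (fun t => (e0 t).symm) rfl rfl
  have e3 := tau_pre F (F.comp ⟨fun t => (t, R t), by fun_prop⟩) (fun t => (t, R t)) (by fun_prop)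
    (fun t => rfl) (a := t0) (b := t1) rfl rfl
  have e4 := tau_pre (seg (M.En_sub b)) (F.comp ⟨fun t => (t, R t), by fun_prop⟩)
    (fun t => ⟨F (t, R t), hF t⟩) (by fun_prop) (fun t => rfl) (a := t0) (b := t1) rfl rfl
  have e7 : tau F (t0, R t0) (t0, 0) rfl (e0 t0) ≫ tau F (t0, 0) (t1, 0) (e0 _) (e0 _) =
    tau F (t0, R t0) (t1, 0) rfl (e0 t1) := tau_comp _ _ _ _ _
  have a1 := e1 t0 _ _ rfl (e0 t0)
  have a2 := e1 t1 _ _ rfl (e0 t1)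
  have e6 : tau (seg (M.En_sub b)) ⟨F (t0, R t0), hF t0⟩ ⟨F (t1, R t1), hF t1⟩ rfl rfl
    ≫ tau F (t1, R t1) (t1, 0) rfl (e0 t1) = tau F (t0, R t0) (t1, 0) rfl (e0 t1) := by
    rw [show tau (seg (M.En_sub b)) ⟨F (t0, R t0), hF t0⟩ ⟨F (t1, R t1), hF t1⟩ rfl rfl = _ from
      e4.symm.trans e3]
    exact tau_comp _ _ _ _ _
  refine hom_aux (M.ray_left b _ _ _ _ (hg t0)) (M.ray_left b _ _ _ _ (hg t1))
     (tau (seg (M.En_sub b)) ⟨F (t0, R t0), hF t0⟩ ⟨F (t1, R t1), hF t1⟩ rfl rfl) ?_ ?_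
  · exact tau_comp _ _ _ _ _
  · exact (congr_arg₂ (· ≫ ·) a1 e2).trans (e7.trans (e6.symm.trans (congrArg _ a2.symm)))
end
end Marks
namespace Marks
variable {P ι : Type} [NormedAddCommGroup P] [NormedSpace ℝ P] (M : Marks P ι)
def Good (w : P) (f : ℝ → ℝ) : Prop := ∀ i, f (M.z i w).im ≠ (M.z i w).re
lemma Good.r {M : Marks P ι} {w f} (hg : M.Good w f) (b : Bool) (h : ℝ) : M.RGood b w f h :=
  fun i _ => hg i
def H (w : P) (f : ℝ → ℝ) (hf : Continuous f) (hg : M.Good w f) : Hm (M.pb false) (M.pb true) :=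
  M.ray false w f hf 0 (hg.r _ _) ≫ inv (M.ray true w f hf 0 (hg.r _ _))
lemma two_aux {X : Type} [TopologicalSpace X] {p q a a' : X} {r : Hm p a} {r' : Hm p a'}
    {s : Hm q a} {s' : Hm q a'} (t : Hm a a') (h1 : r ≫ t = r') (h2 : s ≫ t = s') :
    r ≫ inv s = r' ≫ inv s' := by
  subst h1 h2; simp
theorem H_homotopy {Z : Type} [TopologicalSpace Z] [ContractibleSpace Z]
    {w : Z → P} {f : Z → ℝ → ℝ} (hw : Continuous w)
    (hf : Continuous fun p : Z × ℝ => f p.1 p.2)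
    (hg : ∀ t, M.Good (w t) (f t)) (hf' : ∀ t, Continuous (f t)) (t0 t1 : Z) :
    M.H (w t0) (f t0) (hf' t0) (hg t0) = M.H (w t1) (f t1) (hf' t1) (hg t1) :=
  two_aux _ (M.ray_homotopy (h := fun _ => 0) hw hf continuous_const (fun t => (hg t).r _ _) hf' t0 t1)
    (M.ray_homotopy (h := fun _ => 0) hw hf continuous_const (fun t => (hg t).r _ _) hf' t0 t1)
instance real_contr : ContractibleSpace ℝ := inferInstance
theorem H_height (w : P) (f : ℝ → ℝ) (hf : Continuous f) (hg : M.Good w f) (h : ℝ) :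
    M.H w f hf hg = M.ray false w f hf h (hg.r _ _) ≫ inv (M.ray true w f hf h (hg.r _ _)) :=
  two_aux _ (M.ray_homotopy (Z := ℝ) (w := fun _ => w) (f := fun _ => f) (h := fun t => t)
      continuous_const (by fun_prop) continuous_id (fun t => hg.r _ _) (fun _ => hf) 0 h)
    (M.ray_homotopy (Z := ℝ) (w := fun _ => w) (f := fun _ => f) (h := fun t => t)
      continuous_const (by fun_prop) continuous_id (fun t => hg.r _ _) (fun _ => hf) 0 h)
lemma conv_ne {a b x t : ℝ} (h : a < x ↔ b < x) (ha : a ≠ x) (hb : b ≠ x) (h0 : 0 ≤ t) (h1 : t ≤ 1) :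
    (1 - t) * a + t * b ≠ x := by
  rcases lt_or_gt_of_ne ha with h2 | h2
  · have h3 := h.1 h2
    have : 0 < (1 - t) * (x - a) + t * (x - b) := by
      rcases h0.eq_or_lt with rfl | h0
      · simpa using h2
      · have := mul_pos h0 (sub_pos.2 h3); have := mul_nonneg (sub_nonneg.2 h1) (sub_pos.2 h2).le; linarith
    intro h; linarith
  · have h3 : x < b := lt_of_le_of_ne (not_lt.1 (fun h' => absurd (h.2 h') h2.not_gt)) hb.symm
    have : 0 < (1 - t) * (a - x) + t * (b - x) := by
      rcases h0.eq_or_lt with rfl | h0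
      · simpa using h2
      · have := mul_pos h0 (sub_pos.2 h3); have := mul_nonneg (sub_nonneg.2 h1) (sub_pos.2 h2).le; linarith
    intro h; linarith
theorem H_congr {w : P} {f f' : ℝ → ℝ} (hf : Continuous f) (hf' : Continuous f') (hg : M.Good w f)
    (hg' : M.Good w f') (h : ∀ i, f (M.z i w).im < (M.z i w).re ↔ f' (M.z i w).im < (M.z i w).re) :
    M.H w f hf hg = M.H w f' hf' hg' := by
  have := M.H_homotopy (Z := unitInterval) (w := fun _ => w)
    (f := fun t η => (1 - (t : ℝ)) * f η + t * f' η) continuous_const (by fun_prop)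
    (fun t i => conv_ne (h i) (hg i) (hg' i) t.2.1 t.2.2) (fun t => by fun_prop) 0 1
  simpa using this
lemma ray_mix {w : P} {b : Bool} {f f' : ℝ → ℝ} (hf : Continuous f) (hf' : Continuous f') {h : ℝ}
    (hg : M.RGood b w f h) (hg' : M.RGood b w f' h)
    (hs : ∀ i, 0 ≤ sg b * ((M.z i w).im - h) →
      (f (M.z i w).im < (M.z i w).re ↔ f' (M.z i w).im < (M.z i w).re)) (K : C(ℝ, M.Y))
    (hK : ∀ x, (K x : P × ℂ) = (w, ⟨x, h⟩)) :
    M.ray b w f hf h hg ≫ tau K (f h) (f' h) (Subtype.ext (hK _)) (Subtype.ext (hK _)) =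
     M.ray b w f' hf' h hg' := by
  have G : ∀ t : unitInterval, M.RGood b w (fun η => (1 - (t : ℝ)) * f η + t * f' η) h := fun t i hi =>
    conv_ne (hs i hi) (hg i hi) (hg' i hi) t.2.1 t.2.2
  have := M.ray_homotopy (Z := unitInterval) (w := fun _ => w) (b := b) (h := fun _ => h)
    (f := fun t η => (1 - (t : ℝ)) * f η + t * f' η) continuous_const (by fun_prop) continuous_const
    G (fun t => by fun_prop) 0 1
  have e := tau_pre K (M.emap (Z := unitInterval) (w := fun _ => w) (b := b) (h := fun _ => h)
    (f := fun t η => (1 - (t : ℝ)) * f η + t * f' η) continuous_const (by fun_prop) continuous_const G)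
    (fun t => (1 - (t : ℝ)) * f h + t * f' h) (by fun_prop)
    (fun t => Subtype.ext (by rw [hK]; rfl)) (a := 0) (b := 1) rfl rfl
  have key : ∀ (u0 u1 : ℝ → ℝ) (c0 : Continuous u0) (c1 : Continuous u1) (G0 : M.RGood b w u0 h)
      (G1 : M.RGood b w u1 h), u0 = f → u1 = f' → M.ray b w u0 c0 h G0 ≫
      tau K (u0 h) (u1 h) (Subtype.ext (hK _)) (Subtype.ext (hK _)) = M.ray b w u1 c1 h G1 →
      M.ray b w f hf h hg ≫ tau K (f h) (f' h) (Subtype.ext (hK _)) (Subtype.ext (hK _)) =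
        M.ray b w f' hf' h hg' := by
    rintro _ _ _ _ _ _ rfl rfl h; exact h
  exact key _ _ _ _ (G 0) (G 1) (by simp) (by simp) ((congrArg (_ ≫ ·) e.symm).trans this)
lemma mix_aux {X : Type} [TopologicalSpace X] {p q a1 a2 a3 a4 : X} {r1 : Hm p a1} {r2 : Hm p a2}
    {r3 : Hm p a3} {r4 : Hm p a4} {s1 : Hm q a1} {s2 : Hm q a2} {s3 : Hm q a3} {s4 : Hm q a4}
    {k12 : Hm a1 a2} {k34 : Hm a3 a4} {k13 : Hm a1 a3} {k24 : Hm a2 a4} (h1 : r1 ≫ k12 = r2)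
    (h2 : r3 ≫ k34 = r4) (h3 : s1 ≫ k13 = s3) (h4 : s2 ≫ k24 = s4) (h5 : k12 ≫ k24 = k13 ≫ k34) :
    r2 ≫ inv s2 = (r1 ≫ inv s1) ≫ inv (r3 ≫ inv s3) ≫ (r4 ≫ inv s4) := by
  have h6 : k34 = inv k13 ≫ k12 ≫ k24 := by rw [h5]; simp
  subst h1 h2 h3 h4 h6
  simp
theorem mix {w : P} {f1 f2 f3 f4 : ℝ → ℝ} (c1 : Continuous f1) (c2 : Continuous f2)
    (c3 : Continuous f3) (c4 : Continuous f4) (g1 : M.Good w f1) (g2 : M.Good w f2)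
    (g3 : M.Good w f3) (g4 : M.Good w f4) (h : ℝ) (hh : ∀ i, (M.z i w).im ≠ h)
    (hl : ∀ i, (M.z i w).im < h →
      (f1 (M.z i w).im < (M.z i w).re ↔ f2 (M.z i w).im < (M.z i w).re) ∧
      (f3 (M.z i w).im < (M.z i w).re ↔ f4 (M.z i w).im < (M.z i w).re))
    (hu : ∀ i, h < (M.z i w).im →
      (f1 (M.z i w).im < (M.z i w).re ↔ f3 (M.z i w).im < (M.z i w).re) ∧
      (f2 (M.z i w).im < (M.z i w).re ↔ f4 (M.z i w).im < (M.z i w).re)) :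
    M.H w f2 c2 g2 = M.H w f1 c1 g1 ≫ inv (M.H w f3 c3 g3) ≫ M.H w f4 c4 g4 := by
  let K : C(ℝ, M.Y) := ⟨fun x => ⟨(w, ⟨x, h⟩), fun i hi => hh i (by
    have : (⟨x, h⟩ : ℂ) = M.z i w := hi
    rw [← this])⟩, Continuous.subtype_mk (Continuous.prodMk continuous_const
      (cont_mk continuous_id continuous_const)) _⟩
  have hK : ∀ x, (K x : P × ℂ) = (w, ⟨x, h⟩) := fun x => rfl
  have L : ∀ i, 0 ≤ sg false * ((M.z i w).im - h) → (M.z i w).im < h := fun i hi =>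
    lt_of_le_of_ne (by simp at hi; linarith) (hh i)
  have U : ∀ i, 0 ≤ sg true * ((M.z i w).im - h) → h < (M.z i w).im := fun i hi =>
    lt_of_le_of_ne (by simp at hi; linarith) (hh i).symm
  simp only [M.H_height w _ _ _ h]
  refine mix_aux (M.ray_mix c1 c2 (g1.r _ _) (g2.r _ _) (fun i hi => (hl i (L i hi)).1) K hK)
    (M.ray_mix c3 c4 (g3.r _ _) (g4.r _ _) (fun i hi => (hl i (L i hi)).2) K hK)
    (M.ray_mix c1 c3 (g1.r _ _) (g3.r _ _) (fun i hi => (hu i (U i hi)).1) K hK)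
    (M.ray_mix c2 c4 (g2.r _ _) (g4.r _ _) (fun i hi => (hu i (U i hi)).2) K hK) ?_
  exact (tau_comp K _ _ _ _).trans (tau_comp K _ _ _ _).symm
end Marks
structure SubG {X : Type} [TopologicalSpace X] (p : X) where
  mem : Hm p p → Prop
  one : mem (𝟙 _)
  mul : ∀ {a b}, mem a → mem b → mem (a ≫ b)
  inv : ∀ {a}, mem a → mem (inv a)
lemma tau_const {X Z : Type} [TopologicalSpace X] [TopologicalSpace Z] [SimplyConnectedSpace Z]
    (y : X) (a b : Z) : tau (ContinuousMap.const Z y) a b (x := y) (y := y) rfl rfl = 𝟙 _ :=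
  (tau_pre (ContinuousMap.const PUnit.{1} y) (ContinuousMap.const Z y) (fun _ => PUnit.unit) continuous_const (fun _ => rfl)
    (a := a) (b := b) (x := y) (y := y) rfl rfl).trans
    (tau_refl _ _ _ _)
lemma tau_pt {X Z : Type} [TopologicalSpace X] [TopologicalSpace Z] [SimplyConnectedSpace Z]
    (F : C(Z, X)) {a b b' : Z} {x y : X} (hx : F a = x) (hy : F b = y) (hy' : F b' = y) (h : b = b') :
    tau F a b hx hy = tau F a b' hx hy' := by subst h; rfl
namespace Marks
variable {P ι : Type} [NormedAddCommGroup P] [NormedSpace ℝ P] (M : Marks P ι)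
def rayT (b : Bool) (w : P) (f : ℝ → ℝ) (hf : Continuous f) (h : ℝ) (hg : M.RGood b w f h) {y : M.Y}
    (hy : (w, ⟨f h, h⟩) = y.1) : Hm (M.pb b) y :=
  (show (⟨(w, ⟨f h, h⟩), hg.mem0⟩ : M.Y) = y from Subtype.ext hy) ▸ M.ray b w f hf h hg
theorem rayT_homotopy {Z : Type} [TopologicalSpace Z] [ContractibleSpace Z] {b : Bool}
    {w : Z → P} {f : Z → ℝ → ℝ} {h : Z → ℝ} (hw : Continuous w)
    (hf : Continuous fun p : Z × ℝ => f p.1 p.2) (hh : Continuous h)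
    (hg : ∀ t, M.RGood b (w t) (f t) (h t)) (hf' : ∀ t, Continuous (f t)) (F : C(Z, M.Y))
    (hF : ∀ t, (w t, ⟨f t (h t), h t⟩) = (F t).1) (t0 t1 : Z) :
    M.rayT b (w t0) (f t0) (hf' t0) (h t0) (hg t0) (hF t0) ≫ tau F t0 t1 rfl rfl =
      M.rayT b (w t1) (f t1) (hf' t1) (h t1) (hg t1) (hF t1) := by
  obtain rfl : F = M.emap hw hf hh hg := by ext t : 1; exact Subtype.ext (hF t).symm
  exact M.ray_homotopy hw hf hh hg hf' t0 t1
lemma rayT_congr {w : P} {b : Bool} {f f' : ℝ → ℝ} (hf : Continuous f) (hf' : Continuous f') {h : ℝ}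
    (hg : M.RGood b w f h) (hg' : M.RGood b w f' h)
    (hs : ∀ i, 0 ≤ sg b * ((M.z i w).im - h) →
      (f (M.z i w).im < (M.z i w).re ↔ f' (M.z i w).im < (M.z i w).re)) {y : M.Y}
    (hy : (w, ⟨f h, h⟩) = y.1) (hy' : (w, ⟨f' h, h⟩) = y.1) :
    M.rayT b w f hf h hg hy = M.rayT b w f' hf' h hg' hy' := by
  have e : f h = f' h := by have := hy.trans hy'.symm; simpa using this
  have G : ∀ t : unitInterval, M.RGood b w (fun η => (1 - (t : ℝ)) * f η + t * f' η) h := fun t i hi =>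
    conv_ne (hs i hi) (hg i hi) (hg' i hi) t.2.1 t.2.2
  have := M.rayT_homotopy (Z := unitInterval) (w := fun _ => w) (b := b) (h := fun _ => h)
    (f := fun t η => (1 - (t : ℝ)) * f η + t * f' η) continuous_const (by fun_prop) continuous_const
    G (fun t => by fun_prop) (ContinuousMap.const _ y) (fun t => by
      change _ = y.1
      rw [← hy']; simp only [e]; congr 2; ring) 0 1
  have this := (Category.comp_id _).symm.trans ((congrArg (_ ≫ ·) (tau_const y _ _).symm).trans this)
  have key : ∀ (u0 u1 : ℝ → ℝ) (c0 : Continuous u0) (c1 : Continuous u1) (G0 : M.RGood b w u0 h)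
      (G1 : M.RGood b w u1 h) (h0 : (w, ⟨u0 h, h⟩) = y.1) (h1 : (w, ⟨u1 h, h⟩) = y.1),
      u0 = f → u1 = f' → M.rayT b w u0 c0 h G0 h0 = M.rayT b w u1 c1 h G1 h1 →
      M.rayT b w f hf h hg hy = M.rayT b w f' hf' h hg' hy' := by
    rintro _ _ _ _ _ _ _ _ rfl rfl h; exact h
  exact key _ _ _ _ (G 0) (G 1) _ _ (by simp) (by simp) this
lemma rayT_H {w : P} {f : ℝ → ℝ} (hf : Continuous f) (hg : M.Good w f) (h : ℝ) {y : M.Y}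
    (hy : (w, ⟨f h, h⟩) = y.1) :
    M.rayT false w f hf h (hg.r _ _) hy ≫ inv (M.rayT true w f hf h (hg.r _ _) hy) = M.H w f hf hg := by
  obtain ⟨y, hy0⟩ := y
  obtain rfl : (w, ⟨f h, h⟩) = y := hy
  rw [M.H_height w f hf hg h]; rfl
lemma rayT_ratio {w : P} {f1 f2 : ℝ → ℝ} (h1 : Continuous f1) (h2 : Continuous f2) {h : ℝ}
    (g1 : M.RGood false w f1 h) (g2 : M.RGood true w f2 h) {y : M.Y}
    (hy1 : (w, ⟨f1 h, h⟩) = y.1) (hy2 : (w, ⟨f2 h, h⟩) = y.1) :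
    ∃ f, ∃ hf : Continuous f, ∃ hg : M.Good w f,
    M.rayT false w f1 h1 h g1 hy1 ≫ inv (M.rayT true w f2 h2 h g2 hy2) = M.H w f hf hg := by
  have e : f1 h = f2 h := by have := hy1.trans hy2.symm; simpa using this
  let f : ℝ → ℝ := fun s => if s ≤ h then f1 s else f2 s
  have hf : Continuous f := Continuous.if_le h1 h2 continuous_id continuous_const
    (by rintro x rfl; exact e)
  have a1 : ∀ s, s ≤ h → f s = f1 s := fun s hs => by simp [f, hs]
  have a2 : ∀ s, h ≤ s → f s = f2 s := fun s hs => by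
    rcases hs.eq_or_lt with rfl | hs
    · simp [f, e]
    · simp [f, hs]
  have hg : M.Good w f := fun i => by
    rcases le_total (M.z i w).im h with hi | hi
    · rw [a1 _ hi]; exact g1 i (by simp [hi])
    · rw [a2 _ hi]; exact g2 i (by simp [hi])
  refine ⟨f, hf, hg, ?_⟩
  have hy : (w, ⟨f h, h⟩) = y.1 := by rw [a1 h le_rfl]; exact hy1
  rw [← M.rayT_H hf hg h hy, M.rayT_congr h1 hf g1 (hg.r _ _) (fun i hi => by
      rw [a1 _ (by simpa using hi)]) hy1 hy,
    M.rayT_congr h2 hf g2 (hg.r _ _) (fun i hi => by rw [a2 _ (by simpa using hi)]) hy2 hy]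
lemma rayT_base {f : ℝ → ℝ} (hf : Continuous f) {b : Bool} {h : ℝ} (hg : M.RGood b 0 f h)
    (hy : ((0 : P), ⟨f h, h⟩) = (M.pb b).1) : M.rayT b 0 f hf h hg hy = 𝟙 _ := by
  have hh : h = sg b * (M.ρ 0 + 1) := (congrArg (fun q => q.2.im) hy)
  have key : ∀ (y : M.Y) (e : (⟨(0, ⟨f h, h⟩), hg.mem0⟩ : M.Y) = y) (hy : y.1 ∈ M.En b), 
     (e ▸ M.ray b 0 f hf h hg : Hm (M.pb b) y) =
      tau (seg (M.En_sub b)) ⟨_, M.base_mem b⟩ ⟨_, hy⟩ rfl rfl := by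
    rintro _ rfl hy
    have hE : ∀ s, (M.rmap b 0 f hf h hg s : P × ℂ) ∈ M.En b := fun s => by
      change M.ρ 0 < sg b * (h + sg b * max s 0)
      have := le_max_right s 0; have := sg_sq b
      have : sg b * (h + sg b * max s 0) = M.ρ 0 + 1 + max s 0 := by
        rw [hh]; linear_combination (M.ρ 0 + 1 + max s 0) * this
      rw [this]; linarith
    have e := tau_pre (seg (M.En_sub b)) (M.rmap b 0 f hf h hg) (fun s => ⟨_, hE s⟩)
      ((continuous_subtype_val.comp (ContinuousMap.continuous _)).subtype_mk _)
      (fun s => rfl) (a := M.ρ 0 + |h| + 1) (b := 0) rfl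
      (show _ = (⟨(0, ⟨f h, h⟩), hg.mem0⟩ : M.Y) by simp [rmap])
    exact (congrArg (_ ≫ ·) e).trans ((tau_comp _ _ _ _ _).trans (tau_pt _ _ _ _
      (Subtype.ext (by simp [rmap]))))
  exact (key _ (Subtype.ext hy) (M.base_mem b)).trans (tau_refl _ _ _ _)
lemma isOpen_RGood [Finite ι] {T : Type} [TopologicalSpace T] {w : T → P} {f : T → ℝ → ℝ} {h : T → ℝ}
    (b : Bool) (hw : Continuous w) (hf : Continuous fun p : T × ℝ => f p.1 p.2) (hh : Continuous h) :
    IsOpen {t | M.RGood b (w t) (f t) (h t)} := by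
  have : {t | M.RGood b (w t) (f t) (h t)} = ⋂ i, ({t | sg b * ((M.z i (w t)).im - h t) < 0} ∪
      {t | f t (M.z i (w t)).im ≠ (M.z i (w t)).re}) := by
    ext t; simp only [RGood, Set.mem_ofPred_eq, Set.mem_iInter, Set.mem_union, ← not_le, imp_iff_not_or]
  rw [this]
  refine isOpen_iInter_of_finite fun i => ?_
  have := M.hz i
  exact (isOpen_lt (by fun_prop) continuous_const).union (isOpen_ne_fun
    (hf.comp (continuous_id.prodMk (by fun_prop : Continuous fun t => (M.z i (w t)).im))) (by fun_prop))
def E (V : Hm (M.pb false) (M.pb true)) : ∀ b, Hm (M.pb false) (M.pb b)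
  | false => 𝟙 _
  | true => V
variable {M}
def Q (Γ : SubG (M.pb false)) (V : Hm (M.pb false) (M.pb true)) {y : M.Y} (m : Hm (M.pb false) y) (b : Bool)
    (r : Hm (M.pb b) y) : Prop := Γ.mem (m ≫ inv r ≫ inv (M.E V b))
lemma Q_flip {Γ : SubG (M.pb false)} {V : Hm (M.pb false) (M.pb true)} {y : M.Y} {m : Hm (M.pb false) y}
    (r : ∀ b, Hm (M.pb b) y) (h : Γ.mem ((r false ≫ inv (r true)) ≫ inv V)) {b : Bool}
    (hb : Q Γ V m b (r b)) (b' : Bool) : Q Γ V m b' (r b') := by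
  rcases Bool.eq_false_or_eq_true b with rfl | rfl <;> rcases Bool.eq_false_or_eq_true b' with rfl | rfl
  · exact hb
  · have := Γ.mul hb (Γ.inv h)
    simpa [Q, E] using this
  · have := Γ.mul hb h
    simpa [Q, E] using this
  · exact hb
def thr (k x h : ℝ) : ℝ → ℝ := fun s => x + k * (s - h)
lemma thr_c (k x h : ℝ) : Continuous (thr k x h) := by unfold thr; fun_prop
theorem locconst {X : Type} [TopologicalSpace X] [PreconnectedSpace X] (S : X → Prop)
    (h : ∀ x, ∀ᶠ y in nhds x, (S y ↔ S x)) (a b : X) (ha : S a) : S b := by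
  have : IsLocallyConstant S := (IsLocallyConstant.iff_eventually_eq S).2
    (fun x => (h x).mono fun y hy => propext hy)
  rwa [← this.apply_eq_of_preconnectedSpace a b]
theorem planar [Finite ι] {Γ : SubG (M.pb false)} {V : Hm (M.pb false) (M.pb true)} (w : P) (e : ℝ)
    (hd : ∀ i j, (M.z i w).re - e * (M.z i w).im = (M.z j w).re - e * (M.z j w).im → i = j)
    (hG : ∀ x h, ∀ hg : M.Good w (thr e x h), Γ.mem (M.H w (thr e x h) (thr_c e x h) hg ≫ inv V))
    (f : ℝ → ℝ) (hf : Continuous f) (hg : M.Good w f) : Γ.mem (M.H w f hf hg ≫ inv V) := by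
  let F : C(ℝ, M.Y) := ⟨fun η => ⟨(w, ⟨f η, η⟩), ((hg.r false η).mem0)⟩,
    Continuous.subtype_mk (Continuous.prodMk continuous_const (cont_mk hf continuous_id)) _⟩
  have hF : ∀ η, (w, ⟨thr e (f η) η η, η⟩) = (F η).1 := fun η => by simp [F, thr]
  let m : ∀ η, Hm (M.pb false) (F η) := fun η => M.rayT false w f hf η (hg.r _ _) (y := F η) rfl
  let R : ∀ η b, M.RGood b w (thr e (f η) η) η → Hm (M.pb b) (F η) := fun η b hr =>
    M.rayT b w (thr e (f η) η) (thr_c _ _ _) η hr (hF η)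
  let S : ℝ → Prop := fun η => ∀ b hr, Q Γ V (m η) b (R η b hr)
  have flip : ∀ η b hr, Q Γ V (m η) b (R η b hr) → S η := by
    intro η b hr hq b' hr'
    rcases eq_or_ne b b' with rfl | hb
    · exact hq
    have hr2 : ∀ c, M.RGood c w (thr e (f η) η) η := by
      intro c
      rcases Bool.eq_false_or_eq_true b with rfl | rfl <;>
      rcases Bool.eq_false_or_eq_true b' with rfl | rfl <;>
      rcases Bool.eq_false_or_eq_true c with rfl | rfl <;> simp at hb <;> assumption
    have hg2 : M.Good w (thr e (f η) η) := fun i => by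
      rcases le_total (M.z i w).im η with hi | hi
      · exact hr2 false i (by simp [hi])
      · exact hr2 true i (by simp [hi])
    refine Q_flip (fun c => R η c (hr2 c)) ?_ hq b'
    have := M.rayT_H (thr_c _ _ _) hg2 η (hF η)
    rw [show R η false (hr2 false) ≫ inv (R η true (hr2 true)) = _ from this]
    exact hG _ _ hg2
  have exg : ∀ η, ∃ b, M.RGood b w (thr e (f η) η) η := by
    intro η
    by_contra hcon
    push Not at hcon
    have h1 := hcon true; have h2 := hcon false
    simp only [RGood, not_forall, not_not] at h1 h2
    obtain ⟨i, hi, hi'⟩ := h1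
    obtain ⟨j, hj, hj'⟩ := h2
    simp only [thr, sg_t, sg_f] at *
    obtain rfl : i = j := hd i j (by rw [← hi', ← hj']; ring)
    obtain hh : (M.z i w).im = η := by linarith
    exact hg i (by rw [← hi', hh]; ring)
  have loc : ∀ η, ∀ᶠ η' in nhds η, (S η' ↔ S η) := by
    intro η
    obtain ⟨b, hb⟩ := exg η
    have ho := M.isOpen_RGood (w := fun _ => w) (f := fun η => thr e (f η) η) (h := fun η => η) b
      continuous_const (by unfold thr; fun_prop) continuous_id
    obtain ⟨ε, hε, hsub⟩ := Metric.isOpen_iff.1 ho η hb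
    filter_upwards [Metric.ball_mem_nhds η hε] with η' hη'
    have : Fact (0 < ε) := ⟨hε⟩
    have step : ∀ a a' : Metric.ball η ε, S a → S a' := by
      intro a a' ha
      refine flip a' b (hsub a'.2) ?_
      have h1 := ha b (hsub a.2)
      have e1 := M.rayT_homotopy (Z := Metric.ball η ε) (w := fun _ => w) (f := fun t => thr e (f t) t)
        (h := fun t => t) (b := b) continuous_const (by unfold thr; fun_prop) (by fun_prop)
        (fun t => hsub t.2) (fun t => thr_c _ _ _) (F.comp ⟨Subtype.val, by fun_prop⟩) (fun t => hF t) a a'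
      have e2 := M.rayT_homotopy (Z := Metric.ball η ε) (w := fun _ => w) (f := fun t => f)
        (h := fun t => t) (b := false) continuous_const (by fun_prop) (by fun_prop)
        (fun t => hg.r _ _) (fun t => hf) (F.comp ⟨Subtype.val, by fun_prop⟩) (fun t => rfl) a a'
      have e3 := two_aux _ e2 e1
      have e4 : m a ≫ inv (R a b (hsub a.2)) = m a' ≫ inv (R a' b (hsub a'.2)) := e3
      unfold Q at h1 ⊢
      rw [← Category.assoc] at h1 ⊢
      rwa [← e4]
    exact ⟨step ⟨η', hη'⟩ ⟨η, Metric.mem_ball_self hε⟩, step ⟨η, Metric.mem_ball_self hε⟩ ⟨η', hη'⟩⟩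
  have bd := fun i => abs_lt.1 (M.bd i w)
  have hlow : S (-M.ρ w) := by
    have hv : ∀ i, ¬ (0 ≤ sg false * ((M.z i w).im - (-M.ρ w))) := fun i hi => by
      simp at hi; linarith [(bd i).1]
    refine flip _ false (fun i hi => absurd hi (hv i)) ?_
    have : R (-M.ρ w) false (fun i hi => absurd hi (hv i)) = m (-M.ρ w) :=
      M.rayT_congr _ _ _ _ (fun i hi => absurd hi (hv i)) _ _
    rw [this]; simpa [Q, E] using Γ.one
  have hv : ∀ i, ¬ (0 ≤ sg true * ((M.z i w).im - (M.ρ w))) := fun i hi => by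
    simp at hi; linarith [(bd i).2]
  have := locconst S loc (-M.ρ w) (M.ρ w) hlow true (fun i hi => absurd hi (hv i))
  have e1 : R (M.ρ w) true (fun i hi => absurd hi (hv i)) = M.rayT true w f hf _ (hg.r _ _) (y := F (M.ρ w)) rfl :=
      M.rayT_congr _ _ _ _ (fun i hi => absurd hi (hv i)) _ _
  rw [e1] at this
  unfold Q at this
  rw [← Category.assoc] at this
  rwa [← M.rayT_H hf hg (M.ρ w) (y := F (M.ρ w)) rfl]
end Marks
namespace Marks
variable {P ι : Type} [NormedAddCommGroup P] [NormedSpace ℝ P] {M : Marks P ι}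
lemma exists_slope [Finite ι] (q : M.Y) : ∃ k, M.Good q.1.1 (thr k q.1.2.re q.1.2.im) := by
  obtain ⟨k, hk⟩ := (Set.finite_range fun i => ((M.z i q.1.1).re - q.1.2.re) /
    ((M.z i q.1.1).im - q.1.2.im)).exists_notMem
  refine ⟨k, fun i hi => ?_⟩
  unfold thr at hi
  by_cases h : (M.z i q.1.1).im - q.1.2.im = 0
  · rw [h, mul_zero, add_zero] at hi
    exact q.2 i (Complex.ext hi (by linarith))
  · exact hk ⟨i, by simp only; rw [← hi]; field_simp; ring⟩
def sray (b : Bool) (k : ℝ) (q : M.Y) (hr : M.RGood b q.1.1 (thr k q.1.2.re q.1.2.im) q.1.2.im) :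
    Hm (M.pb b) q := M.rayT b q.1.1 (thr k q.1.2.re q.1.2.im) (thr_c _ _ _) q.1.2.im hr (by simp [thr])
theorem gen1 [Finite ι] {Γ : SubG (M.pb false)} {V : Hm (M.pb false) (M.pb true)}
    (hG : ∀ w f hf, ∀ hg : M.Good w f, Γ.mem (M.H w f hf hg ≫ inv V)) (m : Hm (M.pb false) (M.pb false)) :
    Γ.mem m := by
  have flip1 : ∀ (q : M.Y) (m : Hm (M.pb false) q) b k hr k' hr', Q Γ V m b (sray b k q hr) →
      Q Γ V m (!b) (sray (!b) k' q hr') := by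
    intro q m b k hr k' hr' h
    have : ∀ r : ∀ b, Hm (M.pb b) q, Γ.mem ((r false ≫ inv (r true)) ≫ inv V) →
      r b = sray b k q hr → r (!b) = sray (!b) k' q hr' → Q Γ V m (!b) (sray (!b) k' q hr') := by
      intro r h1 h2 h3
      rw [← h3]; rw [← h2] at h; exact Q_flip r h1 h _
    cases b
    · refine this (fun b => match b with
        | false => sray false k q hr
        | true => sray true k' q hr') ?_ rfl rfl
      obtain ⟨f, hf, hg, e⟩ := M.rayT_ratio (thr_c _ _ _) (thr_c _ _ _) hr hr' (y := q) (by simp [thr]) (by simp [thr])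
      exact (congrArg (fun t => Γ.mem (t ≫ inv V)) e).mpr (hG _ _ hf hg)
    · refine this (fun b => match b with
        | false => sray false k' q hr'
        | true => sray true k q hr) ?_ rfl rfl
      obtain ⟨f, hf, hg, e⟩ := M.rayT_ratio (thr_c _ _ _) (thr_c _ _ _) hr' hr (y := q) (by simp [thr]) (by simp [thr])
      exact (congrArg (fun t => Γ.mem (t ≫ inv V)) e).mpr (hG _ _ hf hg)
  have flip : ∀ (q : M.Y) (m : Hm (M.pb false) q) b k hr b' k' hr', Q Γ V m b (sray b k q hr) →
      Q Γ V m b' (sray b' k' q hr') := by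
    intro q m b k hr b' k' hr' h
    by_cases hb : b' = !b
    · subst hb; exact flip1 q m b k hr k' hr' h
    · obtain rfl : b' = b := by cases b <;> cases b' <;> simp_all
      obtain ⟨k0, hk0⟩ := exists_slope q
      have := flip1 q m _ k0 (hk0.r _ _) k' (by simpa using hr') (flip1 q m b' k hr k0 (hk0.r _ _) h)
      cases b' <;> exact this
  have hr0 : M.RGood false (M.pb false).1.1 (thr 0 (M.pb false).1.2.re (M.pb false).1.2.im) (M.pb false).1.2.im := by
    intro i hi
    exfalso
    have hb := abs_lt.1 (M.bd i 0)
    change 0 ≤ sg false * ((M.z i 0).im - sg false * (M.ρ 0 + 1)) at hi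
    simp at hi; linarith
  have := pathInduct (A := M.Y) (x0 := M.pb false)
    (fun q m => ∀ b k hr, Q Γ V m b (sray b k q hr)) ?_ ?_ _ m false 0 hr0
  · have e : sray false 0 (M.pb false) hr0 = 𝟙 _ := M.rayT_base (thr_c _ _ _) _ _
    rw [e] at this
    simpa [Q, E] using this
  · intro b k hr
    refine flip _ _ false 0 hr0 _ _ _ ?_
    have e : sray false 0 (M.pb false) hr0 = 𝟙 _ := M.rayT_base (thr_c _ _ _) _ _
    rw [e]; simpa [Q, E] using Γ.one
  · intro q
    obtain ⟨k, hk⟩ := exists_slope q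
    have ho := M.isOpen_RGood (T := P × ℂ) (w := fun q => q.1) (f := fun q => thr k q.2.re q.2.im)
      (h := fun q => q.2.im) false (by fun_prop) (by unfold thr; fun_prop) (by fun_prop)
    obtain ⟨ε, hε, hB⟩ := Metric.isOpen_iff.1 ho q.1 (hk.r false _)
    have hY : Metric.ball (q : P × ℂ) ε ⊆ M.Y := fun p hp => by
      have := (hB hp).mem0
      simpa [thr] using this
    have : Fact (0 < ε) := ⟨hε⟩
    refine ⟨ε, this, hY, fun q1 q2 m hm b k' hr => ?_⟩
    refine flip _ _ false k (hB q2.2) _ _ _ ?_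
    have h1 := hm false k (hB q1.2)
    have e := M.rayT_homotopy (Z := Metric.ball (q : P × ℂ) ε) (w := fun p => p.1.1)
      (f := fun p => thr k p.1.2.re p.1.2.im) (h := fun p => p.1.2.im) (b := false) (by fun_prop)
      (by unfold thr; fun_prop) (by fun_prop) (fun t => hB t.2) (fun t => thr_c _ _ _)
      (seg hY) (fun t => by simp [thr, seg]) q1 q2
    have e' : sray false k (seg hY q1) (hB q1.2) ≫ tau (seg hY) q1 q2 rfl rfl = sray false k (seg hY q2) (hB q2.2) := e
    unfold Q at h1 ⊢
    rw [← e']; simpa using h1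
lemma isOpen_Good [Finite ι] {T : Type} [TopologicalSpace T] {w : T → P} {f : T → ℝ → ℝ}
    (hw : Continuous w) (hf : Continuous fun p : T × ℝ => f p.1 p.2) :
    IsOpen {t | M.Good (w t) (f t)} := by
  have : {t | M.Good (w t) (f t)} = ⋂ i, {t | f t (M.z i (w t)).im ≠ (M.z i (w t)).re} := by
    ext t; simp only [Good, Set.mem_ofPred_eq, Set.mem_iInter]
  rw [this]
  refine isOpen_iInter_of_finite fun i => ?_
  have := M.hz i
  exact isOpen_ne_fun
    (hf.comp (continuous_id.prodMk (by fun_prop : Continuous fun t => (M.z i (w t)).im))) (by fun_prop)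
theorem gen2 [Finite ι] {M : Marks ℂ ι} {Γ : SubG (M.pb false)} {V : Hm (M.pb false) (M.pb true)}
    (hΔ : {w | ∃ i j, i ≠ j ∧ M.z i w = M.z j w}.Countable) (w0 : ℂ)
    (hw0 : ∀ i j, M.z i w0 = M.z j w0 → i = j)
    (hG : ∀ f hf, ∀ hg : M.Good w0 f, Γ.mem (M.H w0 f hf hg ≫ inv V)) (m : Hm (M.pb false) (M.pb false)) :
    Γ.mem m := by
  refine gen1 (V := V) ?_ m
  set Δ := {w | ∃ i j, i ≠ j ∧ M.z i w = M.z j w}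
  have hrk : 1 < Module.rank ℝ ℂ := by simp
  have : PreconnectedSpace (Δᶜ : Set ℂ) := isPreconnected_iff_preconnectedSpace.1
    (hΔ.isConnected_compl_of_one_lt_rank hrk).isPreconnected
  have key : ∀ w : (Δᶜ : Set ℂ), ∀ f hf, ∀ hg : M.Good w f, Γ.mem (M.H w f hf hg ≫ inv V) := by
    refine fun w => locconst (fun w : (Δᶜ : Set ℂ) => ∀ f hf, ∀ hg : M.Good w f, Γ.mem (M.H w f hf hg ≫ inv V)) ?_
      ⟨w0, by rintro ⟨i, j, h1, h2⟩; exact h1 (hw0 i j h2)⟩ w hG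
    rintro ⟨w, hw⟩
    obtain ⟨e, he⟩ := (Set.finite_range fun p : ι × ι => ((M.z p.1 w).re - (M.z p.2 w).re) /
      ((M.z p.1 w).im - (M.z p.2 w).im)).exists_notMem
    let s : ι → ℂ → ℝ := fun i w => (M.z i w).re - e * (M.z i w).im
    have hs : ∀ i, Continuous (s i) := fun i => by have := M.hz i; fun_prop
    have hd : ∀ i j, i ≠ j → s i w ≠ s j w := by
      intro i j hij h
      by_cases h0 : (M.z i w).im - (M.z j w).im = 0
      · refine hw ⟨i, j, hij, Complex.ext ?_ (by linarith)⟩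
        simp only [s] at h; rw [sub_eq_zero.1 h0] at h; linarith
      · refine he ⟨(i, j), ?_⟩
        simp only [s] at h ⊢
        field_simp; linarith
    have h1 : ∀ᶠ δ in nhdsWithin (0 : ℝ) (Set.Ioi 0), ∀ i j, i ≠ j → 4 * δ < |s i w - s j w| := by
      rw [Filter.eventually_all]; intro i; rw [Filter.eventually_all]; intro j
      by_cases hij : i = j
      · simp [hij]
      have : Filter.Tendsto (fun δ : ℝ => 4 * δ) (nhdsWithin 0 (Set.Ioi 0)) (nhds 0) := by
        have : Continuous (fun δ : ℝ => 4 * δ) := by fun_prop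
        have := this.tendsto 0
        rw [mul_zero] at this
        exact this.mono_left nhdsWithin_le_nhds
      exact (this.eventually_lt_const (abs_pos.2 (sub_ne_zero.2 (hd i j hij)))).mono fun _ h _ => h
    obtain ⟨δ, hδ, hδ0⟩ := (h1.and self_mem_nhdsWithin).exists
    have h2 : ∀ᶠ w' in nhds w, ∀ i, |s i w' - s i w| < δ := by
      rw [Filter.eventually_all]; intro i
      exact (Metric.continuous_iff'.1 (hs i) w δ hδ0)
    obtain ⟨ε, hε, hB⟩ := Metric.eventually_nhds_iff_ball.1 h2
    have : Fact (0 < ε) := ⟨hε⟩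
    have hsep : ∀ w' ∈ Metric.ball w ε, ∀ i j, s i w' ≤ s j w' → i ≠ j → s i w + 4 * δ < s j w := by
      intro w' hw' i j hij hne
      have a1 := abs_lt.1 (hB w' hw' i); have a2 := abs_lt.1 (hB w' hw' j)
      rcases lt_abs.1 (hδ i j hne) with h | h <;> linarith
    have gate : ∀ w' ∈ Metric.ball w ε, ∀ x, (∀ i, s i w' ≠ x) → ∃ m, ∀ w'' ∈ Metric.ball w ε, ∀ i,
        m ≠ s i w'' ∧ (m < s i w'' ↔ x < s i w') := by
      intro w' hw' x hx
      classical
      cases nonempty_fintype ι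
      by_cases hL : (Finset.univ.filter fun i => s i w' < x).Nonempty
      · obtain ⟨i, hi, hmax⟩ := Finset.exists_max_image _ (fun i => s i w') hL
        simp only [Finset.mem_filter, Finset.mem_univ, true_and] at hi hmax
        refine ⟨s i w + δ, fun w'' hw'' j => ?_⟩
        have a1 := abs_lt.1 (hB w'' hw'' j)
        by_cases hj : s j w' < x
        · have : s j w ≤ s i w := by
            by_cases hji : j = i
            · rw [hji]
            · have := hsep w' hw' j i (hmax j hj) hji
              have : 0 < δ := hδ0
              linarith
          exact ⟨by intro h; linarith, ⟨fun h => by linarith, fun h => by linarith⟩⟩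
        · have : s i w + 4 * δ < s j w := hsep w' hw' i j (by linarith) (by rintro rfl; exact hj hi)
          have h3 : s i w + δ < s j w'' := by have : 0 < δ := hδ0; linarith
          exact ⟨h3.ne, ⟨fun _ => lt_of_le_of_ne (not_lt.1 hj) (hx j).symm, fun _ => h3⟩⟩
      · obtain ⟨m, hm⟩ := (Set.finite_range fun i => s i w - δ).bddBelow
        refine ⟨m, fun w'' hw'' i => ?_⟩
        have a1 := abs_lt.1 (hB w'' hw'' i)
        have := hm ⟨i, rfl⟩
        have h3 : m < s i w'' := by simp only at this; linarith
        refine ⟨h3.ne, ⟨fun _ => ?_, fun _ => h3⟩⟩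
        by_contra h
        exact hL ⟨i, by simpa using lt_of_le_of_ne (not_lt.1 h) (hx i)⟩
    have step : ∀ a a' : Metric.ball w ε, (∀ f hf, ∀ hg : M.Good a f, Γ.mem (M.H a f hf hg ≫ inv V)) →
        ∀ f hf, ∀ hg : M.Good a' f, Γ.mem (M.H a' f hf hg ≫ inv V) := by
      intro a a' ha f hf hg
      refine planar _ e ?_ ?_ f hf hg
      · intro i j hij
        by_contra hne
        have := hsep _ a'.2 i j hij.le hne
        have := hsep _ a'.2 j i hij.ge (Ne.symm hne)
        have : 0 < δ := hδ0
        linarith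
      · intro x h hg
        obtain ⟨m, hm⟩ := gate a' a'.2 (x - e * h) (fun i hi => hg i (by
          simp only [thr, s] at hi ⊢; linarith))
        have g : ∀ t : Metric.ball w ε, M.Good t (thr e m 0) := fun t i hi => (hm t t.2 i).1 (by
          simp only [thr, s] at hi ⊢; linarith)
        rw [M.H_congr (thr_c _ _ _) (thr_c e m 0) hg (g a') (fun i => by
          have := (hm a' a'.2 i).2
          simp only [thr, s] at this ⊢
          constructor
          · intro h
            have := this.2 (by linarith)
            linarith
          · intro h
            have := this.1 (by linarith)
            linarith)]
        have := M.H_homotopy (Z := Metric.ball w ε) (w := fun t => t) (f := fun t => thr e m 0) (by fun_prop)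
          (by unfold thr; fun_prop) g (fun t => thr_c _ _ _) a a'
        rw [← this]
        exact ha _ _ _
    have : ∀ᶠ y : (Δᶜ : Set ℂ) in nhds ⟨w, hw⟩, (y : ℂ) ∈ Metric.ball w ε :=
      continuous_subtype_val.continuousAt (Metric.ball_mem_nhds w hε)
    filter_upwards [this] with y hy
    exact ⟨step ⟨y, hy⟩ ⟨w, Metric.mem_ball_self hε⟩, step ⟨w, Metric.mem_ball_self hε⟩ ⟨y, hy⟩⟩
  intro w f hf hg
  have ho := M.isOpen_Good (w := fun w : ℂ => w) (f := fun w => f) continuous_id (by fun_prop)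
  obtain ⟨ε, hε, hB⟩ := Metric.isOpen_iff.1 ho w hg
  have : Fact (0 < ε) := ⟨hε⟩
  obtain ⟨w', hw', hm'⟩ := (hΔ.dense_compl ℝ).exists_mem_open Metric.isOpen_ball ⟨w, Metric.mem_ball_self hε⟩
  have := M.H_homotopy (Z := Metric.ball w ε) (w := fun t => t) (f := fun t => f) (by fun_prop)
          (by fun_prop) (fun t => hB t.2) (fun t => hf) ⟨w, Metric.mem_ball_self hε⟩ ⟨w', hm'⟩
  rw [this]
  exact key ⟨w', hw'⟩ f hf _
end Marks
namespace Marks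
variable {ι : Type}  {M : Marks ℂ ι}
lemma loc_inv {z : ℂ → ℂ} {w1 z' : ℂ} (hd : HasStrictDerivAt z z' w1) (hz' : z' ≠ 0) :
    ∃ ε : ℝ, 0 < ε ∧ ∃ ω : Metric.ball (0 : ℂ) ε → ℂ, Continuous ω ∧ (∀ ζ, z (ω ζ) = z w1 + ζ) ∧
      ∃ U ∈ nhds w1, ∀ w ∈ U, ∀ h : z w - z w1 ∈ Metric.ball (0 : ℂ) ε, ω ⟨_, h⟩ = w := by
  let e := (hd.hasStrictFDerivAt_equiv hz').toOpenPartialHomeomorph z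
  have he : ⇑e = z := rfl
  have hs : w1 ∈ e.source := HasStrictFDerivAt.mem_toOpenPartialHomeomorph_source _
  have ht : z w1 ∈ e.target := e.map_source hs
  obtain ⟨ε, hε, hB⟩ := Metric.isOpen_iff.1 e.open_target _ ht
  have hm : ∀ ζ : Metric.ball (0 : ℂ) ε, z w1 + ζ ∈ e.target := fun ζ => hB (by
    have := mem_ball_zero_iff.1 ζ.2; simpa [Metric.mem_ball, dist_eq_norm] using this)
  refine ⟨ε, hε, fun ζ => e.symm (z w1 + ζ), ?_, fun ζ => e.right_inv (hm ζ), e.source,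
    e.open_source.mem_nhds hs, fun w hw h => ?_⟩
  · exact e.continuousOn_symm.comp_continuous (by fun_prop) hm
  · have := e.left_inv hw
    rw [he] at this
    simpa using this
theorem crossing [Finite ι] {j k : ι} (b : ℂ) (hk : ∀ w, M.z k w = b) {w1 : ℂ}
    (hj : M.z j w1 = b) {z' : ℂ} (hd : HasStrictDerivAt (M.z j) z' w1) (hz' : z' ≠ 0) (κ : ℝ)
    (hf0 : ∀ i, i ≠ j → i ≠ k → thr κ b.re b.im (M.z i w1).im ≠ (M.z i w1).re) :
    ∃ U ∈ nhds w1, ∃ N M1 R M2 : Hm (M.pb false) (M.pb true), M2 = N ≫ inv M1 ≫ R ∧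
      M2 = R ≫ inv M1 ≫ N ∧ ∀ w ∈ U, ∀ f hf, ∀ hg : M.Good w f,
      (∀ i, i ≠ j → i ≠ k → (f (M.z i w).im < (M.z i w).re ↔
        thr κ b.re b.im (M.z i w1).im < (M.z i w1).re)) →
      (f b.im < b.re → f (M.z j w).im < (M.z j w).re → M.H w f hf hg = N) ∧
      (b.re < f b.im → (M.z j w).re < f (M.z j w).im → M.H w f hf hg = R) ∧
      ((M.z j w).re ≤ thr κ b.re b.im (M.z j w).im → f b.im < b.re →
        (M.z j w).re < f (M.z j w).im → M.H w f hf hg = M1) ∧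
      (thr κ b.re b.im (M.z j w).im ≤ (M.z j w).re → b.re < f b.im →
        f (M.z j w).im < (M.z j w).re → M.H w f hf hg = M2) := by
  obtain ⟨ε0, hε0, ω, hω, hωz, U0, hU0, hU0'⟩ := loc_inv hd hz'
  rw [hj] at hωz
  simp only [hj] at hU0'
  let B0 := Metric.ball (0 : ℂ) ε0
  let o : B0 := ⟨0, Metric.mem_ball_self hε0⟩
  have ho : ω o = w1 := by
    have := hU0' w1 (mem_of_mem_nhds hU0) (by simpa [hj] using hε0)
    simpa [hj] using this
  let G : B0 × ℝ × ℝ → ℝ → ℝ := fun t η => thr κ b.re b.im η + (t.2.1 + t.2.2 * (η - b.im - (t.1 : ℂ).im / 2))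
  have hGc : Continuous fun p : (B0 × ℝ × ℝ) × ℝ => G p.1 p.2 := by simp only [G, thr]; fun_prop
  have hGc1 : ∀ t, Continuous (G t) := fun t => by simp only [G, thr]; fun_prop
  have hoth : ∀ᶠ t : B0 × ℝ × ℝ in nhds (o, 0, 0), ∀ i, i ≠ j → i ≠ k →
      G t (M.z i (ω t.1)).im ≠ (M.z i (ω t.1)).re ∧
      (G t (M.z i (ω t.1)).im < (M.z i (ω t.1)).re ↔ thr κ b.re b.im (M.z i w1).im < (M.z i w1).re) := by
    rw [Filter.eventually_all]; intro i
    by_cases h1 : i = j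
    · exact Filter.Eventually.of_forall fun _ h => absurd h1 h
    by_cases h2 : i = k
    · exact Filter.Eventually.of_forall fun _ _ h => absurd h2 h
    have hzi := M.hz i
    have c1 : Continuous fun t : B0 × ℝ × ℝ => G t (M.z i (ω t.1)).im :=
      hGc.comp (continuous_id.prodMk (by fun_prop : Continuous fun t : B0 × ℝ × ℝ => (M.z i (ω t.1)).im))
    have c2 : Continuous fun t : B0 × ℝ × ℝ => (M.z i (ω t.1)).re := by fun_prop
    have e1 : G (o, 0, 0) (M.z i (ω o)).im = thr κ b.re b.im (M.z i w1).im := by simp [G, ho]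
    rcases lt_or_gt_of_ne (hf0 i h1 h2) with h | h
    · have : ∀ᶠ t : B0 × ℝ × ℝ in nhds (o, 0, 0), G t (M.z i (ω t.1)).im < (M.z i (ω t.1)).re :=
        (isOpen_lt c1 c2).mem_nhds (by simp only [Set.mem_ofPred_eq]; rw [e1, ho]; exact h)
      filter_upwards [this] with t ht _ _
      exact ⟨ht.ne, by simp [ht, h]⟩
    · have : ∀ᶠ t : B0 × ℝ × ℝ in nhds (o, 0, 0), (M.z i (ω t.1)).re < G t (M.z i (ω t.1)).im :=
        (isOpen_lt c2 c1).mem_nhds (by simp only [Set.mem_ofPred_eq]; rw [e1, ho]; exact h)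
      filter_upwards [this] with t ht _ _
      exact ⟨ht.ne', iff_of_false (not_lt.2 ht.le) (not_lt.2 h.le)⟩
  obtain ⟨ε, hε, hB⟩ := Metric.eventually_nhds_iff_ball.1 hoth
  have hκ : 0 ≤ |κ| := abs_nonneg κ
  let r : ℝ := min ε0 (ε / (4 * (1 + |κ|)))
  have hr0 : 0 < r := lt_min hε0 (by positivity)
  have hrε : 4 * (1 + |κ|) * r ≤ ε := by
    have := min_le_right ε0 (ε / (4 * (1 + |κ|)))
    rw [le_div_iff₀ (by positivity)] at this
    change r * _ ≤ _ at this
    linarith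
  have hr' : 4 * r ≤ ε := by nlinarith
  let ξ : ℂ → ℝ := fun ζ => ζ.re - κ * ζ.im
  have hξ : ∀ ζ : ℂ, ‖ζ‖ < r → |ξ ζ| < ε / 2 := by
    intro ζ hζ
    have h1 : |ξ ζ| ≤ |ζ.re| + |κ| * |ζ.im| := by
      rw [← abs_mul]; exact abs_sub _ _
    have h2 := Complex.abs_re_le_norm ζ
    have h3 := Complex.abs_im_le_norm ζ
    nlinarith
  have hoth' : ∀ (t : B0 × ℝ × ℝ), ‖(t.1 : ℂ)‖ < r → |t.2.1| < ε → |t.2.2| < ε → ∀ i, i ≠ j → i ≠ k →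
      G t (M.z i (ω t.1)).im ≠ (M.z i (ω t.1)).re ∧
      (G t (M.z i (ω t.1)).im < (M.z i (ω t.1)).re ↔ thr κ b.re b.im (M.z i w1).im < (M.z i w1).re) := by
    intro t h1 h2 h3
    refine hB t ?_
    rw [Metric.mem_ball, Prod.dist_eq, Prod.dist_eq, max_lt_iff, max_lt_iff]
    refine ⟨?_, by simpa [Real.dist_eq] using h2, by simpa [Real.dist_eq] using h3⟩
    rw [Subtype.dist_eq, dist_eq_norm]; simp only [o, sub_zero]; linarith
  have vb : ∀ t : B0 × ℝ × ℝ, G t b.im - b.re = t.2.1 - t.2.2 * (t.1 : ℂ).im / 2 := fun t => by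
    simp only [G, thr]; ring
  have vj : ∀ t : B0 × ℝ × ℝ, G t (M.z j (ω t.1)).im - (M.z j (ω t.1)).re =
      t.2.1 + t.2.2 * (t.1 : ℂ).im / 2 - ξ t.1 := fun t => by
    rw [hωz]; simp only [G, thr, ξ, Complex.add_im, Complex.add_re]; ring
  have good : ∀ (t : B0 × ℝ × ℝ), ‖(t.1 : ℂ)‖ < r → |t.2.1| < ε → |t.2.2| < ε →
      t.2.1 - t.2.2 * (t.1 : ℂ).im / 2 ≠ 0 → t.2.1 + t.2.2 * (t.1 : ℂ).im / 2 - ξ t.1 ≠ 0 →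
      M.Good (ω t.1) (G t) := by
    intro t h1 h2 h3 h4 h5 i
    by_cases hij : i = j
    · subst hij; rw [← vj] at h5; exact sub_ne_zero.1 h5
    by_cases hik : i = k
    · subst hik; rw [← vb] at h4; rw [hk]; exact sub_ne_zero.1 h4
    exact (hoth' t h1 h2 h3 i hij hik).1
  have main : ∀ (Z : Set ℂ) (c : ℂ) (hZ : StarConvex ℝ c Z) (hc : c ∈ Z) (hZr : ∀ ζ ∈ Z, ‖ζ‖ < r)
      (p q : ℂ → ℝ) (hp : Continuous p) (hq : Continuous q) (h2 : ∀ ζ ∈ Z, |p ζ| < ε)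
      (h3 : ∀ ζ ∈ Z, |q ζ| < ε)
      (h4 : ∀ ζ ∈ Z, p ζ - q ζ * ζ.im / 2 ≠ 0) (h5 : ∀ ζ ∈ Z, p ζ + q ζ * ζ.im / 2 - ξ ζ ≠ 0),
      ∃ A : Hm (M.pb false) (M.pb true), ∀ ζ ∈ Z, ∀ hζ : ζ ∈ B0, ∀ f hf, ∀ hg : M.Good (ω ⟨ζ, hζ⟩) f,
       (∀ i, i ≠ j → i ≠ k → (f (M.z i (ω ⟨ζ, hζ⟩)).im < (M.z i (ω ⟨ζ, hζ⟩)).re ↔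
        thr κ b.re b.im (M.z i w1).im < (M.z i w1).re)) →
       (f b.im < b.re ↔ p ζ - q ζ * ζ.im / 2 < 0) →
       (f (M.z j (ω ⟨ζ, hζ⟩)).im < (M.z j (ω ⟨ζ, hζ⟩)).re ↔ p ζ + q ζ * ζ.im / 2 - ξ ζ < 0) →
       M.H _ f hf hg = A := by
    intro Z c hZ hc hZr p q hp hq h2 h3 h4 h5
    have hm : ∀ ζ ∈ Z, ζ ∈ B0 := fun ζ hζ => by
      have := hZr ζ hζ
      have : r ≤ ε0 := min_le_left _ _
      simp only [B0, mem_ball_zero_iff]; linarith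
    have : ContractibleSpace Z := hZ.contractibleSpace ⟨c, hc⟩
    let T : Z → B0 × ℝ × ℝ := fun ζ => (⟨ζ, hm ζ ζ.2⟩, p ζ, q ζ)
    have hT : Continuous T := by fun_prop
    have gd : ∀ ζ : Z, M.Good (ω (T ζ).1) (G (T ζ)) := fun ζ =>
      good (T ζ) (hZr ζ ζ.2) (h2 ζ ζ.2) (h3 ζ ζ.2) (h4 ζ ζ.2) (h5 ζ ζ.2)
    refine ⟨M.H _ _ (hGc1 _) (gd ⟨c, hc⟩), fun ζ hζ hζ' f hf hg e1 e2 e3 => ?_⟩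
    have := M.H_homotopy (Z := Z) (w := fun ζ => ω (T ζ).1) (f := fun ζ => G (T ζ)) (by fun_prop)
      (hGc.comp (by fun_prop : Continuous fun p : Z × ℝ => (T p.1, p.2))) gd (fun t => hGc1 _) ⟨c, hc⟩ ⟨ζ, hζ⟩
    rw [this]
    refine M.H_congr hf (hGc1 _) hg (gd ⟨ζ, hζ⟩) fun i => ?_
    by_cases hij : i = j
    · subst hij
      rw [e3, ← sub_neg (a := G _ _)]
      exact iff_of_eq (congrArg (· < 0) (vj (T ⟨ζ, hζ⟩)).symm)
    by_cases hik : i = k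
    · subst hik
      rw [hk, e2, ← sub_neg (a := G _ _)]
      exact iff_of_eq (congrArg (· < 0) (vb (T ⟨ζ, hζ⟩)).symm)
    exact (e1 i hij hik).trans (hoth' (T ⟨ζ, hζ⟩) (hZr ζ hζ) (h2 ζ hζ) (h3 ζ hζ) i hij hik).2.symm
  have hξc : Continuous ξ := by fun_prop
  have nr : ∀ p : ℝ, (|p| = ε / 2) → ∃ A : Hm (M.pb false) (M.pb true), ∀ ζ : ℂ, ‖ζ‖ < r → ∀ hζ : ζ ∈ B0, ∀ f hf, ∀ hg : M.Good (ω ⟨ζ, hζ⟩) f,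
       (∀ i, i ≠ j → i ≠ k → (f (M.z i (ω ⟨ζ, hζ⟩)).im < (M.z i (ω ⟨ζ, hζ⟩)).re ↔
        thr κ b.re b.im (M.z i w1).im < (M.z i w1).re)) →
       (f b.im < b.re ↔ p < 0) →
       (f (M.z j (ω ⟨ζ, hζ⟩)).im < (M.z j (ω ⟨ζ, hζ⟩)).re ↔ p < 0) → M.H _ f hf hg = A := by
    intro p hp
    have aux : ∀ ζ : ℂ, ‖ζ‖ < r → p - ξ ζ ≠ 0 ∧ (p - ξ ζ < 0 ↔ p < 0) := by
      intro ζ hζ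
      have h1 := abs_lt.1 (hξ ζ hζ)
      rcases (abs_eq (by positivity)).1 hp with h | h <;> rw [h]
      · exact ⟨by linarith, iff_of_false (by linarith) (by linarith)⟩
      · exact ⟨by linarith, iff_of_true (by linarith) (by linarith)⟩
    obtain ⟨A, hA⟩ := main (Metric.ball 0 r) 0 ((convex_ball 0 r).starConvex (Metric.mem_ball_self hr0))
      (Metric.mem_ball_self hr0) (fun ζ hζ => mem_ball_zero_iff.1 hζ) (fun _ => p) (fun _ => 0) continuous_const continuous_const
      (fun _ _ => by linarith) (fun _ _ => by simpa using hε)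
      (fun ζ _ => by
        simp only [zero_mul, zero_div, sub_zero]
        rintro rfl
        simp at hp; linarith)
      (fun ζ hζ => by simpa using (aux ζ (mem_ball_zero_iff.1 hζ)).1)
    refine ⟨A, fun ζ hζ hζ' f hf hg e1 e2 e3 => hA ζ (mem_ball_zero_iff.2 hζ) hζ' f hf hg e1 (by simpa using e2) ?_⟩
    rw [e3]; simp [(aux ζ hζ).2]
  have ms : ∀ s : ℝ, s * s = 1 → ∃ A : Hm (M.pb false) (M.pb true), ∀ ζ : ℂ, ‖ζ‖ < r → s * ξ ζ ≤ 0 → ζ ≠ 0 →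
       ∀ hζ : ζ ∈ B0, ∀ f hf, ∀ hg : M.Good (ω ⟨ζ, hζ⟩) f,
       (∀ i, i ≠ j → i ≠ k → (f (M.z i (ω ⟨ζ, hζ⟩)).im < (M.z i (ω ⟨ζ, hζ⟩)).re ↔
        thr κ b.re b.im (M.z i w1).im < (M.z i w1).re)) →
       (f b.im < b.re ↔ 0 < s) →
       (f (M.z j (ω ⟨ζ, hζ⟩)).im < (M.z j (ω ⟨ζ, hζ⟩)).re ↔ s < 0) → M.H _ f hf hg = A := by
    intro s hs
    have hs' : s = 1 ∨ s = -1 := mul_self_eq_one_iff.1 hs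
    have hpos : ∀ ζ : ℂ, s * ξ ζ ≤ 0 → ζ ≠ 0 → s * ξ ζ - ζ.im * ζ.im < 0 := by
      intro ζ h1 h2
      by_cases h3 : ζ.im = 0
      · have : ζ.re ≠ 0 := fun h => h2 (Complex.ext h h3)
        have h4 : s * ξ ζ ≠ 0 := by
          simp only [ξ, h3]; rcases hs' with rfl | rfl <;> simpa using this
        rw [h3]; rcases h1.lt_or_eq with h | h
        · linarith
        · exact absurd h h4
      · have := mul_self_pos.2 h3; linarith
    have hcξ : ξ ((-s * (r / 2) : ℝ) : ℂ) = -s * (r / 2) := by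
      simp only [ξ, Complex.ofReal_re, Complex.ofReal_im]; ring
    have hcm : ((-s * (r / 2) : ℝ) : ℂ) ∈ {ζ : ℂ | ‖ζ‖ < r ∧ s * ξ ζ ≤ 0 ∧ ζ ≠ 0} := by
      refine ⟨?_, ?_, ?_⟩
      · rw [Complex.norm_real, Real.norm_eq_abs]
        have : |s| = 1 := by rcases hs' with rfl | rfl <;> simp
        rw [abs_mul, abs_neg, this, abs_of_pos (half_pos hr0)]; linarith
      · rw [hcξ]; nlinarith
      · rw [Complex.ofReal_ne_zero]
        rcases hs' with rfl | rfl <;> simp <;> exact hr0.ne'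
    obtain ⟨A, hA⟩ := main {ζ | ‖ζ‖ < r ∧ s * ξ ζ ≤ 0 ∧ ζ ≠ 0} ((-s * (r / 2) : ℝ) : ℂ) (by
        intro y hy a a' ha ha' haa
        have hx1 : s * ξ (a • ((-s * (r / 2) : ℝ) : ℂ) + a' • y) = - a * (r / 2) + a' * (s * ξ y) := by
          simp only [ξ, Complex.add_re, Complex.add_im, Complex.smul_re, Complex.smul_im, Complex.ofReal_re,
            Complex.ofReal_im, smul_eq_mul]
          linear_combination (- a * (r / 2)) * hs
        refine ⟨?_, ?_, ?_⟩
        · exact mem_ball_zero_iff.1 (convex_ball (0 : ℂ) r (mem_ball_zero_iff.2 hcm.1) (mem_ball_zero_iff.2 hy.1) ha ha' haa)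
        · rw [hx1]; nlinarith [hy.2.1]
        · intro h0
          rw [h0] at hx1
          simp only [ξ, Complex.zero_re, Complex.zero_im, mul_zero, sub_zero] at hx1
          have h7 : a = 0 := by
            by_contra h8
            have : 0 < a := lt_of_le_of_ne ha (Ne.symm h8)
            have := mul_pos this hr0
            have := mul_nonneg ha' (neg_nonneg.2 hy.2.1)
            have : a' * (s * ξ y) = a' * (s * (y.re - κ * y.im)) := rfl
            linarith
          obtain rfl : a' = 1 := by linarith
          rw [h7] at h0; simp at h0; exact hy.2.2 h0) hcm (fun ζ hζ => hζ.1)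
      (fun ζ => ξ ζ / 2) (fun ζ => s * ζ.im) (by fun_prop) (by fun_prop)
      (fun ζ hζ => by
        have := hξ ζ hζ.1
        have h1 := abs_nonneg (ξ ζ)
        rw [abs_div, abs_two]; linarith)
      (fun ζ hζ => by
        have := Complex.abs_im_le_norm ζ
        have := hζ.1
        rcases hs' with rfl | rfl <;> simp <;> linarith)
      (fun ζ hζ h0 => by
        have := hpos ζ hζ.2.1 hζ.2.2
        have : s * ξ ζ - ζ.im * ζ.im = 2 * s * (ξ ζ / 2 - s * ζ.im * ζ.im / 2) := by
          linear_combination (ζ.im * ζ.im) * hs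
        rw [h0] at this; linarith)
      (fun ζ hζ h0 => by
        have := hpos ζ hζ.2.1 hζ.2.2
        have : s * ξ ζ - ζ.im * ζ.im = -2 * s * (ξ ζ / 2 + s * ζ.im * ζ.im / 2 - ξ ζ) := by
          linear_combination (ζ.im * ζ.im) * hs
        rw [h0] at this; linarith)
    refine ⟨A, fun ζ h1 h2 h3 hζ' f hf hg e1 e2 e3 => hA ζ ⟨h1, h2, h3⟩ hζ' f hf hg e1 ?_ ?_⟩
    · have := hpos ζ h2 h3
      rw [e2]
      rcases hs' with rfl | rfl
      · exact iff_of_true (by norm_num) (by linarith)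
      · exact iff_of_false (by norm_num) (by linarith)
    · have := hpos ζ h2 h3
      rw [e3]
      rcases hs' with rfl | rfl
      · exact iff_of_false (by norm_num) (by linarith)
      · exact iff_of_true (by norm_num) (by linarith)
  obtain ⟨N, hN⟩ := nr (-(ε / 2)) (by rw [abs_neg, abs_of_pos (by positivity)])
  obtain ⟨R, hR⟩ := nr (ε / 2) (by rw [abs_of_pos (by positivity)])
  obtain ⟨M1, hM1⟩ := ms 1 (by norm_num)
  obtain ⟨M2, hM2⟩ := ms (-1) (by norm_num)
  have swap : ∀ y : ℝ, y ≠ 0 → ‖(y : ℂ) * (κ + Complex.I)‖ < r →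
      (0 < y → M2 = R ≫ inv M1 ≫ N) ∧ (y < 0 → M2 = N ≫ inv M1 ≫ R) := by
    intro y hy0 hyr
    set ζ : ℂ := (y : ℂ) * (κ + Complex.I) with hζ
    have him : ζ.im = y := by simp [hζ]
    have hx0 : ξ ζ = 0 := by simp [hζ, ξ]; ring
    have hne : ζ ≠ 0 := fun h => hy0 (by rw [← him, h]; rfl)
    have hB : ζ ∈ B0 := by
      have : r ≤ ε0 := min_le_left _ _
      simp only [B0, mem_ball_zero_iff]; linarith
    have hyr' : |y| < r := by rw [← him]; exact (Complex.abs_im_le_norm ζ).trans_lt hyr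
    have hyy := mul_self_pos.2 hy0
    let t : ℝ → ℝ → B0 × ℝ × ℝ := fun p q => (⟨ζ, hB⟩, p, q)
    have gN : M.Good (ω ⟨ζ, hB⟩) (G (t (-(ε / 2)) 0)) := good (t _ _) hyr
      (by simp only [t]; rw [abs_neg, abs_of_pos] <;> linarith) (by simpa [t] using hε) (by simp [t]; exact hε.ne')
      (by simp [t, hx0]; exact hε.ne')
    have gR : M.Good (ω ⟨ζ, hB⟩) (G (t ((ε / 2)) 0)) := good (t _ _) hyr
      (by simp only [t]; rw [abs_of_pos] <;> linarith) (by simpa [t] using hε) (by simp [t]; exact hε.ne')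
      (by simp [t, hx0]; exact hε.ne')
    have gM : ∀ s : ℝ, |s| = 1 → M.Good (ω ⟨ζ, hB⟩) (G (t 0 (s * y))) := fun s hs => good (t _ _) hyr
      (by simpa [t] using hε) (by simp only [t]; rw [abs_mul, hs]; linarith)
      (by simp only [t, him]; intro h; have : s = 0 ∨ y = 0 := by
            have : s * (y * y) = 0 := by linarith
            rcases mul_eq_zero.1 this with h | h
            · exact Or.inl h
            · exact absurd h hyy.ne'
          rcases this with rfl | h
          · simp at hs
          · exact hy0 h)
      (by simp only [t, him, hx0]; intro h; have : s = 0 ∨ y = 0 := by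
            have : s * (y * y) = 0 := by linarith
            rcases mul_eq_zero.1 this with h | h
            · exact Or.inl h
            · exact absurd h hyy.ne'
          rcases this with rfl | h
          · simp at hs
          · exact hy0 h)
    have pb : ∀ p q, (G (t p q) b.im < b.re ↔ p - q * y / 2 < 0) := fun p q => by
      rw [← sub_neg, vb]; simp only [t, him]
    have pj : ∀ p q, (G (t p q) (M.z j (ω ⟨ζ, hB⟩)).im < (M.z j (ω ⟨ζ, hB⟩)).re ↔ p + q * y / 2 < 0) := fun p q => by
      have := vj (t p q)
      rw [← sub_neg, this]; simp only [t, him, hx0, sub_zero]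
    have po : ∀ p q, |p| < ε → |q| < ε → ∀ i, i ≠ j → i ≠ k → 
      (G (t p q) (M.z i (ω ⟨ζ, hB⟩)).im < (M.z i (ω ⟨ζ, hB⟩)).re ↔ thr κ b.re b.im (M.z i w1).im < (M.z i w1).re) :=
      fun p q hp hq i h1 h2 => (hoth' (t p q) hyr hp hq i h1 h2).2
    have a1 : |-(ε / 2)| < ε := by rw [abs_neg, abs_of_pos] <;> linarith
    have a2 : |ε / 2| < ε := by rw [abs_of_pos] <;> linarith
    have a3 : |(0 : ℝ)| < ε := by simpa using hε
    have a4 : |1 * y| < ε := by rw [one_mul]; linarith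
    have a5 : |-1 * y| < ε := by rw [neg_one_mul, abs_neg]; linarith
    have eN := hN ζ hyr hB _ (hGc1 _) gN (po _ _ a1 a3) ((pb _ _).trans (by simp)) ((pj _ _).trans (by simp))
    have eR := hR ζ hyr hB _ (hGc1 _) gR (po _ _ a2 a3) ((pb _ _).trans (by simp)) ((pj _ _).trans (by simp))
    have e1 := hM1 ζ hyr (by simp [hx0]) hne hB _ (hGc1 _) (gM 1 (by simp)) (po _ _ a3 a4)
      ((pb _ _).trans (iff_of_true (by linarith) (by linarith))) ((pj _ _).trans (iff_of_false (by linarith) (by linarith)))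
    have e2 := hM2 ζ hyr (by simp [hx0]) hne hB _ (hGc1 _) (gM (-1) (by simp)) (po _ _ a3 a5)
      ((pb _ _).trans (iff_of_false (by linarith) (by linarith))) ((pj _ _).trans (iff_of_true (by linarith) (by linarith)))
    have hfin : ∀ u v : ℝ, u < v → ∃ h, u < h ∧ h < v ∧ ∀ i, (M.z i (ω ⟨ζ, hB⟩)).im ≠ h := by
      intro u v huv
      obtain ⟨h, h1, h2⟩ := (Set.Ioo_infinite huv).exists_notMem_finite
        (Set.finite_range fun i => (M.z i (ω ⟨ζ, hB⟩)).im)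
      exact ⟨h, h1.1, h1.2, fun i hi => h2 ⟨i, hi⟩⟩
    have zj : (M.z j (ω ⟨ζ, hB⟩)).im = b.im + y := by rw [hωz]; simp [him]
    have comp : ∀ (P : ι → Prop), ((M.z j (ω ⟨ζ, hB⟩)).im = b.im + y → P j) → P k → (∀ i, i ≠ j → i ≠ k → P i) → ∀ i, P i := by
      intro P h1 h2 h3 i
      by_cases hij : i = j
      · subst hij; exact h1 zj
      by_cases hik : i = k
      · subst hik; exact h2
      exact h3 i hij hik
    have oo := fun p q p' q' (hp : |p| < ε) (hq : |q| < ε) (hp' : |p'| < ε) (hq' : |q'| < ε) i h1 h2 =>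
      (po p q hp hq i h1 h2).trans (po p' q' hp' hq' i h1 h2).symm
    constructor
    · intro hy
      obtain ⟨h, h1, h2, h3⟩ := hfin b.im (b.im + y) (by linarith)
      have := M.mix (hGc1 _) (hGc1 _) (hGc1 _) (hGc1 _) gR (gM (-1) (by simp)) (gM 1 (by simp)) gN h h3
        (comp _ (fun e he => by exfalso; linarith) (fun _ => by
          rw [hk]; simp only [pb]
          exact ⟨iff_of_false (by linarith) (by linarith), iff_of_true (by linarith) (by linarith)⟩)
          (fun i h1 h2 _ => ⟨oo _ _ _ _ a2 a3 a3 a5 i h1 h2, oo _ _ _ _ a3 a4 a1 a3 i h1 h2⟩))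
        (comp _ (fun e he => by
          simp only [pj]
          exact ⟨iff_of_false (by linarith) (by linarith), iff_of_true (by linarith) (by linarith)⟩)
          (fun he => by exfalso; rw [hk] at he; linarith)
          (fun i h1 h2 _ => ⟨oo _ _ _ _ a2 a3 a3 a4 i h1 h2, oo _ _ _ _ a3 a5 a1 a3 i h1 h2⟩))
      rw [eN, eR, e1, e2] at this
      exact this
    · intro hy
      obtain ⟨h, h1, h2, h3⟩ := hfin (b.im + y) b.im (by linarith)
      have := M.mix (hGc1 _) (hGc1 _) (hGc1 _) (hGc1 _) gN (gM (-1) (by simp)) (gM 1 (by simp)) gR h h3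
        (comp _ (fun e he => by
          simp only [pj]
          exact ⟨iff_of_true (by linarith) (by linarith), iff_of_false (by linarith) (by linarith)⟩)
          (fun he => by exfalso; rw [hk] at he; linarith)
          (fun i h1 h2 _ => ⟨oo _ _ _ _ a1 a3 a3 a5 i h1 h2, oo _ _ _ _ a3 a4 a2 a3 i h1 h2⟩))
        (comp _ (fun e he => by exfalso; linarith) (fun _ => by
          rw [hk]; simp only [pb]
          exact ⟨iff_of_true (by linarith) (by linarith), iff_of_false (by linarith) (by linarith)⟩)
          (fun i h1 h2 _ => ⟨oo _ _ _ _ a1 a3 a3 a4 i h1 h2, oo _ _ _ _ a3 a5 a2 a3 i h1 h2⟩))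
      rw [eN, eR, e1, e2] at this
      exact this
  let y0 : ℝ := r / (2 * (1 + |κ|))
  have hy0 : 0 < y0 := by positivity
  have hny : ∀ y : ℝ, |y| = y0 → ‖(y : ℂ) * (κ + Complex.I)‖ < r := by
    intro y hy
    rw [norm_mul, Complex.norm_real, Real.norm_eq_abs, hy]
    have : ‖(κ + Complex.I : ℂ)‖ ≤ |κ| + 1 := (norm_add_le _ _).trans (by simp)
    have e : y0 * (|κ| + 1) = r / 2 := by simp only [y0]; field_simp; ring
    nlinarith
  have s1 := (swap y0 hy0.ne' (hny _ (abs_of_pos hy0))).1 hy0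
  have s2 := (swap (-y0) (by linarith) (hny _ (by rw [abs_neg, abs_of_pos hy0]))).2 (by linarith)
  have hzj := M.hz j
  have hU : ∀ᶠ w in nhds w1, ‖M.z j w - b‖ < r := by
    have : Continuous fun w => ‖M.z j w - b‖ := by fun_prop
    exact this.continuousAt.eventually_lt continuousAt_const (by simpa [hj] using hr0)
  refine ⟨{w | ‖M.z j w - b‖ < r} ∩ U0, Filter.inter_mem hU hU0, N, M1, R, M2, s2, s1, ?_⟩
  rintro w ⟨hw, hw0⟩ f hf hg e1
  have hB : M.z j w - b ∈ B0 := by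
      have : r ≤ ε0 := min_le_left _ _
      have : ‖M.z j w - b‖ < r := hw
      simp only [B0, mem_ball_zero_iff]; linarith
  have ew := hU0' w hw0 hB
  have red : ∀ A, (∀ hg : M.Good (ω ⟨M.z j w - b, hB⟩) f,
     (∀ i, i ≠ j → i ≠ k → (f (M.z i (ω ⟨M.z j w - b, hB⟩)).im < (M.z i (ω ⟨M.z j w - b, hB⟩)).re ↔
        thr κ b.re b.im (M.z i w1).im < (M.z i w1).re)) → M.H _ f hf hg = A) → M.H w f hf hg = A := by
    intro A h
    rw [ew] at h
    exact h hg e1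
  have hξ' : ξ (M.z j w - b) = (M.z j w).re - thr κ b.re b.im (M.z j w).im := by
    simp only [ξ, thr, Complex.sub_re, Complex.sub_im]; ring
  refine ⟨fun h1 h2 => red _ fun hg e1 => ?_, fun h1 h2 => red _ fun hg e1 => ?_,
    fun h0 h1 h2 => red _ fun hg e1 => ?_, fun h0 h1 h2 => red _ fun hg e1 => ?_⟩
  · exact hN _ hw hB f hf hg e1 (iff_of_true h1 (by linarith)) (iff_of_true (by rw [ew]; exact h2) (by linarith))
  · exact hR _ hw hB f hf hg e1 (iff_of_false h1.not_gt (by linarith)) (iff_of_false (by rw [ew]; exact h2.not_gt) (by linarith))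
  · refine hM1 _ hw (by rw [hξ']; linarith) (fun h => ?_) hB f hf hg e1 (iff_of_true h1 (by norm_num)) (iff_of_false (by rw [ew]; exact h2.not_gt) (by norm_num))
    rw [sub_eq_zero.1 h] at h2; linarith
  · refine hM2 _ hw (by rw [hξ']; linarith) (fun h => ?_) hB f hf hg e1 (iff_of_false h1.not_gt (by norm_num)) (iff_of_true (by rw [ew]; exact h2) (by norm_num))
    rw [sub_eq_zero.1 h] at h2; linarith
end Marks
namespace Marks
variable {P ι : Type} [NormedAddCommGroup P] [NormedSpace ℝ P] {M : Marks P ι}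
variable (M) in
def Pt (w : P) (f : ℝ → ℝ) (s : ι → Bool) : Prop :=
  ∀ i, 0 < sg (s i) * (f (M.z i w).im - (M.z i w).re)
lemma sg_pos {b : Bool} {x : ℝ} (h : 0 < sg b * x) : x ≠ 0 ∧ (x < 0 ↔ b = false) := by
  cases b
  · simp at h; exact ⟨h.ne, by simp [h]⟩
  · simp at h; exact ⟨h.ne', by simp [h.le]⟩
lemma Pt.good {w : P} {f : ℝ → ℝ} {s : ι → Bool} (h : M.Pt w f s) : M.Good w f := fun i =>
  sub_ne_zero.1 (sg_pos (h i)).1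
lemma Pt.iff {w : P} {f : ℝ → ℝ} {s : ι → Bool} (h : M.Pt w f s) (i : ι) :
    f (M.z i w).im < (M.z i w).re ↔ s i = false := by
  rw [← (sg_pos (h i)).2, sub_neg]
lemma Pt.lt {w : P} {f : ℝ → ℝ} {s : ι → Bool} (h : M.Pt w f s) {i : ι} (hi : s i = false) :
    f (M.z i w).im < (M.z i w).re := (h.iff i).2 hi
lemma Pt.gt {w : P} {f : ℝ → ℝ} {s : ι → Bool} (h : M.Pt w f s) {i : ι} (hi : s i = true) :
    (M.z i w).re < f (M.z i w).im := by
  have := h i; rw [hi] at this; simpa using this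
variable (M) in
def GG (w : P) (s : ι → Bool) (A : Hm (M.pb false) (M.pb true)) : Prop :=
  ∃ f hf, ∃ h : M.Pt w f s, M.H w f hf h.good = A
lemma GG.of {w : P} {f : ℝ → ℝ} {s : ι → Bool} (hf : Continuous f) (h : M.Pt w f s) : ∃ A, M.GG w s A :=
  ⟨_, f, hf, h, rfl⟩
lemma GG.eq {w : P} {f : ℝ → ℝ} {s : ι → Bool} {A} (hA : M.GG w s A) (hf : Continuous f) (h : M.Pt w f s) :
    M.H w f hf h.good = A := by
  obtain ⟨g, hg, h', rfl⟩ := hA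
  exact M.H_congr _ _ _ _ fun i => by rw [h.iff, h'.iff]
lemma GG.uniq {w : P} {s : ι → Bool} {A B} (hA : M.GG w s A) (hB : M.GG w s B) : A = B := by
  obtain ⟨g, hg, h', rfl⟩ := hB
  exact (hA.eq hg h').symm
lemma GG.move {s : ι → Bool} {A} {a b : ℝ} (hab : a ≤ b) {w : ℝ → P} (hw : Continuous w) {k x : ℝ → ℝ} (hk : Continuous k)
    (hx : Continuous x) (h : ∀ t, a ≤ t → t ≤ b → M.Pt (w t) (fun η => x t + k t * η) s) :
    M.GG (w a) s A ↔ M.GG (w b) s A := by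
  have : Fact (a ≤ b) := ⟨hab⟩
  have e := M.H_homotopy (Z := Set.Icc a b) (w := fun t => w t) (f := fun t η => x t + k t * η) (by fun_prop) (by fun_prop)
    (fun t => (h t t.2.1 t.2.2).good) (fun t => by fun_prop) ⟨a, le_rfl, hab⟩ ⟨b, hab, le_rfl⟩
  constructor
  · intro hA
    exact ⟨_, by fun_prop, h b hab le_rfl, e.symm.trans (hA.eq _ (h a le_rfl hab))⟩
  · intro hA
    exact ⟨_, by fun_prop, h a le_rfl hab, e.trans (hA.eq _ (h b hab le_rfl))⟩
lemma GG.mix {w : P} {s1 s2 s3 s4 : ι → Bool} {A1 A2 A3 A4} (h1 : M.GG w s1 A1) (h2 : M.GG w s2 A2)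
    (h3 : M.GG w s3 A3) (h4 : M.GG w s4 A4) (h : ℝ) (hh : ∀ i,
      ((M.z i w).im < h ∧ s1 i = s2 i ∧ s3 i = s4 i) ∨ (h < (M.z i w).im ∧ s1 i = s3 i ∧ s2 i = s4 i)) :
    A2 = A1 ≫ inv A3 ≫ A4 := by
  obtain ⟨f1, c1, p1, rfl⟩ := h1
  obtain ⟨f2, c2, p2, rfl⟩ := h2
  obtain ⟨f3, c3, p3, rfl⟩ := h3
  obtain ⟨f4, c4, p4, rfl⟩ := h4
  refine M.mix c1 c2 c3 c4 _ _ _ _ h (fun i => ?_) (fun i hi => ?_) (fun i hi => ?_)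
  · rcases hh i with h | h
    · exact h.1.ne
    · exact h.1.ne'
  · rcases hh i with h | h
    · rw [p1.iff, p2.iff, p3.iff, p4.iff, h.2.1, h.2.2]; simp
    · exact absurd hi h.1.not_gt
  · rcases hh i with h | h
    · exact absurd hi h.1.not_gt
    · rw [p1.iff, p2.iff, p3.iff, p4.iff, h.2.1, h.2.2]; simp
theorem crossG {ι : Type} {M : Marks ℂ ι} [Finite ι] {j k : ι} (b : ℂ) (hk : ∀ w, M.z k w = b) {w1 : ℂ}
    (hj : M.z j w1 = b) {z' : ℂ} (hd : HasStrictDerivAt (M.z j) z' w1) (hz' : z' ≠ 0) (κ : ℝ) (s0 : ι → Bool)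
    (hf0 : ∀ i, i ≠ j → i ≠ k → 0 < sg (s0 i) * (b.re + κ * ((M.z i w1).im - b.im) - (M.z i w1).re)) :
    ∃ U ∈ nhds w1, ∃ N M1 R M2 : Hm (M.pb false) (M.pb true), M2 = N ≫ inv M1 ≫ R ∧
      M2 = R ≫ inv M1 ≫ N ∧ ∀ w ∈ U, ∀ s A, M.GG w s A → (∀ i, i ≠ j → i ≠ k → s i = s0 i) →
      (s k = false → s j = false → A = N) ∧ (s k = true → s j = true → A = R) ∧
      ((M.z j w).re ≤ b.re + κ * ((M.z j w).im - b.im) → s k = false → s j = true → A = M1) ∧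
      (b.re + κ * ((M.z j w).im - b.im) ≤ (M.z j w).re → s k = true → s j = false → A = M2) := by
  obtain ⟨U, hU, N, M1, R, M2, r1, r2, h⟩ := crossing b hk hj hd hz' κ
    (fun i h1 h2 => sub_ne_zero.1 (sg_pos (hf0 i h1 h2)).1)
  refine ⟨U, hU, N, M1, R, M2, r1, r2, fun w hw s A hA hs => ?_⟩
  obtain ⟨f, hf, p, rfl⟩ := hA
  obtain ⟨q1, q2, q3, q4⟩ := h w hw f hf p.good (fun i h1 h2 => by
    rw [p.iff, hs i h1 h2, ← (sg_pos (hf0 i h1 h2)).2, sub_neg]; rfl)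
  refine ⟨fun a c => ?_, fun a c => ?_, fun o a c => ?_, fun o a c => ?_⟩
  · exact q1 (by simpa [hk] using p.lt a) (p.lt c)
  · exact q2 (by simpa [hk] using p.gt a) (p.gt c)
  · exact q3 o (by simpa [hk] using p.lt a) (p.gt c)
  · exact q4 o (by simpa [hk] using p.gt a) (p.lt c)
end Marks
inductive Ix : Type
  | z (s : Bool)
  | o
  | b (s : Bool)
instance : Finite Ix := Finite.of_surjective (fun x : Bool ⊕ Option Bool => match x with
  | .inl s => Ix.z s
  | .inr none => Ix.o
  | .inr (some s) => Ix.b s) (fun i => match i with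
  | .z s => ⟨.inl s, rfl⟩
  | .o => ⟨.inr none, rfl⟩
  | .b s => ⟨.inr (some s), rfl⟩)
def zf : Ix → ℂ → ℂ
  | .z s, w => 3 * w - 2 * sg s * Complex.I * w ^ 3
  | .o, _ => 0
  | .b s, _ => 1 - sg s * Complex.I
lemma abs_sg (s : Bool) : |sg s| = 1 := by cases s <;> simp
lemma nsg (s : Bool) : ‖(sg s : ℂ)‖ = 1 := by rw [Complex.norm_real, Real.norm_eq_abs, abs_sg]
lemma zf_c (i : Ix) : Continuous (zf i) := by
  cases i with
  | z s => exact (by fun_prop : Continuous fun w : ℂ => 3 * w - 2 * sg s * Complex.I * w ^ 3)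
  | o => exact continuous_const
  | b s => exact continuous_const
def K : Marks ℂ Ix where
  z := zf
  hz := zf_c
  ρ w := 7 + 3 * ‖w‖ + 2 * ‖w‖ ^ 3
  hρ := by fun_prop
  hc := by
    have h := convexOn_norm (E := ℂ) (s := Set.univ) convex_univ
    have h3 : ConvexOn ℝ Set.univ fun w : ℂ => ‖w‖ ^ 3 := h.pow (fun _ _ => norm_nonneg _) 3
    exact ((convexOn_const 7 convex_univ).add (h.smul (by norm_num : (0 : ℝ) ≤ 3))).add
      (h3.smul (by norm_num : (0 : ℝ) ≤ 2))
  h0 w := by positivity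
  bd i w := by
    refine (Complex.abs_im_le_norm _).trans_lt ?_
    have h1 := norm_nonneg w
    have h2 : 0 ≤ ‖w‖ ^ 3 := by positivity
    cases i with
    | z s =>
      refine (norm_sub_le _ _).trans_lt ?_
      simp only [norm_mul, norm_pow, nsg, Complex.norm_I]
      norm_num
    | o => simp only [zf, norm_zero]; linarith
    | b s =>
      refine (norm_sub_le _ _).trans_lt ?_
      simp only [norm_mul, nsg, Complex.norm_I, norm_one]
      linarith
lemma zre (s : Bool) (x y : ℝ) : (zf (.z s) ⟨x, y⟩).re = 3 * x + sg s * (6 * x ^ 2 * y - 2 * y ^ 3) := by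
  simp [zf, pow_succ]; ring
lemma zim (s : Bool) (x y : ℝ) : (zf (.z s) ⟨x, y⟩).im = 3 * y - sg s * (2 * x ^ 3 - 6 * x * y ^ 2) := by
  simp [zf, pow_succ]; ring
lemma ore (w) : (zf .o w).re = 0 := rfl
lemma oim (w) : (zf .o w).im = 0 := rfl
lemma bre (s : Bool) (w) : (zf (.b s) w).re = 1 := by simp [zf]
lemma bim (s : Bool) (w) : (zf (.b s) w).im = - sg s := by simp [zf]
lemma sg_not (s : Bool) : sg (!s) = - sg s := by cases s <;> simp
instance hmMul {X : Type} [TopologicalSpace X] (x : X) : Mul (Hm x x) := ⟨fun m n => m ≫ n⟩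
instance hmOne {X : Type} [TopologicalSpace X] (x : X) : One (Hm x x) := ⟨𝟙 _⟩
instance hmInv {X : Type} [TopologicalSpace X] (x : X) : Inv (Hm x x) := ⟨fun m => inv m⟩
instance hmGroup {X : Type} [TopologicalSpace X] (x : X) : Group (Hm x x) :=
  Group.ofLeftAxioms (fun a b c => Category.assoc a b c) (fun a => Category.id_comp a) (fun a => IsIso.inv_hom_id a)
lemma mul_d {X : Type} [TopologicalSpace X] {x : X} (m n : Hm x x) : m * n = m ≫ n := rfl
lemma one_d {X : Type} [TopologicalSpace X] {x : X} : (1 : Hm x x) = 𝟙 _ := rfl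
lemma inv_d {X : Type} [TopologicalSpace X] {x : X} (m : Hm x x) : m⁻¹ = inv m := rfl
def df {X : Type} [TopologicalSpace X] {x y : X} (m n : Hm x y) : Hm x x := m ≫ inv n
lemma df_4 {X : Type} [TopologicalSpace X] {x y : X} {a b c d v : Hm x y} (h : b = a ≫ inv c ≫ d) :
    df b v = df a v * (df c v)⁻¹ * df d v := by
  subst h; simp [df, mul_d, inv_d]
lemma df_2 {X : Type} [TopologicalSpace X] {x y : X} {a b v : Hm x y} :
    df a b = df a v * (df b v)⁻¹ := by
  simp [df, mul_d, inv_d]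
lemma df_1 {X : Type} [TopologicalSpace X] {x y : X} {a : Hm x y} : df a a = 1 := by
  simp [df, one_d]
def pat (σ a b c d e : Bool) : Ix → Bool
  | .z s => if s = σ then a else b
  | .o => c
  | .b s => if s = σ then d else e
lemma pat_sw' (σ a b c d e : Bool) : pat (!σ) a b c d e = pat σ b a c e d := by
  funext i; cases i with
  | z s => cases s <;> cases σ <;> rfl
  | o => rfl
  | b s => cases s <;> cases σ <;> rfl
lemma sg2 (s : Bool) : sg s ^ 2 = 1 := by cases s <;> norm_num
lemma zs1 (σ : Bool) (X y : ℝ) : (zf (.z σ) ⟨X, sg σ * y⟩).re = 3 * X + (6 * X ^ 2 * y - 2 * y ^ 3) := by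
  rw [zre]; cases σ <;> simp <;> ring
lemma zs2 (σ : Bool) (X y : ℝ) : (zf (.z σ) ⟨X, sg σ * y⟩).im = sg σ * (3 * y - (2 * X ^ 3 - 6 * X * y ^ 2)) := by
  rw [zim]; cases σ <;> simp <;> ring
lemma zs3 (σ : Bool) (X y : ℝ) : (zf (.z (!σ)) ⟨X, sg σ * y⟩).re = 3 * X - (6 * X ^ 2 * y - 2 * y ^ 3) := by
  rw [zre]; cases σ <;> simp <;> ring
lemma zs4 (σ : Bool) (X y : ℝ) : (zf (.z (!σ)) ⟨X, sg σ * y⟩).im = sg σ * (3 * y + (2 * X ^ 3 - 6 * X * y ^ 2)) := by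
  rw [zim]; cases σ <;> simp <;> ring
lemma Ix_ind (σ : Bool) {p : Ix → Prop} (h1 : p (.z σ)) (h2 : p (.z (!σ))) (h3 : p .o) (h4 : p (.b σ))
    (h5 : p (.b (!σ))) (i : Ix) : p i := by
  cases i with
  | z s => cases s <;> cases σ <;> assumption
  | o => assumption
  | b s => cases s <;> cases σ <;> assumption
def C5 (a b c d e : Bool) (X y k x : ℝ) : Prop :=
    0 < sg a * (x + k * (3 * y - (2 * X ^ 3 - 6 * X * y ^ 2)) - (3 * X + (6 * X ^ 2 * y - 2 * y ^ 3))) ∧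
    0 < sg b * (x + k * (3 * y + (2 * X ^ 3 - 6 * X * y ^ 2)) - (3 * X - (6 * X ^ 2 * y - 2 * y ^ 3))) ∧
    0 < sg c * x ∧ 0 < sg d * (x - k - 1) ∧ 0 < sg e * (x + k - 1)
lemma C5.pt {σ a b c d e : Bool} {X y k x : ℝ} (h : C5 a b c d e X y k x) :
    K.Pt ⟨X, sg σ * y⟩ (fun η => x + (sg σ * k) * η) (pat σ a b c d e) := by
  obtain ⟨h1, h2, h3, h4, h5⟩ := h
  have hs := sg2 σ
  refine Ix_ind σ ?_ ?_ ?_ ?_ ?_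
  · change 0 < sg (if σ = σ then a else b) * (x + sg σ * k * (zf _ _).im - (zf _ _).re)
    rw [zs1, zs2, if_pos rfl]
    convert h1 using 2
    linear_combination (k * (3 * y - (2 * X ^ 3 - 6 * X * y ^ 2))) * hs
  · change 0 < sg (if (!σ) = σ then a else b) * (x + sg σ * k * (zf _ _).im - (zf _ _).re)
    rw [zs3, zs4, if_neg (by simp)]
    convert h2 using 2
    linear_combination (k * (3 * y + (2 * X ^ 3 - 6 * X * y ^ 2))) * hs
  · change 0 < sg c * (x + sg σ * k * (zf _ _).im - (zf _ _).re)
    rw [ore, oim]; simpa using h3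
  · change 0 < sg (if σ = σ then d else e) * (x + sg σ * k * (zf _ _).im - (zf _ _).re)
    rw [bre, bim, if_pos rfl]
    convert h4 using 2
    linear_combination (-k) * hs
  · change 0 < sg (if (!σ) = σ then d else e) * (x + sg σ * k * (zf _ _).im - (zf _ _).re)
    rw [bre, bim, if_neg (by simp), sg_not]
    convert h5 using 2
    linear_combination k * hs
abbrev G5 (σ a b c d e : Bool) (X y : ℝ) (A : Hm (K.pb false) (K.pb true)) : Prop :=
  K.GG ⟨X, sg σ * y⟩ (pat σ a b c d e) A
lemma ex5 (σ : Bool) {a b c d e : Bool} {X y : ℝ} (k x : ℝ) (h : C5 a b c d e X y k x) : ∃ A, G5 σ a b c d e X y A :=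
  Marks.GG.of (by fun_prop) h.pt
lemma mv5 {σ a b c d e : Bool} {X y k x : ℝ → ℝ} {A} {t0 t1 : ℝ} (h01 : t0 ≤ t1)
    (hc : Continuous X ∧ Continuous y ∧ Continuous k ∧ Continuous x)
    (h : ∀ t, t0 ≤ t → t ≤ t1 → C5 a b c d e (X t) (y t) (k t) (x t)) :
    G5 σ a b c d e (X t0) (y t0) A → G5 σ a b c d e (X t1) (y t1) A := by
  obtain ⟨h1, h2, h3, h4⟩ := hc
  exact (Marks.GG.move (M := K) h01 (w := fun t => ⟨X t, sg σ * y t⟩) (Marks.cont_mk h1 (by fun_prop)) (k := fun t => sg σ * k t) (by fun_prop) h4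
    (fun t a b => (h t a b).pt)).1
lemma P1 (σ : Bool) {A : Hm (K.pb false) (K.pb true)} :
    (G5 σ false true false false false (-(1/100)) 0 A → G5 σ false true false false false (-(1/100)) (1/100) A) ∧
    (G5 σ true true false false false (-(1/100)) 0 A → G5 σ true true false false false (-(1/100)) (1/100) A) ∧
    (G5 σ true true true false false (-(1/100)) 0 A → G5 σ true true true false false (-(1/100)) (1/100) A) ∧
    (G5 σ true true true true false (-(1/100)) 0 A → G5 σ true true true true false (-(1/100)) (1/100) A) ∧
    (G5 σ true true true false true (-(1/100)) 0 A → G5 σ true true true false true (-(1/100)) (1/100) A) := by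
  refine ⟨?_, ?_, ?_, ?_, ?_⟩
  · refine mv5 (X := fun _ => -(1/100)) (y := fun t => t) (k := fun _ => -(1/2)) (x := fun t => -3/100 + 3/2 * t) (by norm_num) ⟨by fun_prop, by fun_prop, by fun_prop, by fun_prop⟩ fun t h0 h1 => ?_
    simp only [C5, sg_t, sg_f]
    refine ⟨?_, ?_, ?_, ?_, ?_⟩ <;> nlinarith [mul_nonneg h0 h0, mul_nonneg h0 (sub_nonneg.2 h1), mul_nonneg (mul_nonneg h0 (sub_nonneg.2 h1)) h0, mul_nonneg (mul_nonneg h0 h0) h0]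
  all_goals
    have aux : ∀ t : ℝ, 0 ≤ t → t ≤ 1/100 → 0 ≤ t ^ 2 ∧ t ^ 2 ≤ 1/10000 ∧ 0 ≤ t ^ 3 ∧ t ^ 3 ≤ 1/1000000 := by
      intro t h0 h1
      have e1 := pow_le_pow_left₀ h0 h1 2
      have e2 := pow_le_pow_left₀ h0 h1 3
      norm_num at e1 e2
      exact ⟨by positivity, e1, by positivity, e2⟩
  · refine mv5 (X := fun _ => -(1/100)) (y := fun t => t) (k := fun _ => 0) (x := fun t => -1/1000) (by norm_num) ⟨by fun_prop, by fun_prop, by fun_prop, by fun_prop⟩ fun t h0 h1 => ?_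
    simp only [C5, sg_t, sg_f]
    obtain ⟨e1, e2, e3, e4⟩ := aux t h0 h1
    refine ⟨?_, ?_, ?_, ?_, ?_⟩ <;> linarith
  · refine mv5 (X := fun _ => -(1/100)) (y := fun t => t) (k := fun _ => 0) (x := fun t => 1/2) (by norm_num) ⟨by fun_prop, by fun_prop, by fun_prop, by fun_prop⟩ fun t h0 h1 => ?_
    simp only [C5, sg_t, sg_f]
    obtain ⟨e1, e2, e3, e4⟩ := aux t h0 h1
    refine ⟨?_, ?_, ?_, ?_, ?_⟩ <;> linarith
  · refine mv5 (X := fun _ => -(1/100)) (y := fun t => t) (k := fun _ => -1/4) (x := fun t => 1) (by norm_num) ⟨by fun_prop, by fun_prop, by fun_prop, by fun_prop⟩ fun t h0 h1 => ?_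
    simp only [C5, sg_t, sg_f]
    obtain ⟨e1, e2, e3, e4⟩ := aux t h0 h1
    refine ⟨?_, ?_, ?_, ?_, ?_⟩ <;> linarith
  · refine mv5 (X := fun _ => -(1/100)) (y := fun t => t) (k := fun _ => 1/4) (x := fun t => 1) (by norm_num) ⟨by fun_prop, by fun_prop, by fun_prop, by fun_prop⟩ fun t h0 h1 => ?_
    simp only [C5, sg_t, sg_f]
    obtain ⟨e1, e2, e3, e4⟩ := aux t h0 h1
    refine ⟨?_, ?_, ?_, ?_, ?_⟩ <;> linarith
lemma P2 (σ : Bool) {A : Hm (K.pb false) (K.pb true)} {T : ℝ} (h : 1/100 ≤ T) :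
    (T * T < 3/4 → G5 σ false true false false false (-(1/100)) (1/100) A → G5 σ false true false false false (-T) T A) ∧
    (T * T < 3/4 → G5 σ true true false false false (-(1/100)) (1/100) A → G5 σ true true false false false (-T) T A) ∧
    (T < 1 → G5 σ true true true false false (-(1/100)) (1/100) A → G5 σ true true true false false (-T) T A) ∧
    (T < 1 → G5 σ true true true true false (-(1/100)) (1/100) A → G5 σ true true true true false (-T) T A) ∧
    (T * T ≤ 3/4 → G5 σ true true true false true (-(1/100)) (1/100) A → G5 σ true true true false true (-T) T A) := by
  refine ⟨fun hT => ?_, fun hT => ?_, fun hT => ?_, fun hT => ?_, fun hT => ?_⟩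
  · refine mv5 (X := fun t => -t) (y := fun t => t) (k := fun _ => 0) (x := fun t => -3 * t) h ⟨by fun_prop, by fun_prop, by fun_prop, by fun_prop⟩ fun t h0 h1 => ?_
    have h3 : 0 < t ^ 3 := by positivity
    simp only [C5, sg_t, sg_f]
    refine ⟨?_, ?_, ?_, ?_, ?_⟩ <;> nlinarith
  · refine mv5 (X := fun t => -t) (y := fun t => t) (k := fun _ => 0) (x := fun t => (-3 * t + 4 * t ^ 3) / 2) h ⟨by fun_prop, by fun_prop, by fun_prop, by fun_prop⟩ fun t h0 h1 => ?_
    have h2 : t * t < 3 / 4 := by nlinarith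
    have h4 : t ^ 3 = t * (t * t) := by ring
    have h3 : 0 < t ^ 3 := by positivity
    have h5 : t * (t * t) < t * (3/4) := by gcongr
    simp only [C5, sg_t, sg_f]
    refine ⟨?_, ?_, ?_, ?_, ?_⟩ <;> nlinarith
  · refine mv5 (X := fun t => -t) (y := fun t => t) (k := fun _ => 0) (x := fun t => (2 - 3 * t + 4 * t ^ 3) / 3) h ⟨by fun_prop, by fun_prop, by fun_prop, by fun_prop⟩ fun t h0 h1 => ?_
    have h3 : 0 < t ^ 3 := by positivity
    have h5 : 0 < (1 - t) * (2 * t + 1) ^ 2 := by have : 0 < 1 - t := by linarith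
                                                  positivity
    have h6 : 0 ≤ (2 * t - 1) ^ 2 * (t + 1) := by positivity
    simp only [C5, sg_t, sg_f]
    refine ⟨?_, ?_, ?_, ?_, ?_⟩ <;> nlinarith
  · refine mv5 (X := fun t => -t) (y := fun t => t) (k := fun _ => -1/4) (x := fun t => 1) h ⟨by fun_prop, by fun_prop, by fun_prop, by fun_prop⟩ fun t h0 h1 => ?_
    have h3 : 0 < t ^ 3 := by positivity
    have h5 : 0 < (1 - t) * (2 * t + 1) ^ 2 := by have : 0 < 1 - t := by linarith
                                                  positivity
    simp only [C5, sg_t, sg_f]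
    refine ⟨?_, ?_, ?_, ?_, ?_⟩ <;> nlinarith
  · refine mv5 (X := fun t => -t) (y := fun t => t) (k := fun _ => 1/4) (x := fun t => 1) h ⟨by fun_prop, by fun_prop, by fun_prop, by fun_prop⟩ fun t h0 h1 => ?_
    have h3 : 0 < t ^ 3 := by positivity
    have h2 : t * t ≤ 3 / 4 := by nlinarith
    have h4 : t ^ 3 = t * (t * t) := by ring
    have h5 : t * (t * t) ≤ t * (3/4) := by gcongr
    simp only [C5, sg_t, sg_f]
    refine ⟨?_, ?_, ?_, ?_, ?_⟩ <;> nlinarith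
lemma pick_lt {c : ℝ → ℂ} (hc : Continuous c) {T : ℝ} {U : Set ℂ} (hU : U ∈ nhds (c T)) {a : ℝ} (ha : a < T) :
    ∃ t, a < t ∧ t < T ∧ c t ∈ U := by
  have h1 : ∀ᶠ t in nhdsWithin T (Set.Iio T), c t ∈ U := (hc.tendsto T).eventually hU |>.filter_mono nhdsWithin_le_nhds
  have h2 : ∀ᶠ t in nhdsWithin T (Set.Iio T), a < t := (eventually_gt_nhds ha).filter_mono nhdsWithin_le_nhds
  obtain ⟨t, ⟨h1, h2⟩, h3⟩ := ((h1.and h2).and self_mem_nhdsWithin).exists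
  exact ⟨t, h2, h3, h1⟩
lemma pick_gt {c : ℝ → ℂ} (hc : Continuous c) {T : ℝ} {U : Set ℂ} (hU : U ∈ nhds (c T)) {a : ℝ} (ha : T < a) :
    ∃ t, T < t ∧ t < a ∧ c t ∈ U := by
  have h1 : ∀ᶠ t in nhdsWithin T (Set.Ioi T), c t ∈ U := (hc.tendsto T).eventually hU |>.filter_mono nhdsWithin_le_nhds
  have h2 : ∀ᶠ t in nhdsWithin T (Set.Ioi T), t < a := (eventually_lt_nhds ha).filter_mono nhdsWithin_le_nhds
  obtain ⟨t, ⟨h1, h2⟩, h3⟩ := ((h1.and h2).and self_mem_nhdsWithin).exists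
  exact ⟨t, h3, h2, h1⟩
lemma zder (σ : Bool) (w : ℂ) : HasStrictDerivAt (zf (.z σ)) (3 - 6 * sg σ * Complex.I * w ^ 2) w := by
  have h : HasStrictDerivAt (fun w : ℂ => 3 * w - 2 * sg σ * Complex.I * w ^ 3)
      (3 * 1 - 2 * sg σ * Complex.I * ((3 : ℕ) * w ^ (3 - 1) * 1)) w :=
    ((hasStrictDerivAt_id w).const_mul 3).sub (((hasStrictDerivAt_id w).pow 3).const_mul _)
  rw [show (3 - 6 * sg σ * Complex.I * w ^ 2 : ℂ) = 3 * 1 - 2 * sg σ * Complex.I * ((3 : ℕ) * w ^ (3 - 1) * 1) by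
    norm_num; ring]
  exact h
lemma zne (σ : Bool) {X y : ℝ} (h : 3 + 12 * X * y ≠ 0 ∨ X ^ 2 - y ^ 2 ≠ 0) :
    (3 - 6 * sg σ * Complex.I * (⟨X, sg σ * y⟩ : ℂ) ^ 2) ≠ 0 := by
  intro e
  have e1 := congrArg Complex.re e
  have e2 := congrArg Complex.im e
  cases σ <;> simp [pow_two] at e1 e2 <;> rcases h with h | h <;> apply h <;> linarith
lemma cross5 (σ : Bool) (kk : Ix) (b : ℂ) (hk : ∀ w, zf kk w = b) {X y : ℝ}
    (hj : zf (.z σ) ⟨X, sg σ * y⟩ = b) (hd : 3 + 12 * X * y ≠ 0 ∨ X ^ 2 - y ^ 2 ≠ 0) (κ : ℝ) (s0 : Ix → Bool)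
    (hf0 : ∀ i, i ≠ .z σ → i ≠ kk → 0 < sg (s0 i) * (b.re + κ * ((zf i ⟨X, sg σ * y⟩).im - b.im) - (zf i ⟨X, sg σ * y⟩).re)) :
    ∃ U ∈ nhds (⟨X, sg σ * y⟩ : ℂ), ∃ N M1 R M2 : Hm (K.pb false) (K.pb true), M2 = N ≫ inv M1 ≫ R ∧
      M2 = R ≫ inv M1 ≫ N ∧ ∀ w ∈ U, ∀ s A, K.GG w s A → (∀ i, i ≠ .z σ → i ≠ kk → s i = s0 i) →
      (s kk = false → s (.z σ) = false → A = N) ∧ (s kk = true → s (.z σ) = true → A = R) ∧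
      ((zf (.z σ) w).re ≤ b.re + κ * ((zf (.z σ) w).im - b.im) → s kk = false → s (.z σ) = true → A = M1) ∧
      (b.re + κ * ((zf (.z σ) w).im - b.im) ≤ (zf (.z σ) w).re → s kk = true → s (.z σ) = false → A = M2) :=
  Marks.crossG (M := K) (j := .z σ) (w1 := ⟨X, sg σ * y⟩) b hk hj (zder σ _) (zne σ hd) κ s0 hf0
lemma cu (σ : Bool) : Continuous fun t : ℝ => (⟨-t, sg σ * t⟩ : ℂ) := Marks.cont_mk (by fun_prop) (by fun_prop)
def sq (v : ℝ) : ℝ := Real.sqrt (3 + 3 * v ^ 2)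
lemma sq_c : Continuous sq := by unfold sq; fun_prop
lemma sq_s (v : ℝ) : sq v ^ 2 = 3 + 3 * v ^ 2 := Real.sq_sqrt (by positivity)
lemma sq_p (v : ℝ) : 0 < sq v := Real.sqrt_pos.2 (by positivity)
def cX (v : ℝ) : ℝ := (-v - sq v) / 2
def cY (v : ℝ) : ℝ := (sq v - v) / 2
lemma cX_c : Continuous cX := by have := sq_c; unfold cX; fun_prop
lemma cY_c : Continuous cY := by have := sq_c; unfold cY; fun_prop
lemma c1 (v : ℝ) : 6 * cX v ^ 2 * cY v - 2 * cY v ^ 3 = v * (3 + 4 * v ^ 2) - 3 * cX v := by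
  unfold cX cY; linear_combination ((1/2) * sq v + (3/2) * v) * sq_s v
lemma c2 (v : ℝ) : 2 * cX v ^ 3 - 6 * cX v * cY v ^ 2 = 3 * cY v - v * (3 + 4 * v ^ 2) := by
  unfold cX cY; linear_combination ((1/2) * sq v - (3/2) * v) * sq_s v
set_option maxHeartbeats 1000000 in
theorem comm (σ : Bool) {Ms V2 V3 Vs Vn : Hm (K.pb false) (K.pb true)}
    (g1 : G5 σ false true false false false (-(1/100)) 0 Ms) (g2 : G5 σ true true false false false (-(1/100)) 0 V2)
    (g3 : G5 σ true true true false false (-(1/100)) 0 V3) (g4 : G5 σ true true true true false (-(1/100)) 0 Vs)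
    (g5 : G5 σ true true true false true (-(1/100)) 0 Vn) :
    ∃ M2, M2 = Ms ≫ inv V2 ≫ V3 ∧ M2 = V3 ≫ inv V2 ≫ Ms ∧ M2 ≫ inv V3 ≫ Vs = Vs ≫ inv V3 ≫ M2 ∧
      M2 ≫ inv V3 ≫ Vn = Vn ≫ inv V3 ≫ M2 := by
  replace g1 := (P1 σ).1 g1
  replace g2 := (P1 σ).2.1 g2
  replace g3 := (P1 σ).2.2.1 g3
  replace g4 := (P1 σ).2.2.2.1 g4
  replace g5 := (P1 σ).2.2.2.2 g5
  set T : ℝ := sq 0 / 2 with hT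
  have hTT : T * T = 3/4 := by have := sq_s 0; rw [hT]; linear_combination this / 4
  have hT0 : 0 < T := by have := sq_p 0; positivity
  have hTl : 1/2 < T := by nlinarith
  have hTu : T < 1 := by nlinarith
  have hT3 : T ^ 3 = 3/4 * T := by rw [← hTT]; ring
  obtain ⟨U, hU, N, M1, R, M2, r1, r2, h⟩ := cross5 σ .o 0 (fun _ => rfl) (X := -T) (y := T)
    (by apply Complex.ext
        · rw [zs1]; simp; linear_combination 4 * hT3
        · rw [zs2, show (3 * T - (2 * (-T) ^ 3 - 6 * (-T) * T ^ 2)) = 0 by linear_combination (-4) * hT3]; simp)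
    (.inl (by rw [show 3 + 12 * -T * T = -6 by linear_combination (-12) * hTT]; norm_num)) 0
    (pat σ false true false false false) (by
      refine Ix_ind σ (fun h => absurd rfl h) (fun _ _ => ?_) (fun _ h => absurd rfl h) (fun _ _ => ?_) (fun _ _ => ?_)
      · rw [zs3]; simp [pat]; nlinarith
      · rw [bre]; simp [pat]
      · rw [bre]; simp [pat])
  obtain ⟨t, h1, h2, h3⟩ := pick_lt (cu σ) hU hTl
  have htt : t * t < 3/4 := by nlinarith
  have hN : Ms = N := (h _ h3 _ _ ((P2 σ (by linarith)).1 htt g1) (Ix_ind σ (by simp) (by simp [pat]) (by simp) (by simp [pat]) (by simp [pat]))).1 rfl (by simp [pat])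
  have hM : V2 = M1 := (h _ h3 _ _ ((P2 σ (by linarith)).2.1 htt g2) (Ix_ind σ (by simp) (by simp [pat]) (by simp) (by simp [pat]) (by simp [pat]))).2.2.1 (by rw [zs1]; simp; nlinarith) rfl (by simp [pat])
  have hR : V3 = R := (h _ h3 _ _ ((P2 σ (by linarith)).2.2.1 (by linarith) g3) (Ix_ind σ (by simp) (by simp [pat]) (by simp) (by simp [pat]) (by simp [pat]))).2.1 rfl (by simp [pat])
  subst hN hM hR
  refine ⟨M2, r1, r2, ?_, ?_⟩
  · obtain ⟨U', hU', N, M1, R, M3, r1', r2', h'⟩ := cross5 σ (.b σ) (1 - sg σ * Complex.I) (fun _ => rfl) (X := -1) (y := 1)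
      (by apply Complex.ext
          · rw [zs1]; simp; norm_num
          · rw [zs2]; simp; norm_num) (.inl (by norm_num)) (sg σ * -(1/4)) (pat σ false true true false false) (by
      refine Ix_ind σ (fun h => absurd rfl h) (fun _ _ => ?_) (fun _ _ => ?_) (fun _ h => absurd rfl h) (fun _ _ => ?_)
      · rw [zs3, zs4]; cases σ <;> simp [pat] <;> norm_num
      · rw [ore, oim]; cases σ <;> simp [pat] <;> norm_num
      · rw [bre, bim]; cases σ <;> simp [pat] <;> norm_num)
    obtain ⟨t1, k1, k2, k3⟩ := pick_gt (cu σ) hU hTu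
    obtain ⟨t2, l1, l2, l3⟩ := pick_lt (cu σ) hU' k2
    have ineq : ∀ t, t1 ≤ t → t ≤ t2 → 0 < -3 * t + 4 * t ^ 3 ∧ -3 * t + 4 * t ^ 3 < 1 := by
      intro t a b
      have : 3/4 < t * t := by nlinarith
      have h5 : 0 < (1 - t) * (2 * t + 1) ^ 2 := by
        have : 0 < 1 - t := by linarith
        have : 0 < t := by linarith
        positivity
      constructor <;> nlinarith
    have key : ∀ t, t1 ≤ t → t ≤ t2 → C5 false true true false false (-t) t 0 ((-3 * t + 4 * t ^ 3) / 2) := by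
      intro t a b
      obtain ⟨i1, i2⟩ := ineq t a b
      have : 0 < t := by linarith
      have : 0 < t ^ 3 := by positivity
      simp only [C5, sg_t, sg_f]
      refine ⟨?_, ?_, ?_, ?_, ?_⟩ <;> nlinarith
    obtain ⟨A, hA⟩ := ex5 σ _ _ (key t1 le_rfl l1.le)
    have hA2 : A = M2 := (h _ k3 _ _ hA (Ix_ind σ (by simp) (by simp [pat]) (by simp) (by simp [pat]) (by simp [pat]))).2.2.2
      (by rw [zs1]; have := (ineq t1 le_rfl l1.le).1; simp; linarith) rfl (by simp [pat])
    replace hA := mv5 (X := fun t => -t) (y := fun t => t) (k := fun t => 0) (x := fun t => (-3 * t + 4 * t ^ 3) / 2)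
      l1.le ⟨by fun_prop, by fun_prop, by fun_prop, by fun_prop⟩ key hA
    subst hA2
    have hN : A = N := (h' _ l3 _ _ hA (Ix_ind σ (by simp) (by simp [pat]) (by simp [pat]) (by simp) (by simp [pat]))).1 (by simp [pat]) (by simp [pat])
    have hM : V3 = M1 := (h' _ l3 _ _ ((P2 σ (by linarith)).2.2.1 (by linarith) g3) (Ix_ind σ (by simp) (by simp [pat]) (by simp [pat]) (by simp) (by simp [pat]))).2.2.1 (by
      have := (ineq t2 l1.le le_rfl).2
      rw [zs1, zs2]; cases σ <;> simp <;> nlinarith) (by simp [pat]) (by simp [pat])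
    have hR : Vs = R := (h' _ l3 _ _ ((P2 σ (by linarith)).2.2.2.1 (by linarith) g4) (Ix_ind σ (by simp) (by simp [pat]) (by simp [pat]) (by simp) (by simp [pat]))).2.1 (by simp [pat]) (by simp [pat])
    subst hN hM hR
    exact r1'.symm.trans r2'
  · obtain ⟨k, ⟨k0, k1⟩, hk⟩ : ∃ k ∈ Set.Icc (0 : ℝ) 1, k * (3 + 4 * k ^ 2) = 1 :=
      intermediate_value_Icc (f := fun k => k * (3 + 4 * k ^ 2)) zero_le_one (by fun_prop) ⟨by norm_num, by norm_num⟩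
    replace k0 : 0 < k := k0.lt_of_ne (by rintro rfl; simp at hk)
    have cv : Continuous fun v : ℝ => (⟨cX v, sg σ * cY v⟩ : ℂ) := Marks.cont_mk cX_c (by have := cY_c; fun_prop)
    have e0 : cX 0 = -T := by simp [cX, hT]; ring
    have e1 : cY 0 = T := by simp [cY, hT]
    have d1 : ∀ v, cX v = (-v - sq v) / 2 := fun _ => rfl
    have d2 : ∀ v, cY v = (sq v - v) / 2 := fun _ => rfl
    obtain ⟨U', hU', N, M1, R, M3, r1', r2', h'⟩ := cross5 σ (.b (!σ)) (1 + sg σ * Complex.I) (fun _ => by simp [zf, sg_not]) (X := cX k) (y := cY k)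
      (by apply Complex.ext
          · rw [zs1, c1, hk]; simp
          · rw [zs2, c2, hk]; simp) (.inr (by
            rw [show cX k ^ 2 - cY k ^ 2 = k * sq k by unfold cX cY; ring]
            exact (mul_pos k0 (sq_p k)).ne')) (sg σ * (1/4)) (pat σ false true true false false) (by
      have hs := sq_p k
      refine Ix_ind σ (fun h => absurd rfl h) (fun _ _ => ?_) (fun _ _ => ?_) (fun _ _ => ?_) (fun _ h => absurd rfl h)
      · rw [zs3, zs4, c1, c2, hk, d1, d2]; cases σ <;> simp [pat] <;> nlinarith
      · rw [ore, oim]; cases σ <;> simp [pat] <;> norm_num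
      · rw [bre, bim]; cases σ <;> simp [pat] <;> norm_num)
    have hU2 : U ∈ nhds ((fun v : ℝ => (⟨cX v, sg σ * cY v⟩ : ℂ)) 0) := by simpa only [e0, e1] using hU
    obtain ⟨t1, k1, k2, k3⟩ := pick_gt cv hU2 k0
    obtain ⟨t2, l1, l2, l3⟩ := pick_lt cv hU' k2
    have ineq : ∀ t, 0 ≤ t → t ≤ t2 → 0 ≤ t * (3 + 4 * t ^ 2) ∧ t * (3 + 4 * t ^ 2) < 1 := by
      intro t a b
      refine ⟨by positivity, ?_⟩
      rw [← hk]
      have : t < k := by linarith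
      gcongr
    have key : ∀ t, t1 ≤ t → t ≤ t2 → C5 false true true false false (cX t) (cY t) 0 (t * (3 + 4 * t ^ 2) / 2) := by
      intro t a b
      obtain ⟨_, i2⟩ := ineq t (by linarith) b
      have : 0 < t := by linarith
      have i1 : 0 < t * (3 + 4 * t ^ 2) := by positivity
      have := sq_p t
      simp only [C5, sg_t, sg_f, c1, c2]; simp only [d1]
      refine ⟨?_, ?_, ?_, ?_, ?_⟩ <;> linarith
    obtain ⟨A, hA⟩ := ex5 σ _ _ (key t1 le_rfl l1.le)
    have hA2 : A = M2 := (h _ k3 _ _ hA (Ix_ind σ (by simp) (by simp [pat]) (by simp) (by simp [pat]) (by simp [pat]))).2.2.2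
      (by rw [zs1, c1]; have := (ineq t1 k1.le l1.le).1; simp; linarith) rfl (by simp [pat])
    have cc := cX_c
    have cc' := cY_c
    replace hA := mv5 (X := cX) (y := cY) (k := fun t => 0) (x := fun t => t * (3 + 4 * t ^ 2) / 2)
      l1.le ⟨by fun_prop, by fun_prop, by fun_prop, by fun_prop⟩ key hA
    subst hA2
    have g3' : G5 σ true true true false false (cX 0) (cY 0) V3 := by rw [e0, e1]; exact (P2 σ (by linarith)).2.2.1 hTu g3
    have g5' : G5 σ true true true false true (cX 0) (cY 0) Vn := by rw [e0, e1]; exact (P2 σ (by linarith)).2.2.2.2 hTT.le g5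
    replace g3' := mv5 (X := cX) (y := cY) (k := fun t => 0) (x := fun t => (1 + t * (3 + 4 * t ^ 2)) / 2) (t1 := t2)
      (by linarith) ⟨by fun_prop, by fun_prop, by fun_prop, by fun_prop⟩ (fun t a b => by
        obtain ⟨i1, i2⟩ := ineq t a b
        have := sq_p t
        simp only [C5, sg_t, sg_f, c1, c2]; simp only [d1]
        refine ⟨?_, ?_, ?_, ?_, ?_⟩ <;> linarith) g3'
    replace g5' := mv5 (X := cX) (y := cY) (k := fun t => 1/4) (x := fun t => 1) (t1 := t2)
      (by linarith) ⟨by fun_prop, by fun_prop, by fun_prop, by fun_prop⟩ (fun t a b => by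
        obtain ⟨i1, i2⟩ := ineq t a b
        have := sq_p t
        simp only [C5, sg_t, sg_f, c1, c2]; simp only [d1, d2]
        refine ⟨?_, ?_, ?_, ?_, ?_⟩ <;> linarith) g5'
    have hN : A = N := (h' _ l3 _ _ hA (Ix_ind σ (by simp) (by simp [pat]) (by simp [pat]) (by simp [pat]) (by simp))).1 (by simp [pat]) (by simp [pat])
    have hM : V3 = M1 := (h' _ l3 _ _ g3' (Ix_ind σ (by simp) (by simp [pat]) (by simp [pat]) (by simp [pat]) (by simp))).2.2.1 (by
      have := (ineq t2 (by linarith) le_rfl).2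
      rw [zs1, zs2, c1, c2]; cases σ <;> simp <;> nlinarith) (by simp [pat]) (by simp [pat])
    have hR : Vn = R := (h' _ l3 _ _ g5' (Ix_ind σ (by simp) (by simp [pat]) (by simp [pat]) (by simp [pat]) (by simp))).2.1 (by simp [pat]) (by simp [pat])
    subst hN hM hR
    exact r1'.symm.trans r2'
lemma cub {X Y : ℝ} (hX : |X| ≤ 1/100) (hY : |Y| ≤ 1/100) :
    |2 * X ^ 3 - 6 * X * Y ^ 2| ≤ 8/1000000 ∧ |6 * X ^ 2 * Y - 2 * Y ^ 3| ≤ 8/1000000 := by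
  have e : ∀ a b : ℝ, |a| ≤ 1/100 → |b| ≤ 1/100 → |2 * a ^ 3 - 6 * a * b ^ 2| ≤ 8/1000000 := by
    intro a b ha hb
    refine (abs_sub _ _).trans ?_
    simp only [abs_mul, abs_pow, Nat.abs_ofNat]
    calc 2 * |a| ^ 3 + 6 * |a| * |b| ^ 2 ≤ 2 * (1/100) ^ 3 + 6 * (1/100) * (1/100) ^ 2 := by gcongr
      _ = _ := by norm_num
  refine ⟨e _ _ hX hY, ?_⟩
  rw [abs_sub_comm]
  convert e _ _ hY hX using 2
  ring
lemma seg5 {a c : Bool} (k x X0 Y0 X1 Y1 : ℝ) {A}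
    (h1 : |X0| ≤ 1/100) (h2 : |Y0| ≤ 1/100) (h3 : |X1| ≤ 1/100) (h4 : |Y1| ≤ 1/100) (hk : |k| ≤ 1)
    (h5 : 1/10000 ≤ sg a * (x + 3 * k * Y0 - 3 * X0)) (h6 : 1/10000 ≤ sg a * (x + 3 * k * Y1 - 3 * X1))
    (hx : 0 < sg c * x) (hb : x - k - 1 < 0) (hb' : x + k - 1 < 0) :
    (∃ B, G5 true a a c false false X1 Y1 B) ∧ (G5 true a a c false false X0 Y0 A → G5 true a a c false false X1 Y1 A) := by
  have key : ∀ t : ℝ, 0 ≤ t → t ≤ 1 → C5 a a c false false (X0 + t * (X1 - X0)) (Y0 + t * (Y1 - Y0)) k x := by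
    intro t t0 t1
    have cv : ∀ p q : ℝ, |p| ≤ 1/100 → |q| ≤ 1/100 → |p + t * (q - p)| ≤ 1/100 := by
      intro p q hp hq
      rw [abs_le] at hp hq ⊢
      constructor <;> nlinarith
    obtain ⟨c1, c2⟩ := cub (cv _ _ h1 h3) (cv _ _ h2 h4)
    have h7 : 1/10000 ≤ sg a * (x + 3 * k * (Y0 + t * (Y1 - Y0)) - 3 * (X0 + t * (X1 - X0))) := by nlinarith
    set X := X0 + t * (X1 - X0)
    set Y := Y0 + t * (Y1 - Y0)
    have c3 : |k * (2 * X ^ 3 - 6 * X * Y ^ 2)| ≤ 8/1000000 := by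
      rw [abs_mul]; exact (mul_le_mul hk c1 (abs_nonneg _) zero_le_one).trans (by norm_num)
    rw [abs_le] at c2 c3
    simp only [C5]
    refine ⟨?_, ?_, hx, by simp; linarith, by simp; linarith⟩
    · cases a <;> simp at h7 ⊢ <;> linarith
    · cases a <;> simp at h7 ⊢ <;> linarith
  constructor
  · obtain ⟨B, hB⟩ := ex5 true _ _ (key 1 zero_le_one le_rfl)
    exact ⟨B, by simpa using hB⟩
  · intro h
    have := mv5 (σ := true) (A := A) (X := fun t => X0 + t * (X1 - X0)) (y := fun t => Y0 + t * (Y1 - Y0)) (k := fun _ => k) (x := fun _ => x)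
      zero_le_one ⟨by fun_prop, by fun_prop, by fun_prop, by fun_prop⟩ key (by simpa using h)
    simpa using this
lemma mid5 (e c : Bool) {X Y k : ℝ} (h1 : |X| ≤ 1) (h2 : |Y| ≤ 1) (hk : -(1/4) ≤ k) (hk' : k ≤ 3/4)
    (h3 : 0 < sg e * (6 * X ^ 2 * Y - 2 * Y ^ 3 + k * (2 * X ^ 3 - 6 * X * Y ^ 2))) (h4 : 0 < sg c * (X - k * Y)) :
    C5 (!e) e c false false (X / 100) (Y / 100) k (3 * (X / 100) - k * (3 * (Y / 100))) := by
  have h5 : |k * Y| ≤ 1 := by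
    rw [abs_mul]
    exact mul_le_one₀ (abs_le.2 ⟨by linarith, by linarith⟩) (abs_nonneg _) h2
  rw [abs_le] at h1 h5
  simp only [C5, sg_f]
  refine ⟨?_, ?_, ?_, ?_, ?_⟩
  · cases e <;> simp at h3 ⊢ <;> nlinarith
  · cases e <;> simp at h3 ⊢ <;> nlinarith
  · cases c <;> simp at h4 ⊢ <;> nlinarith
  · linarith
  · linarith
def Edge (e c : Bool) (p q p' q' : ℝ) : Prop :=
    (∃ A, G5 true (!e) e c false false (p / 100) (q / 100) A) ∧ (∃ A, G5 true (!e) e c false false (p' / 100) (q' / 100) A) ∧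
    ∀ A, G5 true (!e) e c false false (p / 100) (q / 100) A → G5 true (!e) e c false false (p' / 100) (q' / 100) A
lemma edge (e c : Bool) (p q p' q' : ℝ) (hp : |p| ≤ 1) (hq : |q| ≤ 1) (hp' : |p'| ≤ 1) (hq' : |q'| ≤ 1)
    (h : ∀ X Y t : ℝ, 0 ≤ t → t ≤ 1 → X = p + t * (p' - p) → Y = q + t * (q' - q) →
      0 < sg e * (6 * X ^ 2 * Y - 2 * Y ^ 3 + (t - 1/4) * (2 * X ^ 3 - 6 * X * Y ^ 2)) ∧ 0 < sg c * (X - (t - 1/4) * Y)) :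
    Edge e c p q p' q' := by
  have key : ∀ t : ℝ, 0 ≤ t → t ≤ 1 → C5 (!e) e c false false ((p + t * (p' - p)) / 100) ((q + t * (q' - q)) / 100) (t - 1/4)
      (3 * ((p + t * (p' - p)) / 100) - (t - 1/4) * (3 * ((q + t * (q' - q)) / 100))) := by
    intro t t0 t1
    have cv : ∀ p q : ℝ, |p| ≤ 1 → |q| ≤ 1 → |p + t * (q - p)| ≤ 1 := by
      intro p q hp hq
      rw [abs_le] at hp hq ⊢
      constructor <;> nlinarith
    exact mid5 e c (cv _ _ hp hp') (cv _ _ hq hq') (by linarith) (by linarith) (h _ _ t t0 t1 rfl rfl).1 (h _ _ t t0 t1 rfl rfl).2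
  refine ⟨?_, ?_, fun A hA => ?_⟩
  · obtain ⟨B, hB⟩ := ex5 true _ _ (key 0 le_rfl zero_le_one)
    exact ⟨B, by simpa using hB⟩
  · obtain ⟨B, hB⟩ := ex5 true _ _ (key 1 zero_le_one le_rfl)
    exact ⟨B, by simpa using hB⟩
  · have := mv5 (σ := true) (A := A) (X := fun t => (p + t * (p' - p)) / 100) (y := fun t => (q + t * (q' - q)) / 100) (k := fun t => t - 1/4)
      (x := fun t => 3 * ((p + t * (p' - p)) / 100) - (t - 1/4) * (3 * ((q + t * (q' - q)) / 100)))
      zero_le_one ⟨by fun_prop, by fun_prop, by fun_prop, by fun_prop⟩ key (by simpa using hA)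
    simpa using this
lemma bern (t : ℝ) (h0 : 0 ≤ t) (h1 : t ≤ 1) : 0 ≤ t ^ 4 ∧ 0 ≤ t ^ 3 * (1 - t) ∧ 0 ≤ t ^ 2 * (1 - t) ^ 2 ∧ 0 ≤ t * (1 - t) ^ 3 ∧ 0 ≤ (1 - t) ^ 4 := by
  have := sub_nonneg.2 h1
  refine ⟨?_, ?_, ?_, ?_, ?_⟩ <;> positivity
lemma e1 : Edge true false (-1) 0 (-(1/2)) (7/8) := edge true false (-1) 0 (-(1/2)) (7/8) (by norm_num [abs_le]) (by norm_num) (by norm_num [abs_le]) (by norm_num [abs_le]) (by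
  rintro X Y t t0 t1 rfl rfl
  obtain ⟨b1, b2, b3, b4, b5⟩ := bern t t0 t1
  constructor <;> simp <;> nlinarith)
lemma e2 : Edge false false (-(1/2)) (7/8) (1/2) (7/8) := edge false false (-(1/2)) (7/8) (1/2) (7/8) (by norm_num [abs_le]) (by norm_num [abs_le]) (by norm_num [abs_le]) (by norm_num [abs_le]) (by
  rintro X Y t t0 t1 rfl rfl
  obtain ⟨b1, b2, b3, b4, b5⟩ := bern t t0 t1
  constructor <;> simp <;> nlinarith)
lemma e3 : Edge true true (1/2) (7/8) 1 0 := edge true true (1/2) (7/8) 1 0 (by norm_num [abs_le]) (by norm_num [abs_le]) (by norm_num [abs_le]) (by norm_num [abs_le]) (by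
  rintro X Y t t0 t1 rfl rfl
  obtain ⟨b1, b2, b3, b4, b5⟩ := bern t t0 t1
  constructor <;> simp <;> nlinarith)
lemma e4 : Edge false true 1 0 (1/2) (-(7/8)) := edge false true 1 0 (1/2) (-(7/8)) (by norm_num [abs_le]) (by norm_num [abs_le]) (by norm_num [abs_le]) (by norm_num [abs_le]) (by
  rintro X Y t t0 t1 rfl rfl
  obtain ⟨b1, b2, b3, b4, b5⟩ := bern t t0 t1
  constructor <;> simp <;> nlinarith)
lemma e5 : Edge true true (1/2) (-(7/8)) (-(1/2)) (-(7/8)) := edge true true (1/2) (-(7/8)) (-(1/2)) (-(7/8)) (by norm_num [abs_le]) (by norm_num [abs_le]) (by norm_num [abs_le]) (by norm_num [abs_le]) (by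
  rintro X Y t t0 t1 rfl rfl
  obtain ⟨b1, b2, b3, b4, b5⟩ := bern t t0 t1
  constructor <;> simp <;> nlinarith)
lemma e6 : Edge false false (-(1/2)) (-(7/8)) (-1) 0 := edge false false (-(1/2)) (-(7/8)) (-1) 0 (by norm_num [abs_le]) (by norm_num [abs_le]) (by norm_num [abs_le]) (by norm_num [abs_le]) (by
  rintro X Y t t0 t1 rfl rfl
  obtain ⟨b1, b2, b3, b4, b5⟩ := bern t t0 t1
  constructor <;> simp <;> nlinarith)
lemma abv {c : Bool} {X Y : ℝ} {P Q U V : Hm (K.pb false) (K.pb true)} (hP : G5 true false true c false false X Y P)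
    (hQ : G5 true true false c false false X Y Q) (hU : G5 true false false c false false X Y U)
    (hV : G5 true true true c false false X Y V) (h1 : 2 * X ^ 3 - 6 * X * Y ^ 2 < 0)
    (h2 : 3 * Y - (2 * X ^ 3 - 6 * X * Y ^ 2) / 2 ≠ 0) (h3 : |3 * Y - (2 * X ^ 3 - 6 * X * Y ^ 2) / 2| < 1) :
    Q = U ≫ inv P ≫ V ∧ P = V ≫ inv Q ≫ U := by
  rw [abs_lt] at h3
  constructor
  all_goals
    refine Marks.GG.mix (M := K) (by assumption) (by assumption) (by assumption) (by assumption) (3 * Y - (2 * X ^ 3 - 6 * X * Y ^ 2) / 2) (Ix_ind true ?_ ?_ ?_ ?_ ?_)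
    · right; refine ⟨?_, rfl, rfl⟩; change _ < (zf _ _).im; rw [zs2]; simp; linarith
    · left; refine ⟨?_, rfl, rfl⟩; change (zf _ _).im < _; rw [zs4]; simp; linarith
    · rcases h2.lt_or_gt with h | h
      · right; exact ⟨h, rfl, rfl⟩
      · left; exact ⟨h, rfl, rfl⟩
    · left; refine ⟨?_, rfl, rfl⟩; change (zf _ _).im < _; rw [bim]; simp; linarith
    · right; refine ⟨?_, rfl, rfl⟩; change _ < (zf _ _).im; rw [bim]; simp; linarith
lemma blw {c : Bool} {X Y : ℝ} {P Q U V : Hm (K.pb false) (K.pb true)} (hP : G5 true false true c false false X Y P)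
    (hQ : G5 true true false c false false X Y Q) (hU : G5 true false false c false false X Y U)
    (hV : G5 true true true c false false X Y V) (h1 : 0 < 2 * X ^ 3 - 6 * X * Y ^ 2)
    (h2 : 3 * Y + (2 * X ^ 3 - 6 * X * Y ^ 2) / 2 ≠ 0) (h3 : |3 * Y + (2 * X ^ 3 - 6 * X * Y ^ 2) / 2| < 1) :
    Q = V ≫ inv P ≫ U := by
  rw [abs_lt] at h3
  refine Marks.GG.mix (M := K) hV hQ hP hU (3 * Y + (2 * X ^ 3 - 6 * X * Y ^ 2) / 2) (Ix_ind true ?_ ?_ ?_ ?_ ?_)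
  · left; refine ⟨?_, rfl, rfl⟩; change (zf _ _).im < _; rw [zs2]; simp; linarith
  · right; refine ⟨?_, rfl, rfl⟩; change _ < (zf _ _).im; rw [zs4]; simp; linarith
  · rcases h2.lt_or_gt with h | h
    · right; exact ⟨h, rfl, rfl⟩
    · left; exact ⟨h, rfl, rfl⟩
  · left; refine ⟨?_, rfl, rfl⟩; change (zf _ _).im < _; rw [bim]; simp; linarith
  · right; refine ⟨?_, rfl, rfl⟩; change _ < (zf _ _).im; rw [bim]; simp; linarith
lemma och {a b a' b' : Bool} {A1 A2 A3 A4 : Hm (K.pb false) (K.pb true)} {s : Bool} {X Y : ℝ}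
    (g1 : G5 true a b s false false X Y A1) (g2 : G5 true a' b' s false false X Y A2)
    (g3 : G5 true a b (!s) false false X Y A3) (g4 : G5 true a' b' (!s) false false X Y A4)
    (h : 1/1000 < 3 * Y - (2 * X ^ 3 - 6 * X * Y ^ 2)) (h' : 1/1000 < 3 * Y + (2 * X ^ 3 - 6 * X * Y ^ 2)) :
    A2 = A1 ≫ inv A3 ≫ A4 := by
  refine Marks.GG.mix (M := K) g1 g2 g3 g4 (1/1000) (Ix_ind true ?_ ?_ ?_ ?_ ?_)
  · right; refine ⟨?_, rfl, rfl⟩; change _ < (zf _ _).im; rw [zs2]; simp at h ⊢; linarith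
  · right; refine ⟨?_, rfl, rfl⟩; change _ < (zf _ _).im; rw [zs4]; simp at h' ⊢; linarith
  · left; refine ⟨?_, rfl, rfl⟩; change (zf _ _).im < _; rw [oim]; norm_num
  · left; refine ⟨?_, rfl, rfl⟩; change (zf _ _).im < _; rw [bim]; norm_num
  · right; refine ⟨?_, rfl, rfl⟩; change _ < (zf _ _).im; rw [bim]; norm_num
lemma och' {a b a' b' : Bool} {A1 A2 A3 A4 : Hm (K.pb false) (K.pb true)} {s : Bool} {X Y : ℝ}
    (g1 : G5 true a b s false false X Y A1) (g2 : G5 true a b (!s) false false X Y A2)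
    (g3 : G5 true a' b' s false false X Y A3) (g4 : G5 true a' b' (!s) false false X Y A4)
    (h : 3 * Y - (2 * X ^ 3 - 6 * X * Y ^ 2) < -(1/1000)) (h' : 3 * Y + (2 * X ^ 3 - 6 * X * Y ^ 2) < -(1/1000)) :
    A2 = A1 ≫ inv A3 ≫ A4 := by
  refine Marks.GG.mix (M := K) g1 g2 g3 g4 (-(1/1000)) (Ix_ind true ?_ ?_ ?_ ?_ ?_)
  · left; refine ⟨?_, rfl, rfl⟩; change (zf _ _).im < _; rw [zs2]; simp at h ⊢; linarith
  · left; refine ⟨?_, rfl, rfl⟩; change (zf _ _).im < _; rw [zs4]; simp at h' ⊢; linarith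
  · right; refine ⟨?_, rfl, rfl⟩; change _ < (zf _ _).im; rw [oim]; norm_num
  · left; refine ⟨?_, rfl, rfl⟩; change (zf _ _).im < _; rw [bim]; norm_num
  · right; refine ⟨?_, rfl, rfl⟩; change _ < (zf _ _).im; rw [bim]; norm_num
lemma alg5 {G : Type} [Group G] {v0 v2 p m q2 q1 u p1 q0 pm pn : G} (h0 : m = v0 * p⁻¹ * v2) (h1 : q2 = v2 * p⁻¹ * v0)
    (h2 : q1 = 1 * v2⁻¹ * q2) (h3 : u = 1 * v2⁻¹ * v0) (h4 : p1 = 1 * q1⁻¹ * u) (h5 : q0 = 1 * p1⁻¹ * u) (h6 : pm = 1 * q0⁻¹ * u)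
    (h7 : pn = pm * 1⁻¹ * v2) (h8 : m = v2 * pn⁻¹ * v0) (hy : Commute (p * v2⁻¹) v2) (hx : Commute (m * v2⁻¹) v2) :
    (m * v2⁻¹ * (p * v2⁻¹)) ^ 3 = (p * v2⁻¹ * (m * v2⁻¹)) ^ 3 := by
  obtain ⟨x, rfl⟩ : ∃ x, m = x * v2 := ⟨m * v2⁻¹, by group⟩
  obtain ⟨y, rfl⟩ : ∃ y, p = y * v2 := ⟨p * v2⁻¹, by group⟩
  simp only [mul_inv_cancel_right] at hx hy ⊢
  have hxy : Commute (x * y) v2 := hx.mul_left hy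
  obtain rfl : v0 = x * y * v2 := by
    have := congrArg (· * v2⁻¹ * (y * v2)) h0
    simpa [mul_assoc] using this.symm
  obtain rfl : u = x * y := by rw [h3, hxy.eq]; group
  have e1 : q1 = v2⁻¹ * (y⁻¹ * (x * y)) * v2 := by rw [h2, h1]; group
  have e2 : Commute (y⁻¹ * (x * y)) v2 := hy.inv_left.mul_left hxy
  replace e1 : q1 = y⁻¹ * (x * y) := by rw [e1, mul_assoc, e2.eq]; group
  subst e1 h1 h4 h5 h6
  have e4 : pn = ((x * y)⁻¹ ^ 2 * y * (x * y) ^ 2) * v2 := by rw [h7]; simp [pow_two, mul_assoc]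
  rw [e4] at h8
  have e5 : x = ((x * y)⁻¹ ^ 2 * y * (x * y) ^ 2)⁻¹ * (x * y) := by
    have := congrArg (· * v2⁻¹) h8
    simpa [mul_assoc] using this
  have e6 : y * (x * y) ^ 2 * x = (x * y) ^ 3 := by
    have := congrArg (fun g => y * (x * y) ^ 2 * g) e5
    rw [this]; simp [pow_succ, mul_assoc]
  rw [← e6]; simp [pow_succ, mul_assoc]
theorem braid {V0 V2 V3 P Q : Hm (K.pb false) (K.pb true)}
    (g0 : G5 true false false false false false (-1/100) (0/100) V0) (g2 : G5 true true true false false false (-1/100) (0/100) V2)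
    (g3 : G5 true true true true false false (-1/100) (0/100) V3) (gP : G5 true false true false false false (-1/100) (0/100) P)
    (gQ : G5 true true false false false false (-1/100) (0/100) Q) (hy : Commute (df P V2) (df V2 V3)) (hx : Commute (df Q V2) (df V2 V3)) :
    (df Q V2 * df P V2) ^ 3 = (df P V2 * df Q V2) ^ 3 := by
  have f0 : ∀ p q : ℝ, |p| ≤ 1 → |q| ≤ 1 → G5 true false false false false false (p/100) (q/100) V0 := fun p q hp hq => by
    rw [abs_le] at hp hq
    refine (seg5 (a := false) 0 (-1) _ _ _ _ ?_ ?_ ?_ ?_ ?_ ?_ ?_ ?_ ?_ ?_).2 g0 <;> norm_num [abs_le]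
    · constructor <;> linarith
    · constructor <;> linarith
    · linarith
  have f3 : ∀ p q : ℝ, |p| ≤ 1 → |q| ≤ 1 → G5 true true true true false false (p/100) (q/100) V3 := fun p q hp hq => by
    rw [abs_le] at hp hq
    refine (seg5 (a := true) 0 (1/2) _ _ _ _ ?_ ?_ ?_ ?_ ?_ ?_ ?_ ?_ ?_ ?_).2 g3 <;> norm_num [abs_le]
    · constructor <;> linarith
    · constructor <;> linarith
    · linarith
  have v2 : G5 true true true false false false (-(1/2)/100) ((7/8)/100) V2 := by
    refine (seg5 (a := true) (4/5) (-1/1000) _ _ _ _ ?_ ?_ ?_ ?_ ?_ ?_ ?_ ?_ ?_ ?_).2 g2 <;> norm_num [abs_le]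
  have v1 : G5 true true true false false false ((1/2)/100) ((7/8)/100) V2 := by
    refine (seg5 (a := true) (4/5) (-1/1000) _ _ _ _ ?_ ?_ ?_ ?_ ?_ ?_ ?_ ?_ ?_ ?_).2 v2 <;> norm_num [abs_le]
  have vm : G5 true true true false false false (-(1/2)/100) (-(7/8)/100) V2 := by
    refine (seg5 (a := true) 0 (-1/1000) _ _ _ _ ?_ ?_ ?_ ?_ ?_ ?_ ?_ ?_ ?_ ?_).2 g2 <;> norm_num [abs_le]
  obtain ⟨U, u1⟩ : ∃ U, G5 true false false true false false ((1/2)/100) ((7/8)/100) U := by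
    refine (seg5 (A := V0) (a := false) 0 (1/1000) ((1/2)/100) ((7/8)/100) _ _ ?_ ?_ ?_ ?_ ?_ ?_ ?_ ?_ ?_ ?_).1 <;> norm_num [abs_le]
  have u0 : G5 true false false true false false (1/100) (0/100) U := by
    refine (seg5 (a := false) 0 (1/1000) _ _ _ _ ?_ ?_ ?_ ?_ ?_ ?_ ?_ ?_ ?_ ?_).2 u1 <;> norm_num [abs_le]
  have um : G5 true false false true false false ((1/2)/100) (-(7/8)/100) U := by
    refine (seg5 (a := false) 0 (1/1000) _ _ _ _ ?_ ?_ ?_ ?_ ?_ ?_ ?_ ?_ ?_ ?_).2 u0 <;> norm_num [abs_le]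
  obtain ⟨Q2, q2⟩ := e2.1
  obtain ⟨Q1, q1⟩ : ∃ Q1, G5 true true false true false false ((1/2)/100) ((7/8)/100) Q1 := ex5 true _ _
    (mid5 (X := 1/2) (Y := 7/8) (k := 1/4) false true (by norm_num [abs_le]) (by norm_num [abs_le]) (by norm_num) (by norm_num) (by norm_num) (by norm_num))
  obtain ⟨P1, p1⟩ := e3.1
  obtain ⟨Q0, q0⟩ := e4.1
  obtain ⟨Pm, pm⟩ := e5.1
  obtain ⟨Pn, pn⟩ : ∃ Q1, G5 true false true false false false (-(1/2)/100) (-(7/8)/100) Q1 := ex5 true _ _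
    (mid5 (X := -(1/2)) (Y := -(7/8)) (k := 1/4) true false (by norm_num [abs_le]) (by norm_num [abs_le]) (by norm_num) (by norm_num) (by norm_num) (by norm_num))
  obtain ⟨Qm, qm⟩ := e6.1
  have r0 := (abv gP gQ g0 g2 (by norm_num) (by norm_num) (by norm_num [abs_lt])).1
  have r1 := blw (e1.2.2 _ gP) q2 (f0 _ _ (by norm_num [abs_le]) (by norm_num [abs_le])) v2 (by norm_num) (by norm_num) (by norm_num [abs_lt])
  have r2 := och (f3 _ _ (by norm_num [abs_le]) (by norm_num [abs_le])) q1 v1 (e2.2.2 _ q2) (by norm_num) (by norm_num)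
  have r3 := och (f3 _ _ (by norm_num [abs_le]) (by norm_num [abs_le])) u1 v1 (f0 _ _ (by norm_num [abs_le]) (by norm_num [abs_le])) (by norm_num) (by norm_num)
  have r4 := (abv p1 q1 u1 (f3 _ _ (by norm_num [abs_le]) (by norm_num [abs_le])) (by norm_num) (by norm_num) (by norm_num [abs_lt])).2
  have r5 := blw (e3.2.2 _ p1) q0 u0 (f3 _ _ (by norm_num [abs_le]) (by norm_num [abs_le])) (by norm_num) (by norm_num) (by norm_num [abs_lt])
  have r6 := (abv pm (e4.2.2 _ q0) um (f3 _ _ (by norm_num [abs_le]) (by norm_num [abs_le])) (by norm_num) (by norm_num) (by norm_num [abs_lt])).2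
  have r7 := och' (e5.2.2 _ pm) pn (f3 _ _ (by norm_num [abs_le]) (by norm_num [abs_le])) vm (by norm_num) (by norm_num)
  have r8 := blw pn qm (f0 _ _ (by norm_num [abs_le]) (by norm_num [abs_le])) vm (by norm_num) (by norm_num) (by norm_num [abs_lt])
  obtain rfl : Qm = Q := (e6.2.2 _ qm).uniq gQ
  replace r2 := df_4 (v := V3) r2
  replace r3 := df_4 (v := V3) r3
  replace r4 := df_4 (v := V3) r4
  replace r5 := df_4 (v := V3) r5
  replace r6 := df_4 (v := V3) r6
  replace r7 := df_4 (v := V3) r7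
  rw [df_1] at r2 r3 r4 r5 r6 r7
  rw [df_2 (v := V3) (a := P)] at hy
  rw [df_2 (v := V3) (a := Qm)] at hx
  rw [df_2 (v := V3) (a := P), df_2 (v := V3) (a := Qm)]
  exact alg5 (df_4 r0) (df_4 r1) r2 r3 r4 r5 r6 r7 (df_4 r8) hy hx
open Marks
def w0 : ℂ := ⟨-(1/100), 0⟩
lemma w0e (σ : Bool) : (⟨-(1/100), sg σ * 0⟩ : ℂ) = w0 := by simp [w0]
lemma w0e' (σ : Bool) : (⟨-1/100, sg σ * (0/100)⟩ : ℂ) = w0 := by norm_num [w0]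
lemma g5w {σ a b c d e : Bool} {A} : G5 σ a b c d e (-(1/100)) 0 A ↔ K.GG w0 (pat σ a b c d e) A := by
  change K.GG _ _ _ ↔ _; rw [w0e]
lemma g5w' {σ a b c d e : Bool} {A} : G5 σ a b c d e (-1/100) (0/100) A ↔ K.GG w0 (pat σ a b c d e) A := by
  change K.GG _ _ _ ↔ _; rw [w0e']
abbrev GW (a b c d e : Bool) (A : Hm (K.pb false) (K.pb true)) : Prop := K.GG w0 (pat true a b c d e) A
lemma exW {a b c d e : Bool} (k x : ℝ) (h : C5 a b c d e (-(1/100)) 0 k x) : ∃ A, GW a b c d e A := by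
  have := ex5 true k x h
  simpa only [g5w] using this
lemma comW {X : Type} [TopologicalSpace X] {p q : X} {Ms V2 V3 Vs Vn : Hm p q}
    (h : ∃ M2, M2 = Ms ≫ inv V2 ≫ V3 ∧ M2 = V3 ≫ inv V2 ≫ Ms ∧ M2 ≫ inv V3 ≫ Vs = Vs ≫ inv V3 ≫ M2 ∧
      M2 ≫ inv V3 ≫ Vn = Vn ≫ inv V3 ≫ M2) :
    Commute (df Ms V2) (df V2 V3) ∧ Commute (df Ms V2) (df V3 Vs) ∧ Commute (df Ms V2) (df V3 Vn) := by
  obtain ⟨M2, h1, h2, h3, h4⟩ := h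
  have aux : ∀ V, M2 ≫ inv V3 ≫ V = V ≫ inv V3 ≫ M2 → Commute (df Ms V2) (df V3 V) := by
    intro V hV
    have e : df Ms V2 = M2 ≫ inv V3 := by rw [h1]; simp [df]
    have : Commute (df Ms V2) (df V V3) := by
      change _ ≫ _ = _ ≫ _
      rw [e]
      simp only [df, Category.assoc]
      have := congrArg (· ≫ inv V3) hV
      simpa only [Category.assoc] using this
    have e2 : df V3 V = (df V V3)⁻¹ := by simp [df, inv_d]
    rw [e2]; exact this.inv_right
  refine ⟨?_, aux _ h3, aux _ h4⟩
  have e3 := h1.symm.trans h2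
  have : Commute (df Ms V2) (df V3 V2) := by
    change _ ≫ _ = _ ≫ _
    simp only [df, Category.assoc]
    have := congrArg (· ≫ inv V2) e3
    simpa only [Category.assoc] using this
  have e2 : df V2 V3 = (df V3 V2)⁻¹ := by simp [df, inv_d]
  rw [e2]; exact this.inv_right
lemma Klt (i : Ix) (x h : ℝ) (b : Bool) (hb : 0 < sg b * (x - 1/2 * h + 1/2 * (zf i w0).im - (zf i w0).re)) :
    0 < sg b * (thr (1/2) x h (K.z i w0).im - (K.z i w0).re) := by
  convert hb using 2; simp only [thr]; change _ + _ * ((zf i w0).im - h) - (zf i w0).re = _; ring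
lemma wz (s : Bool) : (zf (.z s) w0).re = -3/100 ∧ (zf (.z s) w0).im = sg s * (2/1000000) := by
  rw [w0, zre, zim]; constructor <;> norm_num
lemma ptW {a b c d e : Bool} {x h : ℝ} (ha : 0 < sg a * (x - 1/2 * h + 3/100 + 1/1000000)) (hb : 0 < sg b * (x - 1/2 * h + 3/100 - 1/1000000))
    (hc : 0 < sg c * (x - 1/2 * h)) (hd : 0 < sg d * (x - 1/2 * h - 3/2)) (he : 0 < sg e * (x - 1/2 * h - 1/2)) :
    K.Pt w0 (thr (1/2) x h) (pat true a b c d e) := by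
  refine Ix_ind true ?_ ?_ ?_ ?_ ?_ <;> refine Klt _ _ _ _ ?_
  · rw [(wz _).1, (wz _).2]; refine ha.trans_eq ?_; simp only [pat, reduceIte, Bool.not_true, Bool.false_eq_true, sg_t, sg_f]; ring
  · rw [(wz _).1, (wz _).2]; refine hb.trans_eq ?_; simp only [pat, reduceIte, Bool.not_true, Bool.false_eq_true, sg_t, sg_f]; ring
  · rw [ore, oim]; refine hc.trans_eq ?_; simp only [pat, reduceIte, Bool.not_true, Bool.false_eq_true, sg_t, sg_f]; ring
  · rw [bre, bim]; refine hd.trans_eq ?_; simp only [pat, reduceIte, Bool.not_true, Bool.false_eq_true, sg_t, sg_f]; ring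
  · rw [bre, bim]; refine he.trans_eq ?_; simp only [pat, reduceIte, Bool.not_true, Bool.false_eq_true, sg_t, sg_f]; ring
lemma zd : {w | ∃ i j, i ≠ j ∧ K.z i w = K.z j w}.Countable := by
  let p : Ix → Polynomial ℂ := fun i => match i with
    | .z s => Polynomial.C 3 * Polynomial.X - Polynomial.C (2 * sg s * Complex.I) * Polynomial.X ^ 3
    | .o => 0
    | .b s => Polynomial.C (1 - sg s * Complex.I)
  have hp : ∀ i w, (p i).eval w = zf i w := by
    intro i w; cases i <;> simp [p, zf]
  have hw : ∀ i j, zf i w0 = zf j w0 → i = j := by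
    have hz := wz
    intro i j h
    have h1 := congrArg Complex.re h
    have h2 := congrArg Complex.im h
    cases i with
    | z s => cases j with
      | z t => rw [(hz _).2, (hz _).2] at h2; cases s <;> cases t <;> first | rfl | norm_num at h2
      | o => rw [(hz _).1, ore] at h1; norm_num at h1
      | b t => rw [(hz _).1, bre] at h1; norm_num at h1
    | o => cases j with
      | z t => rw [(hz _).1, ore] at h1; norm_num at h1
      | o => rfl
      | b t => rw [bre, ore] at h1; norm_num at h1
    | b s => cases j with
      | z t => rw [(hz _).1, bre] at h1; norm_num at h1
      | o => rw [bre, ore] at h1; norm_num at h1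
      | b t => rw [bim, bim] at h2; cases s <;> cases t <;> first | rfl | norm_num at h2
  classical
  have : {w | ∃ i j, i ≠ j ∧ K.z i w = K.z j w} ⊆ ⋃ i, ⋃ j, if i ≠ j then {w | (p i - p j).IsRoot w} else ∅ := by
    rintro w ⟨i, j, hij, h⟩
    simp only [Set.mem_iUnion]
    refine ⟨i, j, ?_⟩
    rw [if_pos hij]
    change (p i - p j).eval w = 0
    rw [Polynomial.eval_sub, hp, hp]; exact sub_eq_zero.2 h
  refine Set.Countable.mono this (Set.countable_iUnion fun i => Set.countable_iUnion fun j => ?_)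
  split_ifs with h
  · refine (Polynomial.finite_setOfPred_isRoot (fun h0 => h (hw i j ?_))).countable
    rw [← hp, ← hp, ← sub_eq_zero, ← Polynomial.eval_sub, h0, Polynomial.eval_zero]
  · exact Set.countable_empty
def sbg {X : Type} [TopologicalSpace X] {p : X} (S : Subgroup (Hm p p)) : SubG p where
  mem m := m ∈ S
  one := S.one_mem
  mul := fun h1 h2 => S.mul_mem h1 h2
  inv := fun h => S.inv_mem h
theorem rels : ∃ V0 P Q V2 V3 Vf V4, GW false false false false false V0 ∧ GW false true false false false P ∧
    GW true false false false false Q ∧ GW true true false false false V2 ∧ GW true true true false false V3 ∧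
    GW true true true false true Vf ∧ GW true true true true true V4 ∧
    df P V2 = (df Q V2)⁻¹ * df V0 Q * df Q V2 ∧
    (∀ M, M = P ∨ M = Q → Commute (df M V2) (df V2 V3) ∧ Commute (df M V2) (df V3 Vf) ∧ Commute (df M V2) (df Vf V4)) ∧
    (df Q V2 * df P V2) ^ 3 = (df P V2 * df Q V2) ^ 3 ∧
    ∀ S : Subgroup (Hm (K.pb false) (K.pb false)), df P V2 ∈ S → df Q V2 ∈ S → df V2 V3 ∈ S → df V3 Vf ∈ S → df Vf V4 ∈ S →
      ∀ m, m ∈ S := by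
  obtain ⟨V0, g0⟩ := exW (a := false) (b := false) (c := false) (d := false) (e := false) 0 (-1) (by norm_num [C5])
  obtain ⟨P, gP⟩ := exW (a := false) (b := true) (c := false) (d := false) (e := false) (-(1/2)) (-3/100) (by norm_num [C5])
  obtain ⟨Q, gQ⟩ := exW (a := true) (b := false) (c := false) (d := false) (e := false) (1/2) (-3/100) (by norm_num [C5])
  obtain ⟨V2, g2⟩ := exW (a := true) (b := true) (c := false) (d := false) (e := false) 0 (-1/100) (by norm_num [C5])
  obtain ⟨V3, g3⟩ := exW (a := true) (b := true) (c := true) (d := false) (e := false) 0 (1/2) (by norm_num [C5])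
  obtain ⟨Vf, gf⟩ := exW (a := true) (b := true) (c := true) (d := false) (e := true) (1/2) (1) (by norm_num [C5])
  obtain ⟨Vt, gt⟩ := exW (a := true) (b := true) (c := true) (d := true) (e := false) (-(1/2)) (1) (by norm_num [C5])
  obtain ⟨V4, g4⟩ := exW (a := true) (b := true) (c := true) (d := true) (e := true) 0 2 (by norm_num [C5])
  have hm : V4 = Vt ≫ inv V3 ≫ Vf := by
    refine Marks.GG.mix (M := K) gt g4 g3 gf (1/2) (Ix_ind true ?_ ?_ ?_ ?_ ?_)
    · left; refine ⟨?_, rfl, rfl⟩; change (zf _ _).im < _; rw [(wz _).2]; norm_num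
    · left; refine ⟨?_, rfl, rfl⟩; change (zf _ _).im < _; rw [(wz _).2]; norm_num
    · left; refine ⟨?_, rfl, rfl⟩; change (zf _ _).im < _; rw [oim]; norm_num
    · left; refine ⟨?_, rfl, rfl⟩; change (zf _ _).im < _; rw [bim]; norm_num
    · right; refine ⟨?_, rfl, rfl⟩; change _ < (zf _ _).im; rw [bim]; norm_num
  have hP : P = V2 ≫ inv Q ≫ V0 := by
    refine (abv (c := false) (X := -(1/100)) (Y := 0) ?_ ?_ ?_ ?_ ?_ ?_ ?_).2 <;> first | (rw [g5w]; assumption) | norm_num [abs_lt]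
  have et : df Vf V4 = df V3 Vt := by rw [hm]; simp [df]
  have ct := comW (comm true (g5w.2 gP) (g5w.2 g2) (g5w.2 g3) (g5w.2 gt)
    (g5w.2 gf))
  have cf := comW (comm false (Ms := Q) (V2 := V2) (V3 := V3) (Vs := Vf) (Vn := Vt) (g5w.2 (pat_sw' true _ _ _ _ _ ▸ gQ)) (g5w.2 (pat_sw' true _ _ _ _ _ ▸ g2))
    (g5w.2 (pat_sw' true _ _ _ _ _ ▸ g3)) (g5w.2 (pat_sw' true _ _ _ _ _ ▸ gf)) (g5w.2 (pat_sw' true _ _ _ _ _ ▸ gt)))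
  refine ⟨V0, P, Q, V2, V3, Vf, V4, g0, gP, gQ, g2, g3, gf, g4, ?_, ?_, ?_, ?_⟩
  · rw [hP]; simp [df, mul_d, inv_d]
  · rw [et]
    rintro M (rfl | rfl)
    · exact ⟨ct.1, ct.2.2, ct.2.1⟩
    · exact cf
  · exact braid (V0 := V0) (V2 := V2) (V3 := V3) (g5w'.2 g0) (g5w'.2 g2) (g5w'.2 g3)
      (g5w'.2 gP) (g5w'.2 gQ) ct.1 cf.1
  · intro S hy hx h0 h1 h2 m
    have hv0 : df V0 Q ∈ S := by
      have e : df V0 Q = df Q V2 * df P V2 * (df Q V2)⁻¹ := by rw [hP]; simp [df, mul_d, inv_d]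
      rw [e]; exact S.mul_mem (S.mul_mem hx hy) (S.inv_mem hx)
    have key : ∀ {a b c d e : Bool} {A : Hm (K.pb false) (K.pb true)} {x h : ℝ}, GW a b c d e A → ∀ hg : K.Good w0 (thr (1/2) x h),
        K.Pt w0 (thr (1/2) x h) (pat true a b c d e) → df A V2 ∈ S → (sbg S).mem (K.H w0 (thr (1/2) x h) (Marks.thr_c _ _ _) hg ≫ inv V2) :=
      fun hA hg hp hS => (hA.eq (Marks.thr_c _ _ _) hp).symm ▸ hS
    have k3 : df V3 V2 ∈ S := by
      have e : df V3 V2 = (df V2 V3)⁻¹ := by simp [df, inv_d]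
      rw [e]; exact S.inv_mem h0
    have kf : df Vf V2 ∈ S := by
      have e : df Vf V2 = (df V3 Vf)⁻¹ * df V3 V2 := by simp [df, mul_d, inv_d]
      rw [e]; exact S.mul_mem (S.inv_mem h1) k3
    have k4 : df V4 V2 ∈ S := by
      have e : df V4 V2 = (df Vf V4)⁻¹ * df Vf V2 := by simp [df, mul_d, inv_d]
      rw [e]; exact S.mul_mem (S.inv_mem h2) kf
    have k0 : df V0 V2 ∈ S := by
      have e : df V0 V2 = df V0 Q * df Q V2 := by simp [df, mul_d]
      rw [e]; exact S.mul_mem hv0 hx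
    have k2 : df V2 V2 ∈ S := by rw [df_1]; exact S.one_mem
    have hd : ∀ i j, (K.z i w0).re - 1/2 * (K.z i w0).im = (K.z j w0).re - 1/2 * (K.z j w0).im → i = j := by
      have hz : ∀ i, (K.z i w0).re - 1/2 * (K.z i w0).im = match i with
        | .z s => -3/100 - sg s * (1/1000000)
        | .o => 0
        | .b s => 1 + sg s * (1/2) := by
        intro i; change (zf i w0).re - 1/2 * (zf i w0).im = _
        cases i with
        | z s => rw [(wz _).1, (wz _).2]; ring
        | o => rw [ore, oim]; norm_num
        | b s => rw [bre, bim]; ring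
      intro i j; rw [hz, hz]
      rcases i with s | _ | s <;> rcases j with t | _ | t <;> first | (cases s <;> cases t <;> norm_num) | (cases s <;> norm_num) | (cases t <;> norm_num) | norm_num
    refine gen2 (Γ := sbg S) (V := V2) zd w0 (fun i j h => hd i j (by rw [h])) (planar w0 (1/2) hd fun x h hg => ?_) m
    have hne : ∀ i, x - 1/2 * h + 1/2 * (zf i w0).im - (zf i w0).re ≠ 0 := fun i hi => hg i (by
      change x + 1/2 * ((zf i w0).im - h) = (zf i w0).re; linarith)
    have n1 := hne (.z true); have n2 := hne (.z false); have n3 := hne .o; have n4 := hne (.b true); have n5 := hne (.b false)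
    rw [(wz _).1, (wz _).2] at n1 n2; rw [ore, oim] at n3; rw [bre, bim] at n4 n5
    simp only [sg_t, sg_f] at n1 n2 n4 n5
    rcases lt_or_gt_of_ne n1 with l1 | l1
    · exact key g0 hg (ptW (by simp; linarith) (by simp; linarith) (by simp; linarith) (by simp; linarith) (by simp; linarith)) k0
    rcases lt_or_gt_of_ne n2 with l2 | l2
    · exact key gQ hg (ptW (by simp; linarith) (by simp; linarith) (by simp; linarith) (by simp; linarith) (by simp; linarith)) hx
    rcases lt_or_gt_of_ne n3 with l3 | l3
    · exact key g2 hg (ptW (by simp; linarith) (by simp; linarith) (by simp; linarith) (by simp; linarith) (by simp; linarith)) k2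
    rcases lt_or_gt_of_ne n5 with l4 | l4
    · exact key g3 hg (ptW (by simp; linarith) (by simp; linarith) (by simp; linarith) (by simp; linarith) (by simp; linarith)) k3
    rcases lt_or_gt_of_ne n4 with l5 | l5
    · exact key gf hg (ptW (by simp; linarith) (by simp; linarith) (by simp; linarith) (by simp; linarith) (by simp; linarith)) kf
    · exact key g4 hg (ptW (by simp; linarith) (by simp; linarith) (by simp; linarith) (by simp; linarith) (by simp; linarith)) k4
section lift
variable {E X Z : Type} [TopologicalSpace E] [TopologicalSpace X] [TopologicalSpace Z]
def Lf (p : E → X) {x y : X} {e e' : E} (m : Hm x y) (ℓ : Hm e e') : Prop :=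
  ∃ (δ : Path x y) (γ : Path e e'), m = cls δ ∧ ℓ = cls γ ∧ ∀ t, p (γ t) = δ t
variable {p : E → X} {x y z : X} {e e' e'' : E}
lemma Lf.src {m : Hm x y} {ℓ : Hm e e'} (h : Lf p m ℓ) : p e = x := by
  obtain ⟨δ, γ, -, -, h⟩ := h; simpa using h 0
lemma Lf.tgt {m : Hm x y} {ℓ : Hm e e'} (h : Lf p m ℓ) : p e' = y := by
  obtain ⟨δ, γ, -, -, h⟩ := h; simpa using h 1
lemma Lf.comp {m : Hm x y} {ℓ : Hm e e'} (h : Lf p m ℓ) {n : Hm y z} {k : Hm e' e''}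
    (h' : Lf p n k) : Lf p (m ≫ n) (ℓ ≫ k) := by
  obtain ⟨δ, γ, rfl, rfl, h⟩ := h
  obtain ⟨δ', γ', rfl, rfl, h'⟩ := h'
  refine ⟨δ.trans δ', γ.trans γ', rfl, rfl, fun t => ?_⟩
  simp only [Path.trans_apply]; split_ifs <;> simp [h, h']
lemma inv_cls (δ : Path x y) : inv (cls δ) = cls δ.symm :=
  IsIso.inv_eq_of_hom_inv_id (Quotient.sound ⟨(Path.Homotopy.reflTransSymm δ).symm⟩)
lemma Lf.inv {m : Hm x y} {ℓ : Hm e e'} (h : Lf p m ℓ) : Lf p (inv m) (inv ℓ) := by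
  obtain ⟨δ, γ, rfl, rfl, h⟩ := h
  exact ⟨δ.symm, γ.symm, inv_cls _, inv_cls _, fun t => h _⟩
lemma Lf.one (h : p e = x) : Lf p (𝟙 (FundamentalGroupoid.mk x)) (𝟙 (FundamentalGroupoid.mk e)) :=
  ⟨Path.refl x, Path.refl e, rfl, rfl, fun _ => h⟩
lemma Lf.mp {q : C(E, X)} (ℓ : Hm e e') : Lf q (mp q ℓ) ℓ := by
  obtain ⟨γ, rfl⟩ := exists_cls ℓ
  exact ⟨γ.map q.continuous, γ, rfl, rfl, fun _ => rfl⟩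
lemma tau_path [SimplyConnectedSpace Z] (F : C(Z, X)) {a b : Z} (h : F a = x) (h' : F b = y)
    (γ : Path a b) : tau F a b h h' = cls ((γ.map F.continuous).cast h.symm h'.symm) := by
  subst h h'
  exact (tau_eq F a b (cls γ)).symm
lemma Lf.tau [SimplyConnectedSpace Z] (F : C(Z, X)) (G : C(Z, E)) (hG : ∀ z, p (G z) = F z)
    {a b : Z} (h : F a = x) (h' : F b = y) (k : G a = e) (k' : G b = e') :
    Lf p (tau F a b h h') (tau G a b k k') := by
  have γ := PathConnectedSpace.somePath a b
  exact ⟨_, _, tau_path F h h' γ, tau_path G k k' γ, fun t => hG _⟩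
lemma Lf.map {D Y : Type} [TopologicalSpace D] [TopologicalSpace Y] {q : D → Y} (f : C(E, D))
    (g : C(X, Y)) (hfg : ∀ a, q (f a) = g (p a)) {m : Hm x y} {ℓ : Hm e e'} (h : Lf p m ℓ) :
    Lf q (P17.mp g m) (P17.mp f ℓ) := by
  obtain ⟨δ, γ, rfl, rfl, h⟩ := h
  exact ⟨δ.map g.continuous, γ.map f.continuous, rfl, rfl, fun t => by simp [hfg, h]⟩
lemma mp_idm (m : Hm x y) : P17.mp (ContinuousMap.id X) m = m := by
  obtain ⟨δ, rfl⟩ := exists_cls m; rfl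
lemma Lf.act (f : C(E, E)) (hf : ∀ a, p (f a) = p a) {m : Hm x y} {ℓ : Hm e e'} (h : Lf p m ℓ) :
    Lf p m (P17.mp f ℓ) := by
  have := h.map f (ContinuousMap.id X) (q := p) hf
  rwa [mp_idm] at this
variable (cov : IsCoveringMap p)
include cov
lemma Lf.ex (m : Hm x y) (h : p e = x) : ∃ e', ∃ ℓ : Hm e e', Lf p m ℓ := by
  obtain ⟨δ, rfl⟩ := exists_cls m
  obtain ⟨Γ, h1, h2⟩ := cov.exists_path_lifts δ.toContinuousMap e (by simp [h])
  exact ⟨Γ 1, _, δ, ⟨Γ, h2, rfl⟩, rfl, rfl, fun t => congrFun h1 t⟩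
lemma Lf.end_eq {m : Hm x y} {ℓ : Hm e e'} (h : Lf p m ℓ) {k : Hm e e''} (h' : Lf p m k) :
    e' = e'' := by
  obtain ⟨δ, γ, rfl, rfl, h⟩ := h
  obtain ⟨δ', γ', hd, rfl, h'⟩ := h'
  have hh : δ.Homotopic δ' := Quotient.exact (s := Path.Homotopic.setoid x y) hd
  have := cov.liftPath_apply_one_eq_of_homotopicRel (γ₀ := δ.toContinuousMap)
    (γ₁ := δ'.toContinuousMap) hh e (by simpa using (h 0).symm) (by simpa using (h 0).symm)
  rw [← (cov.eq_liftPath_iff' _ (Γ := γ.toContinuousMap)).2 ⟨funext h, γ.source⟩,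
    ← (cov.eq_liftPath_iff' _ (Γ := γ'.toContinuousMap)).2 ⟨funext h', γ'.source⟩] at this
  simpa using this
lemma Lf.uniq {m : Hm x y} {ℓ k : Hm e e'} (h : Lf p m ℓ) (h' : Lf p m k) : ℓ = k := by
  obtain ⟨δ, γ, rfl, rfl, h⟩ := h
  obtain ⟨δ', γ', hd, rfl, h'⟩ := h'
  have hh : δ.Homotopic δ' := Quotient.exact (s := Path.Homotopic.setoid x y) hd
  refine Quotient.sound ?_
  refine (cov.homotopicRel_iff_comp (f₀ := γ.toContinuousMap) (f₁ := γ'.toContinuousMap) ⟨0, by simp, by simp⟩).2 ?_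
  have e1 : (⟨p, cov.continuous⟩ : C(E, X)).comp γ.toContinuousMap = δ.toContinuousMap :=
    ContinuousMap.ext h
  have e2 : (⟨p, cov.continuous⟩ : C(E, X)).comp γ'.toContinuousMap = δ'.toContinuousMap :=
    ContinuousMap.ext h'
  rw [e1, e2]; exact hh
end lift
structure Tor (B G : Type) [TopologicalSpace B] [Group G] where
  E : Type
  [top : TopologicalSpace E]
  p : E → B
  cov : IsCoveringMap p
  act : G → C(E, E)
  act_p : ∀ g e, p (act g e) = p e
  act_mul : ∀ g k e, act (g * k) e = act g (act k e)
  sec : B → E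
  sec_p : ∀ b, p (sec b) = b
  free : ∀ g k b, act g (sec b) = act k (sec b) → g = k
  tr : ∀ e, ∃ g, act g (sec (p e)) = e
namespace Tor
variable {B G : Type} [TopologicalSpace B] [Group G] (T : Tor B G)
instance : TopologicalSpace T.E := T.top
variable {x y z : B}
lemma ex (m : Hm x y) : ∃ g, ∃ ℓ : Hm (T.sec x) (T.act g (T.sec y)), Lf T.p m ℓ := by
  obtain ⟨e, ℓ, h⟩ := Lf.ex T.cov m (T.sec_p x)
  obtain ⟨g, hg⟩ := T.tr e
  obtain rfl := h.tgt
  have : ∀ e', e' = e → ∃ ℓ : Hm (T.sec x) e', Lf T.p m ℓ := by rintro _ rfl; exact ⟨ℓ, h⟩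
  exact ⟨g, this _ hg⟩
def hol (m : Hm x y) : G := (T.ex m).choose
lemma hol_eq {m : Hm x y} {g k : G} {e e' : T.E} (he : e = T.act g (T.sec x)) (he' : e' = T.act k (T.sec y))
    {ℓ : Hm e e'} (h : Lf T.p m ℓ) : T.hol m = g⁻¹ * k := by
  subst he he'
  obtain ⟨ℓ', h'⟩ := (T.ex m).choose_spec
  have := (h'.act (T.act g) (T.act_p g)).end_eq T.cov h
  rw [← T.act_mul] at this
  have := T.free _ _ _ this
  rw [eq_inv_mul_iff_mul_eq]; exact this
lemma act_one (b : B) : T.act 1 (T.sec b) = T.sec b := by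
  obtain ⟨g, hg⟩ := T.tr (T.sec b)
  rw [T.sec_p] at hg
  conv_lhs => rw [← hg, ← T.act_mul, one_mul, hg]
lemma hol_comp (m : Hm x y) (n : Hm y z) : T.hol (m ≫ n) = T.hol m * T.hol n := by
  obtain ⟨ℓ, h⟩ := (T.ex m).choose_spec
  obtain ⟨k, h'⟩ := (T.ex n).choose_spec
  have h2 := h'.act (T.act (T.hol m)) (T.act_p _)
  have := T.hol_eq (m := m ≫ n) (g := 1) (k := T.hol m * T.hol n) (T.act_one x).symm (T.act_mul _ _ _).symm (h.comp h2)
  simpa using this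
lemma hol_id : T.hol (𝟙 (FundamentalGroupoid.mk x)) = 1 := by
  have := T.hol_comp (𝟙 (FundamentalGroupoid.mk x)) (𝟙 (FundamentalGroupoid.mk x))
  rw [Category.comp_id] at this
  simpa using this
lemma hol_inv (m : Hm x y) : T.hol (inv m) = (T.hol m)⁻¹ := by
  have := T.hol_comp m (inv m)
  rw [IsIso.hom_inv_id, T.hol_id] at this
  exact (inv_eq_of_mul_eq_one_right this.symm).symm
variable {Z : Type} [TopologicalSpace Z] [SimplyConnectedSpace Z]
lemma hol_tau (F : C(Z, B)) (Fl : C(Z, T.E)) (h : ∀ z, T.p (Fl z) = F z) {a b : Z} (hx : F a = x) (hy : F b = y)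
    {g k : G} (hg : Fl a = T.act g (T.sec x)) (hk : Fl b = T.act k (T.sec y)) :
    T.hol (tau F a b hx hy) = g⁻¹ * k :=
  T.hol_eq hg hk (Lf.tau F Fl h hx hy rfl rfl)
end Tor
def expT : Tor {z : ℂ // z ≠ 0} (Multiplicative ℤ) where
  E := ℂ
  p := fun z => ⟨_, z.exp_ne_zero⟩
  cov := Complex.isCoveringMap_exp
  act g := ⟨fun z => z + (g.toAdd : ℂ) * (2 * Real.pi * Complex.I), by fun_prop⟩
  act_p g e := by
    simp [Complex.exp_add, Complex.exp_int_mul_two_pi_mul_I]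
  act_mul g k e := by simp; ring
  sec b := Complex.log b
  sec_p b := by simp [Complex.exp_log b.2]
  free g k b h := by
    simp [Complex.I_ne_zero, Real.pi_ne_zero] at h; exact h
  tr e := by
    obtain ⟨n, hn⟩ := Complex.exp_eq_exp_iff_exists_int.1 (Complex.exp_log (Complex.exp_ne_zero e))
    refine ⟨Multiplicative.ofAdd (-n), ?_⟩
    simp [hn]
open Complex (I)
def cF (w a : ℂ) : ℂ := I * (a ^ 3 - 3 * a * w ^ 2) + 3 * w
def Pf (q : ℂ × ℂ) : ℂ × ℂ := (q.1, cF q.1 q.2)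
lemma sg_sqC (s : Bool) : (sg s : ℂ) ^ 2 = 1 := by cases s <;> simp
lemma cF_z (s : Bool) (w a : ℂ) :
    cF w a - zf (.z s) w = I * (a + 2 * sg s * w) * (a - sg s * w) ^ 2 := by
  simp only [cF, zf]
  linear_combination (-I * (-3 * a * w^2 + 2 * sg s * w^3)) * sg_sqC s
lemma Pf_c : Continuous Pf := by unfold Pf cF; fun_prop
def Wh : Set (ℂ × ℂ) := {q | cF q.1 q.2 ≠ 0 ∧ (∀ s, cF q.1 q.2 ≠ zf (.b s) 0) ∧ ∀ s : Bool, q.2 ≠ sg s * (2 * q.1)}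
def W0 : Set (ℂ × ℂ) := Pf ⁻¹' K.Y
lemma memW0 {q : ℂ × ℂ} : q ∈ W0 ↔ q ∈ Wh ∧ ∀ s : Bool, q.2 ≠ sg s * q.1 := by
  constructor
  · intro h
    have h' : ∀ i, cF q.1 q.2 ≠ zf i q.1 := h
    refine ⟨⟨h' .o, fun s => h' (.b s), fun s e => h' (.z (!s)) ?_⟩, fun s e => h' (.z s) ?_⟩
    · rw [← sub_eq_zero, cF_z, e, sg_not]; push_cast; ring
    · rw [← sub_eq_zero, cF_z, e]; ring
  · rintro ⟨⟨h1, h2, h3⟩, h4⟩ i e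
    cases i with
    | o => exact h1 e
    | b s => exact h2 s e
    | z s =>
      have e' : cF q.1 q.2 = zf (.z s) q.1 := e
      rw [← sub_eq_zero, cF_z] at e'
      have h5 : q.2 + 2 * sg s * q.1 ≠ 0 := fun hh => h3 (!s) (by
        rw [sg_not]; push_cast; linear_combination hh)
      have h6 : q.2 - sg s * q.1 ≠ 0 := fun hh => h4 s (by linear_combination hh)
      exact mul_ne_zero (mul_ne_zero Complex.I_ne_zero h5) (pow_ne_zero 2 h6) e'
lemma cF_bd (w a : ℂ) : ‖a‖ ≤ 1 + ‖cF w a‖ + 3 * ‖w‖ + 3 * ‖w‖ ^ 2 := by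
  have h : ‖a‖ ^ 3 ≤ ‖cF w a‖ + 3 * ‖w‖ + 3 * ‖a‖ * ‖w‖ ^ 2 := by
    have e : a ^ 3 = -I * cF w a + (3 * I) * w + (3 * a) * w ^ 2 := by
      unfold cF; linear_combination (a^3 - 3 * a * w^2) * Complex.I_sq
    calc ‖a‖ ^ 3 = ‖a ^ 3‖ := by simp
      _ = ‖-I * cF w a + (3 * I) * w + (3 * a) * w ^ 2‖ := by rw [e]
      _ ≤ _ := (norm_add₃_le).trans (by simp)
  by_contra! hc
  have h1 := norm_nonneg w
  have h2 := norm_nonneg (cF w a)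
  set r := ‖a‖; set v := ‖w‖; set c := ‖cF w a‖
  have h3 : 1 < r := by nlinarith
  have h4 : c + 3 * v ≤ r * (c + 3 * v) := by nlinarith
  have h5 : r ^ 2 ≤ c + 3 * v + 3 * v ^ 2 := by nlinarith
  nlinarith
lemma Pf_closed : IsClosedMap Pf := by
  refine IsProperMap.isClosedMap (isProperMap_iff_isCompact_preimage.2 ⟨Pf_c, fun k hk => ?_⟩)
  obtain ⟨M, hM⟩ := hk.isBounded.exists_norm_le
  refine Metric.isCompact_of_isClosed_isBounded (hk.isClosed.preimage Pf_c) ?_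
  refine isBounded_iff_forall_norm_le.2 ⟨1 + M + 3 * M + 3 * M ^ 2, fun q hq => ?_⟩
  have h := hM _ hq
  have h1 : ‖q.1‖ ≤ M := (norm_fst_le (Pf q)).trans h
  have h2 : ‖cF q.1 q.2‖ ≤ M := (norm_snd_le (Pf q)).trans h
  have h3 := cF_bd q.1 q.2
  have h4 := norm_nonneg q.1
  rw [Prod.norm_def, sup_le_iff]
  constructor <;> nlinarith
lemma Pf_fin (x : ℂ × ℂ) : (Pf ⁻¹' {x}).Finite := by
  open Polynomial in
  set p : Polynomial ℂ := C I * X ^ 3 - C (3 * I * x.1 ^ 2) * X + C (3 * x.1 - x.2) with hp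
  have hp0 : p ≠ 0 := by
    intro h
    have : p.coeff 3 = I := by
      simp only [hp, Polynomial.coeff_add, Polynomial.coeff_sub, Polynomial.coeff_C_mul,
        Polynomial.coeff_X_pow, Polynomial.coeff_X, Polynomial.coeff_C]; norm_num
    rw [h, Polynomial.coeff_zero] at this; exact Complex.I_ne_zero this.symm
  refine ((Multiset.finite_toSet p.roots).image (fun a => (x.1, a))).subset ?_
  rintro ⟨w, a⟩ h
  have h : (w, cF w a) = x := h
  subst h
  refine ⟨a, ?_, rfl⟩
  simp only [Set.mem_ofPred_eq, Polynomial.mem_roots hp0, Polynomial.IsRoot]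
  simp [hp, cF]; ring
def shear (A B : ℂ) (hB : B ≠ 0) : (ℂ × ℂ) ≃L[ℂ] (ℂ × ℂ) :=
  ContinuousLinearEquiv.equivOfInverse
    ((ContinuousLinearMap.fst ℂ ℂ ℂ).prod (A • ContinuousLinearMap.fst ℂ ℂ ℂ + B • ContinuousLinearMap.snd ℂ ℂ ℂ))
    ((ContinuousLinearMap.fst ℂ ℂ ℂ).prod
      ((-(B⁻¹ * A)) • ContinuousLinearMap.fst ℂ ℂ ℂ + B⁻¹ • ContinuousLinearMap.snd ℂ ℂ ℂ))
    (fun x => by ext <;> simp; field_simp; ring) (fun x => by ext <;> simp; field_simp; ring)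
lemma Pf_der (q : ℂ × ℂ) (h : I * (3 * q.2 ^ 2 - 3 * q.1 ^ 2) ≠ 0) :
    HasStrictFDerivAt Pf (shear (3 - 6 * I * q.2 * q.1) (I * (3 * q.2 ^ 2 - 3 * q.1 ^ 2)) h : (ℂ × ℂ) →L[ℂ] (ℂ × ℂ)) q := by
  have h1 : HasStrictFDerivAt (fun q : ℂ × ℂ => q.1) (ContinuousLinearMap.fst ℂ ℂ ℂ) q := hasStrictFDerivAt_fst
  have h2 : HasStrictFDerivAt (fun q : ℂ × ℂ => q.2) (ContinuousLinearMap.snd ℂ ℂ ℂ) q := hasStrictFDerivAt_snd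
  have := h1.prodMk ((((h2.pow 3).sub ((h2.const_mul 3).mul (h1.pow 2))).const_mul I).add (h1.const_mul 3))
  refine this.congr_fderiv ?_
  ext <;> simp [shear, ContinuousLinearEquiv.equivOfInverse] <;> ring
lemma Pf_cov : IsCoveringMap (K.Y.restrictPreimage Pf) := by
  refine IsCoveringMapOn.isCoveringMap_restrictPreimage (f := Pf) (s := K.Y) ?_
  refine Pf_closed.isCoveringMapOn_of_isLocalHomeomorphOn (fun x _ => Pf_fin x) fun q hq => ?_
  have h := (memW0.1 hq).2
  have hd : I * (3 * q.2 ^ 2 - 3 * q.1 ^ 2) ≠ 0 := by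
    have e : I * (3 * q.2 ^ 2 - 3 * q.1 ^ 2) = 3 * I * (q.2 - sg true * q.1) * (q.2 - sg false * q.1) := by
      simp; ring
    rw [e]
    exact mul_ne_zero (mul_ne_zero (by simp) (sub_ne_zero.2 (h _))) (sub_ne_zero.2 (h _))
  exact ⟨_, (Pf_der q hd).mem_toOpenPartialHomeomorph_source, by simp⟩
def Pi0 : W0 → K.Y := K.Y.restrictPreimage Pf
lemma Pi0_cov : IsCoveringMap Pi0 := Pf_cov
lemma W0_sub : W0 ⊆ Wh := fun _ h => (memW0.1 h).1
def j : C(W0, Wh) := seg W0_sub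
lemma K_Yopen : IsOpen K.Y := by
  have : K.Y = ⋂ i, {q : ℂ × ℂ | q.2 ≠ zf i q.1} := by ext q; simp [Marks.Y, K]
  rw [this]
  exact isOpen_iInter_of_finite fun i => isOpen_ne_fun continuous_snd ((zf_c i).comp continuous_fst)
lemma cF_c {X : Type} [TopologicalSpace X] {f g : X → ℂ} (hf : Continuous f) (hg : Continuous g) :
    Continuous fun x => cF (f x) (g x) := by unfold cF; fun_prop
lemma Wh_open : IsOpen Wh := by
  have : Wh = {q | cF q.1 q.2 ≠ 0} ∩ ((⋂ s, {q : ℂ × ℂ | cF q.1 q.2 ≠ zf (.b s) 0}) ∩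
      ⋂ s : Bool, {q : ℂ × ℂ | q.2 ≠ sg s * (2 * q.1)}) := by ext q; simp [Wh]
  have hc : Continuous fun q : ℂ × ℂ => cF q.1 q.2 := cF_c continuous_fst continuous_snd
  rw [this]
  exact (isOpen_ne_fun hc continuous_const).inter ((isOpen_iInter_of_finite fun s =>
    isOpen_ne_fun hc continuous_const).inter (isOpen_iInter_of_finite fun s =>
    isOpen_ne_fun continuous_snd (by fun_prop)))
open Marks
def cx (t : ℝ) : ℝ := -3/100 - 1/10^7 * Real.cos t
def cy (σ : Bool) (t : ℝ) : ℝ := sg σ * (2/1000000) + 1/10^7 * Real.sin t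
def cl (σ : Bool) (t : ℝ) : ℝ → ℝ := thr (-sg σ/2) (cx t) (cy σ t)
lemma cl_c (σ : Bool) (t : ℝ) : Continuous (cl σ t) := thr_c _ _ _
lemma wzK (s : Bool) : (K.z (.z s) w0).re = -3/100 ∧ (K.z (.z s) w0).im = sg s * (2/1000000) := wz s
lemma woK : (K.z .o w0).re = 0 ∧ (K.z .o w0).im = 0 := ⟨rfl, rfl⟩
lemma wbK (s : Bool) : (K.z (.b s) w0).re = 1 ∧ (K.z (.b s) w0).im = -sg s := ⟨bre s w0, bim s w0⟩
lemma cl_sgn (σ a : Bool) (t : ℝ) (h : 0 < sg a * (- Real.cos t + sg σ/2 * Real.sin t)) :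
    K.Pt w0 (cl σ t) (pat σ a true false false false) := by
  have h1 := Real.cos_le_one t
  have h2 := Real.neg_one_le_cos t
  have h3 := Real.sin_le_one t
  have h4 := Real.neg_one_le_sin t
  refine Ix_ind σ ?_ ?_ ?_ ?_ ?_
  · rw [(wzK _).1, (wzK _).2]; simp only [pat, reduceIte, cl, thr, cx, cy]
    have : 0 < sg a * (- Real.cos t + sg σ/2 * Real.sin t) * (1/10^7) := by positivity
    refine this.trans_eq ?_; ring
  · rw [(wzK _).1, (wzK _).2]; simp only [pat, cl, thr, cx, cy]; cases σ <;> simp <;> linarith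
  · rw [woK.1, woK.2]; simp only [pat, cl, thr, cx, cy]; cases σ <;> simp <;> linarith
  · rw [(wbK _).1, (wbK _).2]; simp only [pat, cl, thr, cx, cy]; cases σ <;> simp <;> linarith
  · rw [(wbK _).1, (wbK _).2]; simp only [pat, cl, thr, cx, cy]; cases σ <;> simp <;> linarith
lemma cl_good (σ b : Bool) (t : ℝ) (h : 0 ≤ sg b * Real.sin t) : K.RGood b w0 (cl σ t) (cy σ t) := by
  by_cases hs : Real.sin t = 0
  · have hc : Real.cos t ≠ 0 := fun hc => by
      have := Real.sin_sq_add_cos_sq t; rw [hs, hc] at this; norm_num at this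
    rcases lt_or_gt_of_ne hc with hc | hc
    · exact (cl_sgn σ true t (by rw [hs]; simp; linarith)).good.r _ _
    · exact (cl_sgn σ false t (by rw [hs]; simp; linarith)).good.r _ _
  · by_cases h0 : - Real.cos t + sg σ/2 * Real.sin t = 0
    · have hb : 0 < sg b * Real.sin t := lt_of_le_of_ne h (Ne.symm (mul_ne_zero (by cases b <;> simp) hs))
      intro i hi
      have h1 := Real.cos_le_one t
      have h2 := Real.neg_one_le_cos t
      have h3 := Real.sin_le_one t
      have h4 := Real.neg_one_le_sin t
      revert i
      refine Ix_ind σ ?_ ?_ ?_ ?_ ?_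
      · rw [(wzK _).2]; intro hi; exfalso; simp only [cy] at hi; nlinarith
      · intro _; rw [(wzK _).1, (wzK _).2]; simp only [cl, thr, cx, cy]
        intro e; cases σ <;> simp at e <;> linarith
      · intro _; rw [woK.1, woK.2]; simp only [cl, thr, cx, cy]
        intro e; cases σ <;> simp at e <;> linarith
      · intro _; rw [(wbK _).1, (wbK _).2]; simp only [cl, thr, cx, cy]
        intro e; cases σ <;> simp at e <;> linarith
      · intro _; rw [(wbK _).1, (wbK _).2]; simp only [cl, thr, cx, cy]
        intro e; cases σ <;> simp at e <;> linarith
    · rcases lt_or_gt_of_ne h0 with h0 | h0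
      · exact (cl_sgn σ false t (by simpa using h0)).good.r _ _
      · exact (cl_sgn σ true t (by simpa using h0)).good.r _ _
lemma cl_at (σ : Bool) (t : ℝ) : cl σ t (cy σ t) = cx t := by simp [cl, thr]
def cir (σ : Bool) : C(ℝ, K.Y) := ⟨fun t => ⟨(w0, ⟨cx t, cy σ t⟩), by
  rcases le_total 0 (Real.sin t) with h | h
  · have := (cl_good σ true t (by simpa using h)).mem0; rwa [cl_at] at this
  · have := (cl_good σ false t (by simpa using h)).mem0; rwa [cl_at] at this⟩, by
  refine Continuous.subtype_mk (Continuous.prodMk continuous_const (cont_mk ?_ ?_)) _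
  · unfold cx; fun_prop
  · unfold cy; fun_prop⟩
lemma cl_hom (σ b : Bool) (u v : ℝ) (huv : u ≤ v) (h : ∀ t ∈ Set.Icc u v, 0 ≤ sg b * Real.sin t) :
    K.rayT b w0 (cl σ u) (cl_c σ u) (cy σ u) (cl_good σ b u (h u ⟨le_rfl, huv⟩)) (y := cir σ u) (by rw [cl_at]; rfl) ≫
      tau (cir σ) u v rfl rfl =
    K.rayT b w0 (cl σ v) (cl_c σ v) (cy σ v) (cl_good σ b v (h v ⟨huv, le_rfl⟩)) (y := cir σ v) (by rw [cl_at]; rfl) := by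
  have : Fact (u ≤ v) := ⟨huv⟩
  have h1 := K.rayT_homotopy (Z := Set.Icc u v) (b := b) (w := fun _ => w0) (f := fun t => cl σ t)
    (h := fun t => cy σ t) continuous_const (by unfold cl thr cx cy; fun_prop) (by unfold cy; fun_prop)
    (fun t => cl_good σ b t (h t t.2)) (fun t => cl_c σ t) ((cir σ).comp ⟨Subtype.val, continuous_subtype_val⟩)
    (fun t => by rw [cl_at]; rfl) ⟨u, le_rfl, huv⟩ ⟨v, huv, le_rfl⟩
  rw [tau_pre (cir σ) _ (fun t : Set.Icc u v => (t : ℝ)) continuous_subtype_val (fun t => rfl)] at h1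
  exact h1
def cr (σ : Bool) : Hm (K.pb false) (cir σ 0) :=
  K.rayT false w0 (cl σ 0) (cl_c σ 0) (cy σ 0) (cl_good σ false 0 (by simp)) (by rw [cl_at]; rfl)
lemma cir_per (σ : Bool) : cir σ (2 * Real.pi) = cir σ 0 := by
  apply Subtype.ext; simp [cir, cx, cy]
theorem circ {σ : Bool} {A V} (hA : K.GG w0 (pat σ false true false false false) A)
    (hV : K.GG w0 (pat σ true true false false false) V) :
    df A V = cr σ ≫ tau (cir σ) 0 (2 * Real.pi) rfl (cir_per σ) ≫ inv (cr σ) := by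
  have p0 : K.Pt w0 (cl σ 0) _ := cl_sgn σ false 0 (by simp)
  have p1 : K.Pt w0 (cl σ Real.pi) _ := cl_sgn σ true Real.pi (by simp)
  rw [← hA.eq (cl_c σ 0) p0, ← hV.eq (cl_c σ _) p1,
    ← K.rayT_H (cl_c σ 0) p0.good (cy σ 0) (y := cir σ 0) (by rw [cl_at]; rfl),
    ← K.rayT_H (cl_c σ _) p1.good (cy σ Real.pi) (y := cir σ Real.pi) (by rw [cl_at]; rfl),
    ← cl_hom σ true 0 Real.pi Real.pi_pos.le (fun t ht => by simpa using Real.sin_nonneg_of_mem_Icc ht)]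
  have h2 : K.rayT false w0 (cl σ (2 * Real.pi)) (cl_c _ _) (cy σ (2 * Real.pi)) (cl_good _ _ _ (by simp)) (y := cir σ 0)
      (by rw [cl_at, ← cir_per]; rfl) = cr σ := by
    have e : cl σ (2 * Real.pi) = cl σ 0 := by simp [cl, cx, cy]
    have e' : cy σ (2 * Real.pi) = cy σ 0 := by simp [cy]
    unfold cr; congr 1
  have h3 := cl_hom σ false Real.pi (2 * Real.pi) (by linarith [Real.pi_pos]) (fun t ht => by
    have := Real.sin_nonpos_of_nonpos_of_neg_pi_le (x := t - 2 * Real.pi) (by linarith [ht.2]) (by linarith [ht.1])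
    rw [Real.sin_sub_two_pi] at this
    simpa using this)
  have h4 : K.rayT false w0 (cl σ Real.pi) (cl_c _ _) (cy σ Real.pi) (cl_good _ _ _ (by simp)) (y := cir σ Real.pi)
      (by rw [cl_at]; rfl) ≫ tau (cir σ) Real.pi (2 * Real.pi) rfl (cir_per σ) = cr σ := by
    rw [← h2]
    have gen : ∀ (y : K.Y) (hy : cir σ (2 * Real.pi) = y),
      K.rayT false w0 (cl σ Real.pi) (cl_c _ _) (cy σ Real.pi) (cl_good _ _ _ (by simp)) (y := cir σ Real.pi)
      (by rw [cl_at]; rfl) ≫ tau (cir σ) Real.pi (2 * Real.pi) rfl hy = K.rayT false w0 (cl σ (2 * Real.pi)) (cl_c _ _) (cy σ (2 * Real.pi)) (cl_good _ _ _ (by simp)) (y := y)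
      (by rw [cl_at, ← hy]; rfl) := by rintro _ rfl; exact h3
    exact gen _ _
  have h5 : K.rayT false w0 (cl σ Real.pi) (cl_c _ _) (cy σ Real.pi) (cl_good _ _ _ (by simp)) (y := cir σ Real.pi)
      (by rw [cl_at]; rfl) = cr σ ≫ inv (tau (cir σ) Real.pi (2 * Real.pi) rfl (cir_per σ)) := by
    rw [← h4]; simp
  rw [h5, tau_inv]
  have h6 := tau_comp (cir σ) (z := 0) (z' := Real.pi) (z'' := 2 * Real.pi) rfl rfl rfl (cir_per σ)
  rw [← h6]
  simp only [df, IsIso.inv_comp, IsIso.inv_inv, Category.assoc, tau_inv]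
  rw [show K.rayT false w0 (cl σ 0) _ _ _ _ = cr σ from rfl]
  simp
open Marks
open Complex (I)
lemma w0n : ‖w0‖ = 1/100 := by
  have : w0 = ((-(1/100) : ℝ) : ℂ) := by apply Complex.ext <;> simp [w0]
  rw [this, Complex.norm_real]; norm_num
def Bb (σ : Bool) : ℂ := -3 * sg σ * w0
lemma Bbn (σ : Bool) : ‖Bb σ‖ = 3/100 := by simp [Bb, abs_sg, w0n]; norm_num
def bb (σ : Bool) (q : W0) : ℂ := q.1.2 - sg σ * w0
lemma bb_c (σ : Bool) : Continuous (bb σ) := by unfold bb; fun_prop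
def Ov (σ : Bool) (q : W0) : Prop := q.1.1 = w0 ∧ ‖(bb σ q - Bb σ) * bb σ q ^ 2‖ = 1/10^7
lemma cir_eq {σ : Bool} {q : W0} {t : ℝ} (h : Pi0 q = cir σ t) :
    q.1.1 = w0 ∧ (bb σ q - Bb σ) * bb σ q ^ 2 = I * (1/10^7) * Complex.exp (-(t * I)) := by
  have h1 : (q.1.1, cF q.1.1 q.1.2) = ((w0, ⟨cx t, cy σ t⟩) : ℂ × ℂ) := congrArg Subtype.val h
  rw [Prod.mk.injEq] at h1
  obtain ⟨h1, h2⟩ := h1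
  refine ⟨h1, ?_⟩
  rw [h1] at h2
  have h3 := cF_z σ w0 q.1.2
  rw [h2] at h3
  have h4 : (⟨cx t, cy σ t⟩ : ℂ) - zf (.z σ) w0 = - (1/10^7) * Complex.exp (-(t * I)) := by
    have e : Complex.exp (-(t * I)) = ⟨Real.cos t, - Real.sin t⟩ := by
      rw [show -((t : ℂ) * I) = ((-t : ℝ) : ℂ) * I by push_cast; ring]
      apply Complex.ext
      · rw [Complex.exp_ofReal_mul_I_re, Real.cos_neg]
      · rw [Complex.exp_ofReal_mul_I_im, Real.sin_neg]
    have e2 : zf (.z σ) w0 = ⟨-3/100, sg σ * (2/1000000)⟩ := Complex.ext (wz σ).1 (wz σ).2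
    have e3 : (-(1/10^7) : ℂ) = ((-(1/10^7) : ℝ) : ℂ) := by push_cast; rfl
    rw [e, e2, e3]
    apply Complex.ext
    · simp only [Complex.sub_re, Complex.re_ofReal_mul, cx]; ring
    · simp only [Complex.sub_im, Complex.im_ofReal_mul, cy]; ring
  rw [h4] at h3
  have h5 : (bb σ q - Bb σ) * bb σ q ^ 2 = (q.1.2 + 2 * sg σ * w0) * (q.1.2 - sg σ * w0) ^ 2 := by
    simp only [bb, Bb]; ring
  rw [h5]
  linear_combination (-I) * (-h3) + (q.1.2 + 2 * sg σ * w0) * (q.1.2 - sg σ * w0) ^ 2 * (Complex.I_sq)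
lemma cir_ov {σ : Bool} {q : W0} {t : ℝ} (h : Pi0 q = cir σ t) : Ov σ q := by
  refine ⟨(cir_eq h).1, ?_⟩
  rw [(cir_eq h).2]
  have : ‖Complex.exp (-(t * I))‖ = 1 := by
    have := Complex.norm_exp_ofReal_mul_I (-t); simpa using this
  rw [norm_mul, this]; simp
lemma Ov.dich {σ : Bool} {q : W0} (h : Ov σ q) (hn : ¬ ‖bb σ q‖ < 1/100) : ‖bb σ q - Bb σ‖ < 1/1000 := by
  have h2 := h.2
  rw [norm_mul, norm_pow] at h2
  have h3 : ‖Bb σ‖ ≤ ‖bb σ q‖ + ‖bb σ q - Bb σ‖ := by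
    have := norm_sub_le (bb σ q) (bb σ q - Bb σ); simpa using this
  rw [Bbn] at h3
  push Not at hn
  have h4 := norm_nonneg (bb σ q - Bb σ)
  set r := ‖bb σ q‖; set u := ‖bb σ q - Bb σ‖
  by_contra! hc
  have : 1/10^4 ≤ r^2 := by nlinarith
  have h6 : u ≤ 1/1000 := by nlinarith
  have h7 : 29/1000 ≤ r := by linarith
  have : (29/1000)^2 ≤ r^2 := by nlinarith
  nlinarith
lemma far_not {σ : Bool} {q : W0} (h : ‖bb σ q - Bb σ‖ < 1/1000) : ¬ ‖bb σ q‖ < 1/100 := by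
  intro hn
  have h3 : ‖Bb σ‖ ≤ ‖bb σ q‖ + ‖bb σ q - Bb σ‖ := by
    have := norm_sub_le (bb σ q) (bb σ q - Bb σ); simpa using this
  rw [Bbn] at h3; linarith
lemma pt_eq {σ : Bool} {q q' : W0} {t : ℝ} (h : Pi0 q = cir σ t) (h' : Pi0 q' = cir σ t) (hb : bb σ q = bb σ q') : q = q' := by
  apply Subtype.ext
  apply Prod.ext
  · rw [(cir_eq h).1, (cir_eq h').1]
  · simpa [bb] using hb
lemma far_uniq {σ : Bool} {q q' : W0} {t : ℝ} (h : Pi0 q = cir σ t) (h' : Pi0 q' = cir σ t)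
    (f : ‖bb σ q - Bb σ‖ < 1/1000) (f' : ‖bb σ q' - Bb σ‖ < 1/1000) : q = q' := by
  refine pt_eq h h' ?_
  have e := (cir_eq h).2.trans (cir_eq h').2.symm
  set u := bb σ q - Bb σ with hu
  set v := bb σ q' - Bb σ with hv
  rw [show bb σ q = u + Bb σ by simp [hu], show bb σ q' = v + Bb σ by simp [hv]] at e ⊢
  have e2 : (u - v) * (Bb σ ^ 2 + (2 * Bb σ * (u + v) + (u * u + u * v + v * v))) = 0 := by
    linear_combination e
  rcases mul_eq_zero.1 e2 with h0 | h0
  · rw [sub_eq_zero.1 h0]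
  · exfalso
    have e3 : ‖Bb σ ^ 2‖ = ‖2 * Bb σ * (u + v) + (u * u + u * v + v * v)‖ := by
      rw [← norm_neg (2 * Bb σ * (u + v) + (u * u + u * v + v * v))]; congr 1; linear_combination h0
    have e4 : ‖2 * Bb σ * (u + v) + (u * u + u * v + v * v)‖ ≤ 2 * (3/100) * (‖u‖ + ‖v‖) + (‖u‖ * ‖u‖ + ‖u‖ * ‖v‖ + ‖v‖ * ‖v‖) := by
      refine (norm_add_le _ _).trans (add_le_add ?_ ?_)
      · rw [norm_mul, norm_mul, Bbn]
        simp only [Complex.norm_ofNat]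
        exact mul_le_mul_of_nonneg_left (norm_add_le _ _) (by norm_num)
      · refine norm_add₃_le.trans ?_; simp only [norm_mul]; rfl
    rw [norm_pow, Bbn] at e3
    have := norm_nonneg u
    have := norm_nonneg v
    nlinarith
lemma near3 {σ : Bool} {q q' q'' : W0} {t : ℝ} (h : Pi0 q = cir σ t) (h' : Pi0 q' = cir σ t) (h'' : Pi0 q'' = cir σ t)
    (n : ‖bb σ q‖ < 1/100) (n' : ‖bb σ q'‖ < 1/100) (n'' : ‖bb σ q''‖ < 1/100) (d : q ≠ q') (d' : q ≠ q'') : q' = q'' := by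
  refine pt_eq h' h'' ?_
  by_contra hc
  have d1 : bb σ q - bb σ q' ≠ 0 := sub_ne_zero.2 fun e => d (pt_eq h h' e)
  have d2 : bb σ q - bb σ q'' ≠ 0 := sub_ne_zero.2 fun e => d' (pt_eq h h'' e)
  have d3 : bb σ q' - bb σ q'' ≠ 0 := sub_ne_zero.2 hc
  have e1 := (cir_eq h).2.trans (cir_eq h').2.symm
  have e2 := (cir_eq h).2.trans (cir_eq h'').2.symm
  set u := bb σ q; set v := bb σ q'; set x := bb σ q''
  have e : (u - v) * (u - x) * (v - x) * (u + v + x - Bb σ) = 0 := by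
    linear_combination (u - x) * e1 - (u - v) * e2
  have e3 : Bb σ = u + v + x := by
    have := (mul_eq_zero.1 e).resolve_left (mul_ne_zero (mul_ne_zero d1 d2) d3)
    linear_combination -this
  have e4 := Bbn σ
  have := norm_add₃_le (a := u) (b := v) (c := x)
  rw [e3] at e4
  linarith
def IsL (σ : Bool) (G : C(ℝ, W0)) : Prop := ∀ t, Pi0 (G t) = cir σ t
lemma IsL.near {σ : Bool} {G : C(ℝ, W0)} (h : IsL σ G) {a : ℝ} (ha : ‖bb σ (G a)‖ < 1/100) (t : ℝ) :
    ‖bb σ (G t)‖ < 1/100 := by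
  have hc : Continuous fun t => bb σ (G t) := (bb_c σ).comp G.continuous
  refine locconst (fun t => ‖bb σ (G t)‖ < 1/100) (fun t => ?_) a t ha
  by_cases hn : ‖bb σ (G t)‖ < 1/100
  · have := (hc.norm.tendsto t).eventually (Iio_mem_nhds hn)
    exact this.mono fun s hs => by simp only [hn, iff_true]; exact hs
  · have := ((hc.sub continuous_const).norm.tendsto t).eventually (Iio_mem_nhds ((cir_ov (h t)).dich hn))
    exact this.mono fun s hs => by simp only [hn, iff_false]; exact far_not hs
lemma IsL.far {σ : Bool} {G : C(ℝ, W0)} (h : IsL σ G) {a : ℝ} (ha : ‖bb σ (G a) - Bb σ‖ < 1/1000) (t : ℝ) :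
    ‖bb σ (G t) - Bb σ‖ < 1/1000 :=
  (cir_ov (h t)).dich fun hn => far_not ha (h.near hn a)
lemma IsL.ex (σ : Bool) (q : W0) (h : Pi0 q = cir σ 0) : ∃ G, IsL σ G ∧ G 0 = q := by
  obtain ⟨G, hG, -⟩ := Pi0_cov.existsUnique_continuousMap_lifts (cir σ) 0 q h
  exact ⟨G, fun t => congrFun hG.2 t, hG.1⟩
lemma slit_of {z : ℂ} (h : ‖z - 1‖ < 1) : z ∈ Complex.slitPlane := by
  have := Complex.mem_slitPlane_of_norm_lt_one h
  simpa using this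
lemma Bb0 (σ : Bool) : Bb σ ≠ 0 := by rw [← norm_pos_iff, Bbn]; norm_num
lemma IsL.swap {σ : Bool} {G : C(ℝ, W0)} (h : IsL σ G) (ha : ‖bb σ (G 0)‖ < 1/100) : G (2 * Real.pi) ≠ G 0 := by
  intro e
  have hc : Continuous fun t => bb σ (G t) := (bb_c σ).comp G.continuous
  have hs : ∀ t, 1 - bb σ (G t) / Bb σ ∈ Complex.slitPlane := fun t => slit_of (by
    have : 1 - bb σ (G t) / Bb σ - 1 = - (bb σ (G t) / Bb σ) := by ring
    rw [this, norm_neg, norm_div, Bbn]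
    have := h.near ha t
    rw [div_lt_one (by norm_num)]; linarith)
  have hlog : Continuous fun t => Complex.log (1 - bb σ (G t) / Bb σ) :=
    continuous_iff_continuousAt.2 fun t => ((by fun_prop : Continuous fun t => 1 - bb σ (G t) / Bb σ).continuousAt).clog (hs t)
  let r : ℝ → ℂ := fun t => bb σ (G t) * Complex.exp (t * I / 2 + Complex.log (1 - bb σ (G t) / Bb σ) / 2)
  have hr : Continuous r := by simp only [r]; fun_prop
  have hr2 : ∀ t, r t ^ 2 = -(I * (1/10^7) / Bb σ) := by
    intro t
    have h1 := (cir_eq (h t)).2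
    have h2 := Complex.exp_log (Complex.slitPlane_ne_zero (hs t))
    have h3 : Complex.exp (t * I / 2 + Complex.log (1 - bb σ (G t) / Bb σ) / 2) ^ 2 = Complex.exp (t * I) * (1 - bb σ (G t) / Bb σ) := by
      rw [← h2, ← Complex.exp_nat_mul, ← Complex.exp_add, h2]; congr 1; push_cast; ring
    have h4 : Complex.exp (-(t * I)) * Complex.exp (t * I) = 1 := by rw [← Complex.exp_add]; simp
    simp only [r]
    rw [mul_pow, h3]
    have hB := Bb0 σ
    field_simp
    linear_combination (-Complex.exp (t * I)) * h1 * 10 ^ 7 - I * h4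
  have hne : ∀ t, r t ≠ 0 := fun t h0 => by
    have := hr2 t; rw [h0] at this
    have hB := Bb0 σ
    simp [hB] at this
  have hconst : r (2 * Real.pi) = r 0 := by
    have := isPreconnected_univ.eq_or_eq_neg_of_sq_eq (f := r) (g := fun _ => r 0) hr.continuousOn continuousOn_const
      (fun t _ => by simp [hr2]) (fun {x} _ => hne 0)
    rcases this with h1 | h1
    · exact h1 (Set.mem_univ _)
    · have := h1 (Set.mem_univ (0 : ℝ))
      simp only [Pi.neg_apply] at this
      exact absurd (self_eq_neg.1 this) (hne 0)
  have e3 : r (2 * Real.pi) = - r 0 := by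
    simp only [r]
    rw [e, show (((2 * Real.pi : ℝ) : ℂ) * I / 2 + Complex.log (1 - bb σ (G 0) / Bb σ) / 2) =
      Real.pi * I + (((0 : ℝ) : ℂ) * I / 2 + Complex.log (1 - bb σ (G 0) / Bb σ) / 2) by push_cast; ring,
      Complex.exp_add, Complex.exp_pi_mul_I]; ring
  rw [hconst] at e3
  exact hne 0 (self_eq_neg.1 e3)
open Marks
open Complex (I)
def lam (s : Bool) : C(Wh, {z : ℂ // z ≠ 0}) :=
  ⟨fun q => ⟨q.1.2 - sg s * (2 * q.1.1), sub_ne_zero.2 (q.2.2.2 s)⟩, by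
    refine Continuous.subtype_mk ?_ _; fun_prop⟩
def lh (s : Bool) {x y : Wh} (m : Hm x y) : Multiplicative ℤ := expT.hol (mp (lam s) m)
lemma lh_comp (s : Bool) {x y z : Wh} (m : Hm x y) (n : Hm y z) : lh s (m ≫ n) = lh s m * lh s n := by
  simp only [lh, mp_comp]; exact expT.hol_comp _ _
lemma lh_inv (s : Bool) {x y : Wh} (m : Hm x y) : lh s (inv m) = (lh s m)⁻¹ := by
  simp only [lh, mp_inv]; exact expT.hol_inv _
lemma ehol (F : C(ℝ, {z : ℂ // z ≠ 0})) (L : ℝ → ℂ) (hL : Continuous L) (h : ∀ t, Complex.exp (L t) = F t)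
    {a b : ℝ} {x} (hx : F a = x) (hy : F b = x) (n : ℤ) (hn : L b = L a + n * (2 * Real.pi * I)) :
    expT.hol (tau F a b hx hy) = Multiplicative.ofAdd n := by
  obtain ⟨g, hg⟩ := expT.tr (L a)
  have hp : expT.p (L a) = x := by rw [← hx]; exact Subtype.ext (h a)
  rw [hp] at hg
  have := expT.hol_tau (Z := ℝ) F (⟨L, hL⟩ : C(ℝ, ℂ)) (fun t => Subtype.ext (h t)) hx hy (g := g) (k := Multiplicative.ofAdd n * g)
    hg.symm (by rw [expT.act_mul, hg]; exact hn)
  rw [this, mul_comm, mul_inv_cancel_right]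
lemma clog_c {f : ℝ → ℂ} (hf : Continuous f) (h : ∀ t, ‖f t - 1‖ < 1) : Continuous fun t => Complex.log (f t) :=
  continuous_iff_continuousAt.2 fun t => hf.continuousAt.clog (slit_of (h t))
lemma w00 : w0 ≠ 0 := by rw [← norm_pos_iff, w0n]; norm_num
lemma sgC (σ : Bool) : (sg σ : ℂ) ≠ 0 := by rw [← norm_pos_iff, nsg]; norm_num
lemma IsL.wind {σ : Bool} {G : C(ℝ, W0)} (h : IsL σ G) (ha : ‖bb σ (G 0) - Bb σ‖ < 1/1000)
    {q : W0} (h0 : G 0 = q) (h1 : G (2 * Real.pi) = q) :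
    lh (!σ) (mp j (tau G 0 (2 * Real.pi) h0 h1)) = Multiplicative.ofAdd (-1) ∧
    lh σ (mp j (tau G 0 (2 * Real.pi) h0 h1)) = 1 := by
  have hc : Continuous fun t => bb σ (G t) := (bb_c σ).comp G.continuous
  have hf := h.far ha
  have hB := Bb0 σ
  have hs : ∀ t, ‖bb σ (G t) / Bb σ - 1‖ < 1 := fun t => by
    rw [show bb σ (G t) / Bb σ - 1 = (bb σ (G t) - Bb σ) / Bb σ by field_simp, norm_div, Bbn, div_lt_one (by norm_num)]
    linarith [hf t]
  have hC : (-4 * sg σ * w0) ≠ 0 := mul_ne_zero (mul_ne_zero (by norm_num) (sgC σ)) w00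
  have hs' : ∀ t, ‖(bb σ (G t) - sg σ * w0) / (-4 * sg σ * w0) - 1‖ < 1 := fun t => by
    rw [div_sub_one hC, show bb σ (G t) - sg σ * w0 - -4 * sg σ * w0 = bb σ (G t) - Bb σ by simp only [Bb]; ring, norm_div, div_lt_one (norm_pos_iff.2 hC)]
    rw [norm_mul, norm_mul, nsg, w0n]
    norm_num
    linarith [hf t]
  have hl := clog_c (hc.div_const (Bb σ)) hs
  have hl' := clog_c ((hc.sub (continuous_const (y := sg σ * w0))).div_const (-4 * sg σ * w0)) hs'
  have hb0 : ∀ t, bb σ (G t) ≠ 0 := fun t h0 => by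
    have := far_not (hf t); rw [h0] at this; norm_num at this
  have eper : G (2 * Real.pi) = G 0 := h1.trans h0.symm
  constructor
  · simp only [lh, mp_tau]
    refine ehol _ (fun t => Complex.log (I * (1/10^7)) - t * I - (Complex.log (bb σ (G t) / Bb σ) + Complex.log (Bb σ))
      - (Complex.log (bb σ (G t) / Bb σ) + Complex.log (Bb σ))) (by fun_prop) (fun t => ?_) _ _ (-1) ?_
    · have e := (cir_eq (h t)).2
      have e1 := (cir_eq (h t)).1
      rw [Complex.exp_sub, Complex.exp_sub, Complex.exp_sub, Complex.exp_add, Complex.exp_log (by simp),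
        Complex.exp_log (Complex.slitPlane_ne_zero (slit_of (hs t))), Complex.exp_log hB, div_mul_cancel₀ _ hB]
      change _ = (G t).1.2 - sg (!σ) * (2 * (G t).1.1)
      rw [e1, sg_not]
      have e2 : (G t).1.2 - ((-sg σ : ℝ) : ℂ) * (2 * w0) = bb σ (G t) - Bb σ := by
        simp only [bb, Bb]; push_cast; ring
      rw [e2, div_div, div_eq_iff (mul_ne_zero (hb0 t) (hb0 t)), ← pow_two, e, Complex.exp_neg]; rfl
    · rw [eper]; push_cast; ring
  · simp only [lh, mp_tau]
    refine (ehol _ (fun t => Complex.log ((bb σ (G t) - sg σ * w0) / (-4 * sg σ * w0)) + Complex.log (-4 * sg σ * w0))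
      (by fun_prop) (fun t => ?_) _ _ 0 ?_).trans rfl
    · have e1 := (cir_eq (h t)).1
      rw [Complex.exp_add, Complex.exp_log (Complex.slitPlane_ne_zero (slit_of (hs' t))), Complex.exp_log hC,
        div_mul_cancel₀ _ hC]
      change _ = (G t).1.2 - sg σ * (2 * (G t).1.1)
      rw [e1]; simp only [bb]; ring
    · rw [eper]; simp
def Dn (σ : Bool) : Set (ℂ × ℂ) := {q | q.1 = w0 ∧ ‖q.2 - sg σ * w0‖ < 1/100}
lemma Dn_sub (σ : Bool) : Dn σ ⊆ Wh := by
  rintro ⟨w, a⟩ ⟨h1, h2⟩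
  obtain rfl : w = w0 := h1
  change ‖a - sg σ * w0‖ < 1/100 at h2
  have hz := wz σ
  have hk : ‖cF w0 a - zf (.z σ) w0‖ ≤ 1/10^4 := by
    rw [cF_z, norm_mul, norm_mul, norm_pow, Complex.norm_I, one_mul]
    have : ‖a + 2 * sg σ * w0‖ ≤ 4/100 := by
      have e : a + 2 * sg σ * w0 = (a - sg σ * w0) + 3 * sg σ * w0 := by ring
      rw [e]
      refine (norm_add_le _ _).trans ?_
      rw [norm_mul, norm_mul, nsg, w0n]; norm_num; linarith
    have h3 : ‖a - sg σ * w0‖ ^ 2 ≤ (1/100)^2 := pow_le_pow_left₀ (norm_nonneg _) h2.le 2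
    calc _ ≤ (4/100) * ((1/100 : ℝ)^2) := mul_le_mul this h3 (by positivity) (by norm_num)
      _ ≤ _ := by norm_num
  have hre : (cF w0 a).re < 0 := by
    have := (Complex.abs_re_le_norm _).trans hk
    rw [Complex.sub_re, hz.1, abs_le] at this
    linarith [this.2]
  refine ⟨fun h => ?_, fun s h => ?_, fun s h => ?_⟩
  · change cF w0 a = 0 at h
    rw [h] at hre; simp at hre
  · change cF w0 a = _ at h
    rw [h, bre] at hre; linarith
  · change a = sg s * (2 * w0) at h
    rw [h, show (sg s : ℂ) * (2 * w0) - sg σ * w0 = ((2 * sg s - sg σ : ℝ) : ℂ) * w0 by push_cast; ring, norm_mul, w0n,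
      Complex.norm_real] at h2
    have : 1 ≤ ‖2 * sg s - sg σ‖ := by cases s <;> cases σ <;> norm_num
    linarith
instance Dn_contr (σ : Bool) : ContractibleSpace (Dn σ) := by
  have : Convex ℝ (Dn σ) := by
    have e : Dn σ = ({w0} : Set ℂ) ×ˢ Metric.ball (sg σ * w0) (1/100) := by
      ext q; simp [Dn, dist_eq_norm]
    rw [e]; exact (convex_singleton _).prod (convex_ball _ _)
  exact this.contractibleSpace ⟨(w0, sg σ * w0), rfl, by simp⟩
lemma tau_near {σ : Bool} {G G' : C(ℝ, W0)} (h : IsL σ G) (h' : IsL σ G') (n : ‖bb σ (G 0)‖ < 1/100)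
    (n' : ‖bb σ (G' 0)‖ < 1/100) {q q' : W0} (h1 : G 0 = q) (h2 : G (2 * Real.pi) = q') (h3 : G' 0 = q') (h4 : G' (2 * Real.pi) = q) :
    mp j (tau G 0 (2 * Real.pi) h1 h2) ≫ mp j (tau G' 0 (2 * Real.pi) h3 h4) = 𝟙 _ := by
  have key : ∀ (G : C(ℝ, W0)) (h : IsL σ G) (n : ∀ t, ‖bb σ (G t)‖ < 1/100) {q q' : W0} (h1 : G 0 = q) (h2 : G (2 * Real.pi) = q')
      (m : q.1 ∈ Dn σ) (m' : q'.1 ∈ Dn σ),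
      mp j (tau G 0 (2 * Real.pi) h1 h2) = tau (seg (Dn_sub σ)) ⟨q.1, m⟩ ⟨q'.1, m'⟩ rfl rfl := by
    intro G h n q q' h1 h2 m m'
    subst h1 h2
    rw [mp_tau]
    exact tau_pre (seg (Dn_sub σ)) (j.comp G) (fun t => ⟨(G t).1, (cir_eq (h t)).1, n t⟩) (by
      refine Continuous.subtype_mk ?_ _; fun_prop) (fun t => rfl) _ _
  have m : q.1 ∈ Dn σ := by rw [← h1]; exact ⟨(cir_eq (h 0)).1, n⟩
  have m' : q'.1 ∈ Dn σ := by rw [← h3]; exact ⟨(cir_eq (h' 0)).1, n'⟩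
  rw [key G h (h.near n) h1 h2 m m', key G' h' (h'.near n') h3 h4 m' m]
  exact (tau_comp _ _ _ _ _).trans (tau_refl _ _ _ _)
lemma fib3 : ∃ e1 e2 e3 : W0, e1 ≠ e2 ∧ e1 ≠ e3 ∧ e2 ≠ e3 ∧ ∀ e, Pi0 e = K.pb false ↔ e = e1 ∨ e = e2 ∨ e = e3 := by
  obtain ⟨s, hs⟩ := IsAlgClosed.exists_pow_nat_eq (-3 : ℂ) (n := 2) (by norm_num)
  have hb : (K.pb false).1 = (0, -8 * I) := by
    change K.base false = _
    simp only [Marks.base, K]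
    refine Prod.ext rfl (Complex.ext ?_ ?_) <;> norm_num
  have key : ∀ a : ℂ, Pf (0, a) = (K.pb false).1 ↔ a = -2 ∨ a = 1 + s ∨ a = 1 - s := by
    intro a
    rw [hb, Pf, Prod.mk.injEq]
    have e : cF 0 a - (-8 * I) = I * ((a - (-2)) * ((a - (1 + s)) * (a - (1 - s)))) := by
      simp only [cF]; linear_combination I * (a + 2) * hs
    constructor
    · rintro ⟨-, h⟩
      rw [← sub_eq_zero, e] at h
      have := (mul_eq_zero.1 h).resolve_left Complex.I_ne_zero
      simpa only [mul_eq_zero, sub_eq_zero] using this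
    · intro h
      refine ⟨rfl, ?_⟩
      rw [← sub_eq_zero, e]
      rcases h with rfl | rfl | rfl <;> simp
  have hm : ∀ a, (a = -2 ∨ a = 1 + s ∨ a = 1 - s) → (0, a) ∈ W0 := fun a h => by
    have := (key a).2 h
    change Pf (0, a) ∈ K.Y
    rw [this]; exact (K.pb false).2
  have d1 : (-2 : ℂ) ≠ 1 + s := fun h => by
    have e : s = -3 := by linear_combination -h
    rw [e] at hs; norm_num at hs
  have d2 : (-2 : ℂ) ≠ 1 - s := fun h => by
    have e : s = 3 := by linear_combination h
    rw [e] at hs; norm_num at hs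
  have d3 : 1 + s ≠ 1 - s := fun h => by
    have e : s = 0 := by linear_combination h / 2
    rw [e] at hs; norm_num at hs
  refine ⟨⟨_, hm _ (.inl rfl)⟩, ⟨_, hm _ (.inr (.inl rfl))⟩, ⟨_, hm _ (.inr (.inr rfl))⟩, ?_, ?_, ?_, ?_⟩
  · simpa using d1
  · simpa using d2
  · simpa using d3
  · rintro ⟨⟨w, a⟩, he⟩
    have e0 : Pi0 ⟨(w, a), he⟩ = K.pb false ↔ Pf (w, a) = (K.pb false).1 := Subtype.ext_iff
    rw [e0]
    constructor
    · intro h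
      obtain rfl : w = 0 := by rw [hb] at h; exact congrArg Prod.fst h
      rw [key] at h
      simpa using h
    · intro h
      have h' : w = 0 ∧ (a = -2 ∨ a = 1 + s ∨ a = 1 - s) := by
        rcases h with h | h | h <;> · have := congrArg Subtype.val h; simp only [Prod.mk.injEq] at this; tauto
      obtain ⟨rfl, h'⟩ := h'
      exact (key a).2 h'
theorem fill (σ : Bool) (X : Hm (K.pb false) (K.pb false))
    (hX : X = cr σ ≫ tau (cir σ) 0 (2 * Real.pi) rfl (cir_per σ) ≫ inv (cr σ)) :
    ∃ ex : W0, Pi0 ex = K.pb false ∧ (∃ ℓ : Hm ex ex, Lf Pi0 X ℓ ∧ lh (!σ) (mp j ℓ) = Multiplicative.ofAdd (-1) ∧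
      lh σ (mp j ℓ) = 1) ∧ ∀ e, Pi0 e = K.pb false → e ≠ ex → ∃ e', e' ≠ e ∧ e' ≠ ex ∧ ∃ (ℓ : Hm e e') (ℓ' : Hm e' e),
        Lf Pi0 X ℓ ∧ Lf Pi0 X ℓ' ∧ mp j ℓ ≫ mp j ℓ' = 𝟙 _ := by
  subst hX
  have inj : ∀ {e e' f f' : W0} {k : Hm e f} {k' : Hm e' f'}, Lf Pi0 (cr σ) k → Lf Pi0 (cr σ) k' → (e = e' ↔ f = f') := by
    intro e e' f f' k k' h h'
    constructor
    · rintro rfl; exact h.end_eq Pi0_cov h'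
    · rintro rfl; exact h.inv.end_eq Pi0_cov h'.inv
  have pull : ∀ f : W0, Pi0 f = cir σ 0 → ∃ e, ∃ k : Hm e f, Lf Pi0 (cr σ) k := fun f hf => by
    obtain ⟨e, k, hk⟩ := Lf.ex Pi0_cov (inv (cr σ)) hf
    exact ⟨e, inv k, by simpa using hk.inv⟩
  have hL : ∀ {G : C(ℝ, W0)}, IsL σ G → ∀ {q q' e e' : W0} (h0 : G 0 = q) (h1 : G (2 * Real.pi) = q') {k : Hm e q} {k' : Hm e' q'},
      Lf Pi0 (cr σ) k → Lf Pi0 (cr σ) k' → Lf Pi0 (cr σ ≫ tau (cir σ) 0 (2 * Real.pi) rfl (cir_per σ) ≫ inv (cr σ))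
        (k ≫ tau G 0 (2 * Real.pi) h0 h1 ≫ inv k') := by
    intro G hG q q' e e' h0 h1 k k' hk hk'
    exact hk.comp ((Lf.tau (cir σ) G hG _ _ _ _).comp hk'.inv)
  obtain ⟨e1, e2, e3, d1, d2, d3, hfib⟩ := fib3
  have hp1 := (hfib e1).2 (.inl rfl)
  have hp2 := (hfib e2).2 (.inr (.inl rfl))
  have hp3 := (hfib e3).2 (.inr (.inr rfl))
  obtain ⟨ex, fx, kx, hex, hkx, hfx⟩ : ∃ ex fx, ∃ kx : Hm ex fx, Pi0 ex = K.pb false ∧ Lf Pi0 (cr σ) kx ∧ ‖bb σ fx - Bb σ‖ < 1/1000 := by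
    obtain ⟨f1, k1, hk1⟩ := Lf.ex Pi0_cov (cr σ) hp1
    obtain ⟨f2, k2, hk2⟩ := Lf.ex Pi0_cov (cr σ) hp2
    obtain ⟨f3, k3, hk3⟩ := Lf.ex Pi0_cov (cr σ) hp3
    by_cases n1 : ‖bb σ f1‖ < 1/100
    · by_cases n2 : ‖bb σ f2‖ < 1/100
      · by_cases n3 : ‖bb σ f3‖ < 1/100
        · exact absurd (near3 hk1.tgt hk2.tgt hk3.tgt n1 n2 n3 (fun h => d1 ((inj hk1 hk2).2 h)) (fun h => d2 ((inj hk1 hk3).2 h)))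
            (fun h => d3 ((inj hk2 hk3).2 h))
        · exact ⟨e3, f3, k3, hp3, hk3, (cir_ov hk3.tgt).dich n3⟩
      · exact ⟨e2, f2, k2, hp2, hk2, (cir_ov hk2.tgt).dich n2⟩
    · exact ⟨e1, f1, k1, hp1, hk1, (cir_ov hk1.tgt).dich n1⟩
  refine ⟨ex, hex, ?_, ?_⟩
  · obtain ⟨G, hG, h0⟩ := IsL.ex σ fx hkx.tgt
    have hf : ‖bb σ (G 0) - Bb σ‖ < 1/1000 := by rw [h0]; exact hfx
    have h1 : G (2 * Real.pi) = fx := by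
      refine far_uniq (t := 0) ((hG _).trans (cir_per σ)) hkx.tgt (hG.far hf _) hfx
    refine ⟨_, hL hG h0 h1 hkx hkx, ?_⟩
    obtain ⟨w1, w2⟩ := hG.wind hf h0 h1
    simp only [mp_comp, mp_inv, lh_comp, lh_inv, w1, w2]
    constructor
    · rw [mul_comm, mul_assoc, inv_mul_cancel, mul_one]
    · simp
  · intro e he hne
    obtain ⟨f, k, hk⟩ := Lf.ex Pi0_cov (cr σ) he
    have hn : ‖bb σ f‖ < 1/100 := by
      by_contra hc
      exact hne ((inj hk hkx).2 (far_uniq hk.tgt hkx.tgt ((cir_ov hk.tgt).dich hc) hfx))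
    obtain ⟨G, hG, h0⟩ := IsL.ex σ f hk.tgt
    have hn0 : ‖bb σ (G 0)‖ < 1/100 := by rw [h0]; exact hn
    have t1 : Pi0 (G (2 * Real.pi)) = cir σ 0 := (hG _).trans (cir_per σ)
    obtain ⟨f', hf'⟩ : ∃ f', G (2 * Real.pi) = f' := ⟨_, rfl⟩
    rw [hf'] at t1
    obtain ⟨e', k', hk'⟩ := pull f' t1
    have hn' : ‖bb σ f'‖ < 1/100 := hf' ▸ hG.near hn0 _
    have hff : f' ≠ f := by rw [← hf', ← h0]; exact hG.swap hn0
    obtain ⟨G', hG', h0'⟩ := IsL.ex σ f' t1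
    have hn0' : ‖bb σ (G' 0)‖ < 1/100 := by rw [h0']; exact hn'
    have h1' : G' (2 * Real.pi) = f := near3 (t := 0) t1 ((hG' _).trans (cir_per σ)) hk.tgt hn' (hG'.near hn0' _) hn
      (by rw [← h0']; exact (hG'.swap hn0').symm) hff
    refine ⟨e', fun h => hff ((inj hk' hk).1 h), fun h => ?_, _, _, hL hG h0 hf' hk hk', hL hG' h0' h1' hk' hk, ?_⟩
    · have := (inj hk' hkx).1 h
      exact far_not hfx (this ▸ hn')
    · have := tau_near hG hG' hn0 hn0' h0 hf' h0' h1'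
      simp only [mp_comp, mp_inv, Category.assoc, IsIso.inv_hom_id_assoc]
      rw [reassoc_of% this]; simp
open Complex (I)
lemma cjoin {V F : Set ℂ} (hV : IsOpen V) (hc : Convex ℝ V) (h0 : (0 : ℂ) ∈ V) (h1 : (1 : ℂ) ∈ V)
    (hF : F.Finite) (f0 : (0 : ℂ) ∉ F) (f1 : (1 : ℂ) ∉ F) : JoinedIn (V \ F) 0 1 := by
  have hm : (⟨1/2, 0⟩ : ℂ) ∈ V := by
    have := hc h0 h1 (a := 1/2) (b := 1/2) (by norm_num) (by norm_num) (by norm_num)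
    convert this using 1; apply Complex.ext <;> simp
  have hcont : Continuous fun c : ℝ => (⟨1/2, c⟩ : ℂ) := Marks.cont_mk continuous_const continuous_id
  obtain ⟨ε, hε, hb⟩ := Metric.isOpen_iff.1 (hV.preimage hcont) 0 hm
  obtain ⟨c, hc1, hc2⟩ := (Set.Ioo_infinite hε).exists_notMem_finite
    ((hF.image fun z => z.im / (2 * z.re)).union (hF.image fun z => z.im / (2 * (1 - z.re))))
  have hcV : (⟨1/2, c⟩ : ℂ) ∈ V := hb (by
    rw [Metric.mem_ball, Real.dist_eq, sub_zero, abs_of_pos hc1.1]; exact hc1.2)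
  have j1 : JoinedIn (V \ F) 0 (⟨1/2, c⟩ : ℂ) := by
    refine JoinedIn.of_segment_subset fun z hz => ⟨hc.segment_subset h0 hcV hz, fun hzF => ?_⟩
    obtain ⟨a, s, ha, hs, hh, rfl⟩ := hz
    rcases eq_or_ne s 0 with rfl | hs0
    · exact f0 (by simpa using hzF)
    · refine hc2 (Or.inl ⟨_, hzF, ?_⟩); simp; field_simp
  refine j1.trans (JoinedIn.of_segment_subset fun z hz => ⟨hc.segment_subset hcV h1 hz, fun hzF => ?_⟩)
  obtain ⟨a, s, ha, hs, hh, rfl⟩ := hz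
  obtain rfl : s = 1 - a := by linarith
  rcases eq_or_ne a 0 with rfl | hs0
  · exact f1 (by simpa using hzF)
  · refine hc2 (Or.inr ⟨_, hzF, ?_⟩)
    simp
    rw [div_eq_iff (by ring_nf; exact hs0)]; ring
def ph (x y : ℂ × ℂ) (t : ℂ) : ℂ × ℂ := (x.1 + t * (y.1 - x.1), x.2 + t * (y.2 - x.2))
lemma ph_c (x y) : Continuous (ph x y) := by unfold ph; fun_prop
lemma ph_0 (x y) : ph x y 0 = x := by simp [ph]
lemma ph_1 (x y) : ph x y 1 = y := by simp [ph]
lemma bad {x y : ℂ × ℂ} {t0 : ℂ} (h : ph x y t0 ∈ W0) : {t | ph x y t ∉ W0}.Finite := by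
  have key : ∀ i, {t | cF (ph x y t).1 (ph x y t).2 = zf i (ph x y t).1}.Finite := by
    intro i
    open Polynomial in
    have : ∃ p : Polynomial ℂ, ∀ t, p.eval t = cF (ph x y t).1 (ph x y t).2 - zf i (ph x y t).1 := by
      set w : Polynomial ℂ := C x.1 + X * C (y.1 - x.1) with hw
      set a : Polynomial ℂ := C x.2 + X * C (y.2 - x.2) with ha
      cases i with
      | o => exact ⟨C I * (a ^ 3 - 3 * a * w ^ 2) + 3 * w, fun t => by simp [cF, zf, ph, hw, ha]⟩
      | b s => exact ⟨C I * (a ^ 3 - 3 * a * w ^ 2) + 3 * w - C (1 - sg s * I), fun t => by simp [cF, zf, ph, hw, ha]⟩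
      | z s => exact ⟨C I * (a ^ 3 - 3 * a * w ^ 2) + 3 * w - (3 * w - C (2 * sg s * I) * w ^ 3), fun t => by
          simp [cF, zf, ph, hw, ha]⟩
    obtain ⟨p, hp⟩ := this
    have hp0 : p ≠ 0 := fun h0 => by
      have := hp t0; rw [h0, Polynomial.eval_zero] at this
      exact h i (sub_eq_zero.1 this.symm)
    refine (Multiset.finite_toSet p.roots).subset fun t ht => ?_
    simp only [Set.mem_ofPred_eq, Polynomial.mem_roots hp0, Polynomial.IsRoot, hp, sub_eq_zero] at ht ⊢
    exact ht
  refine ((key .o).union (((key (.b true)).union (key (.b false))).union ((key (.z true)).union (key (.z false))))).subset ?_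
  intro t ht
  by_contra hn
  refine ht fun i hi => hn ?_
  rcases i with (_ | _) | _ | (_ | _)
  · exact Or.inr (Or.inr (Or.inr hi))
  · exact Or.inr (Or.inr (Or.inl hi))
  · exact Or.inl hi
  · exact Or.inr (Or.inl (Or.inr hi))
  · exact Or.inr (Or.inl (Or.inl hi))
lemma W0_join {U : Set (ℂ × ℂ)} (hU : IsOpen U) (hc : Convex ℝ U) {x y} (hx : x ∈ U ∩ W0) (hy : y ∈ U ∩ W0) :
    JoinedIn (U ∩ W0) x y := by
  have h := cjoin (V := ph x y ⁻¹' U) (hU.preimage (ph_c x y)) (fun s hs t ht a b ha hb hab => by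
      have := hc hs ht ha hb hab
      change _ ∈ U
      convert this using 1
      simp only [ph, Complex.real_smul, Prod.smul_mk, Prod.mk_add_mk]
      have hb' : b = 1 - a := by linarith
      subst hb'; ext <;> simp <;> ring) (by simpa [ph_0] using hx.1) (by simpa [ph_1] using hy.1)
    (bad (x := x) (y := y) (t0 := 0) (by simpa [ph_0] using hx.2)) (by simpa [ph_0] using hx.2) (by simpa [ph_1] using hy.2)
  have := h.map_continuousOn (f := ph x y) (ph_c x y).continuousOn
  rw [ph_0, ph_1] at this
  refine this.mono ?_
  rintro _ ⟨t, ht, rfl⟩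
  exact ⟨ht.1, not_not.1 ht.2⟩
lemma W0_dense (e : W0) (q : ℂ × ℂ) {ε : ℝ} (hε : 0 < ε) : ∃ r ∈ Metric.ball q ε, r ∈ W0 := by
  have hb := bad (x := q) (y := e) (t0 := 1) (by rw [ph_1]; exact e.2)
  have hcont : Continuous fun c : ℝ => ph q e c := (ph_c q e).comp Complex.continuous_ofReal
  obtain ⟨δ, hδ, hd⟩ := Metric.isOpen_iff.1 ((Metric.isOpen_ball (x := q) (ε := ε)).preimage hcont) 0
    (by simp [ph_0, hε])
  obtain ⟨c, hc1, hc2⟩ := (Set.Ioo_infinite hδ).exists_notMem_finite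
    (hb.preimage (f := fun c : ℝ => (c : ℂ)) Complex.ofReal_injective.injOn)
  exact ⟨ph q e c, hd (by rw [Metric.mem_ball, Real.dist_eq, sub_zero, abs_of_pos hc1.1]; exact hc1.2), not_not.1 hc2⟩
lemma ballJ {c : ℂ × ℂ} {ε : ℝ} [Fact (0 < ε)] (hB : Metric.ball c ε ⊆ Wh) (x y : W0) (hx : x.1 ∈ Metric.ball c ε)
    (hy : y.1 ∈ Metric.ball c ε) : ∃ ℓ : Hm x y, mp j ℓ = tau (seg hB) ⟨x, hx⟩ ⟨y, hy⟩ rfl rfl := by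
  have hj := (W0_join Metric.isOpen_ball (convex_ball c ε) ⟨hx, x.2⟩ ⟨hy, y.2⟩).joined_subtype
  have m := cls hj.somePath
  refine ⟨mp (seg Set.inter_subset_right) m, ?_⟩
  refine Eq.trans ?_ (tau_eq (seg hB) _ _ (mp (seg Set.inter_subset_left) m))
  exact (mp_mp _ _ m).trans (mp_mp (seg hB) (seg Set.inter_subset_left) m).symm
lemma j_full (e e' : W0) (m : Hm (j e) (j e')) : ∃ ℓ : Hm e e', mp j ℓ = m := by
  have key := pathInduct (A := Wh) (x0 := j e) (fun q m => ∀ (c : ℂ × ℂ) (ε : ℝ) (_ : Fact (0 < ε))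
    (hB : Metric.ball c ε ⊆ Wh) (hq : q.1 ∈ Metric.ball c ε) (q' : W0) (hq' : q'.1 ∈ Metric.ball c ε),
    ∃ ℓ : Hm e q', mp j ℓ = m ≫ tau (seg hB) ⟨q, hq⟩ ⟨q', hq'⟩ rfl rfl)
    (fun c ε _ hB hq q' hq' => by
      obtain ⟨ℓ, h⟩ := ballJ hB e q' hq hq'
      exact ⟨ℓ, h.trans (Category.id_comp _).symm⟩)
    (fun q => by
      obtain ⟨ε, hε, hB⟩ := Metric.isOpen_iff.1 Wh_open q q.2
      refine ⟨ε, ⟨hε⟩, hB, fun q1 q2 m hS c δ _ hC hq q' hq' => ?_⟩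
      have : Fact (0 < ε) := ⟨hε⟩
      obtain ⟨η, hη, hD⟩ := Metric.isOpen_iff.1 ((Metric.isOpen_ball (x := q.1) (ε := ε)).inter
        (Metric.isOpen_ball (x := c) (ε := δ))) q2.1 ⟨q2.2, hq⟩
      have : Fact (0 < η) := ⟨hη⟩
      obtain ⟨r, hr, hr0⟩ := W0_dense e q2.1 hη
      obtain ⟨ℓ1, h1⟩ := hS q ε ⟨hε⟩ hB q1.2 ⟨r, hr0⟩ (hD hr).1
      obtain ⟨ℓ2, h2⟩ := ballJ hC ⟨r, hr0⟩ q' (hD hr).2 hq'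
      refine ⟨ℓ1 ≫ ℓ2, ?_⟩
      have hDB : Metric.ball q2.1 η ⊆ Metric.ball q.1 ε := fun _ h => (hD h).1
      have hDC : Metric.ball q2.1 η ⊆ Metric.ball c δ := fun _ h => (hD h).2
      have e1 := tau_pre (seg hB) (seg (hDB.trans hB)) (seg hDB) (seg hDB).continuous (fun _ => rfl)
        (a := ⟨r, hr⟩) (b := ⟨q2.1, Metric.mem_ball_self hη⟩) rfl rfl
      have e2 := tau_pre (seg hC) (seg (hDB.trans hB)) (seg hDC) (seg hDC).continuous (fun _ => rfl)
        (a := ⟨r, hr⟩) (b := ⟨q2.1, Metric.mem_ball_self hη⟩) rfl rfl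
      have e3 : tau (seg hB) q1 q2 rfl rfl ≫ tau (seg hC) ⟨seg hB q2, hq⟩ ⟨q', hq'⟩ rfl rfl =
          tau (seg hB) q1 ⟨r, (hD hr).1⟩ rfl rfl ≫ tau (seg hC) ⟨r, (hD hr).2⟩ ⟨q', hq'⟩ rfl rfl := by
        refine (congrArg (· ≫ _) (tau_comp (seg hB) rfl rfl rfl rfl).symm).trans
          ((Category.assoc _ _ _).trans (congrArg (tau (seg hB) q1 ⟨r, (hD hr).1⟩ rfl rfl ≫ ·) ?_))
        exact (congrArg (· ≫ _) (e1.symm.trans e2)).trans (tau_comp (seg hC) rfl rfl rfl rfl)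
      rw [mp_comp, h1, h2]
      refine (Category.assoc _ _ _).trans ((congrArg (m ≫ ·) e3.symm).trans (Category.assoc _ _ _).symm))
    (j e') m
  obtain ⟨ε, hε, hB⟩ := Metric.isOpen_iff.1 Wh_open _ (j e').2
  obtain ⟨ℓ, h⟩ := key _ ε ⟨hε⟩ hB (Metric.mem_ball_self hε) e' (Metric.mem_ball_self hε)
  have : Fact (0 < ε) := ⟨hε⟩
  refine ⟨ℓ, h.trans ?_⟩
  exact (congrArg (m ≫ ·) (tau_refl (seg hB) _ rfl rfl)).trans (Category.comp_id _)
lemma W0_conn (x y : W0) : Nonempty (Hm x y) := by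
  have := (W0_join isOpen_univ convex_univ ⟨trivial, x.2⟩ ⟨trivial, y.2⟩).joined_subtype
  exact ⟨mp (seg Set.inter_subset_right) (cls this.somePath)⟩
lemma Wh_conn (e : W0) (q : Wh) : Nonempty (Hm (j e) q) := by
  obtain ⟨ε, hε, hB⟩ := Metric.isOpen_iff.1 Wh_open _ q.2
  have : Fact (0 < ε) := ⟨hε⟩
  obtain ⟨r, hr, hr0⟩ := W0_dense e q.1 hε
  obtain ⟨ℓ⟩ := W0_conn e ⟨r, hr0⟩
  exact ⟨mp j ℓ ≫ tau (seg hB) ⟨r, hr⟩ ⟨q.1, Metric.mem_ball_self hε⟩ rfl rfl⟩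
open Complex (I)
open scoped Topology
abbrev F3 := FreeGroup (Fin 3)
instance : TopologicalSpace F3 := ⊥
instance : DiscreteTopology F3 := ⟨rfl⟩
def mk3 : Option Bool → ℂ
  | none => 0
  | some s => zf (.b s) 0
def kp (z : ℂ) : ℝ := z.re - z.im / 2
def X3 : Set ℂ := {z | ∀ i, z ≠ mk3 i}
lemma kp0 : kp (mk3 none) = 0 := by simp [kp, mk3]
lemma kpb (s : Bool) : kp (mk3 (some s)) = 1 + sg s / 2 := by
  simp only [kp, mk3, bre, bim]; ring
lemma kp_inj {i k : Option Bool} (h : kp (mk3 i) = kp (mk3 k)) : i = k := by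
  rcases i with _ | (_ | _) <;> rcases k with _ | (_ | _) <;> simp only [kp0, kpb, sg_t, sg_f] at h <;>
    first | rfl | (norm_num at h)
def U3 (b : Bool) : Set X3 := {z | ∀ i, kp z = kp (mk3 i) → 0 < sg b * (z.1.im - (mk3 i).im)}
lemma kp_c : Continuous fun z : X3 => kp z := by unfold kp; fun_prop
lemma U3_open (b : Bool) : IsOpen (U3 b) := by
  have : U3 b = ⋂ i, ({z : X3 | kp z ≠ kp (mk3 i)} ∪ {z : X3 | 0 < sg b * (z.1.im - (mk3 i).im)}) := by
    ext z; simp only [U3, Set.mem_iInter, Set.mem_union, Set.mem_ofPred_eq, ne_eq, imp_iff_not_or]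
  rw [this]
  exact isOpen_iInter_of_finite fun i => (isOpen_ne_fun kp_c continuous_const).union
    (isOpen_lt continuous_const (by fun_prop))
lemma U3_ov {z : X3} (h : ∀ b, z ∈ U3 b) (i) : kp z ≠ kp (mk3 i) := fun e => by
  have h1 := h true i e; have h2 := h false i e
  simp only [sg_t, sg_f] at h1 h2; linarith
def ix3 (z : X3) : Bool := by classical exact if z ∈ U3 false then false else true
lemma ix3_mem (z : X3) : z ∈ U3 (ix3 z) := by
  unfold ix3
  split_ifs with h
  · exact h
  · simp only [U3, Set.mem_ofPred_eq, not_forall] at h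
    obtain ⟨i, e, h⟩ := h
    intro k e'
    obtain rfl := kp_inj (e.symm.trans e')
    simp only [sg_f, sg_t] at h ⊢
    have : z.1.im ≠ (mk3 i).im := fun h' => z.2 i (Complex.ext (by simp only [kp] at e; linarith) h')
    rcases lt_or_gt_of_ne this with h' | h' <;> linarith
def sk (k : ℝ) : F3 := (if k < 0 then .of 0 else 1) * (if k < 1/2 then .of 1 else 1) * (if k < 3/2 then .of 2 else 1)
def tt (b : Bool) (z : ℂ) : F3 := if b then sk (kp z) else 1
lemma ev_lt {c k0 : ℝ} (h : k0 ≠ c) : ∀ᶠ k in 𝓝 k0, (k < c ↔ k0 < c) := by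
  rcases lt_or_gt_of_ne h with h | h
  · filter_upwards [eventually_lt_nhds h] with k hk; simp [hk, h]
  · filter_upwards [eventually_gt_nhds h] with k hk; exact iff_of_false hk.not_gt h.not_gt
lemma tt_lc {i k : Bool} {z : X3} (hi : z ∈ U3 i) (hk : z ∈ U3 k) :
    ∀ᶠ y : X3 in 𝓝 z, (tt i y)⁻¹ * tt k y = (tt i z)⁻¹ * tt k z := by
  rcases eq_or_ne i k with rfl | hne
  · simp
  have h := U3_ov (z := z) (fun b => by cases b <;> cases i <;> cases k <;> simp_all)
  have h0 := h none; have h1 := h (some true); have h2 := h (some false)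
  rw [kp0] at h0; rw [kpb, sg_t] at h1; rw [kpb, sg_f] at h2
  have key : ∀ᶠ y : X3 in 𝓝 z, sk (kp y) = sk (kp z) := by
    filter_upwards [kp_c.continuousAt.eventually (ev_lt h0),
      kp_c.continuousAt.eventually (ev_lt (c := 3/2) (fun e => h1 (e.trans (by norm_num)))),
      kp_c.continuousAt.eventually (ev_lt (c := 1/2) (fun e => h2 (e.trans (by norm_num))))] with y a b c
    simp only [sk, a, b, c]
  filter_upwards [key] with y hy
  simp only [tt, hy]
def Z3 : FiberBundleCore Bool X3 F3 where
  baseSet := U3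
  isOpen_baseSet := U3_open
  indexAt := ix3
  mem_baseSet_at := ix3_mem
  coordChange i k x g := g * ((tt i x)⁻¹ * tt k x)
  coordChange_self i x _ v := by simp
  continuousOn_coordChange i k := by
    rintro ⟨z, g⟩ ⟨⟨hi, hk⟩, -⟩
    refine ContinuousAt.continuousWithinAt ?_
    have h := (continuous_fst (X := X3) (Y := F3)).continuousAt (x := (z, g)) |>.eventually (tt_lc hi hk)
    refine (continuous_snd.mul (continuous_const (y := (tt i z)⁻¹ * tt k z))).continuousAt.congr ?_
    filter_upwards [h] with p hp
    rw [hp]; rfl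
  coordChange_comp i k l x _ v := by group
def fb (e : Z3.TotalSpace) : F3 := e.2
def mt (x : X3) (g : F3) : Z3.TotalSpace := ⟨x, g⟩
lemma c_tot {T : Type} [TopologicalSpace T] (f : T → Z3.TotalSpace) (t0 : T) (h1 : ContinuousAt (fun t => (f t).1) t0)
    (h2 : ∀ i, (f t0).1 ∈ U3 i → ContinuousAt (fun t => fb (f t) * ((tt (ix3 (f t).1) (f t).1)⁻¹ * tt i (f t).1)) t0) :
    ContinuousAt f t0 :=
  (FiberBundle.continuousAt_totalSpace F3 f).2 ⟨h1, h2 _ (ix3_mem _)⟩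
lemma pr_c : Continuous fun e : Z3.TotalSpace => e.1 := Z3.continuous_proj
lemma co_c (i : Bool) (e0 : Z3.TotalSpace) (h : e0.1 ∈ U3 i) :
    ContinuousAt (fun e : Z3.TotalSpace => fb e * ((tt (ix3 e.1) e.1)⁻¹ * tt i e.1)) e0 :=
  continuous_snd.continuousAt.comp ((Z3.localTriv i).continuousAt (x := e0) (by rw [(Z3.localTriv i).mem_source]; exact h))
def T3 : Tor X3 F3 where
  E := Z3.TotalSpace
  p e := e.1
  cov := FiberBundle.isCoveringMap (F := F3) (E := Z3.Fiber)
  act k := ⟨fun e => mt e.1 (k * fb e), continuous_iff_continuousAt.2 fun e0 => c_tot _ _ pr_c.continuousAt fun i hi => by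
    refine ((continuous_const (y := k)).continuousAt.mul (co_c i e0 hi)).congr (Filter.Eventually.of_forall fun e => ?_)
    exact (mul_assoc _ _ _).symm⟩
  act_p _ _ := rfl
  act_mul g k e := congrArg (mt e.1) (mul_assoc g k (fb e))
  sec x := mt x (tt (ix3 x) x)
  sec_p _ := rfl
  free g k b hh := by
    have : mt b (g * tt (ix3 b) b) = mt b (k * tt (ix3 b) b) := hh
    exact mul_right_cancel (congrArg fb this)
  tr e := ⟨fb e * (tt (ix3 e.1) e.1)⁻¹, congrArg (mt e.1) (inv_mul_cancel_right (fb e) _)⟩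
lemma T3_hol (i : Bool) {Z : Type} [TopologicalSpace Z] [ContractibleSpace Z] (F : C(Z, X3)) (hF : ∀ z, F z ∈ U3 i)
    {a b : Z} {x y : X3} (hx : F a = x) (hy : F b = y) : T3.hol (tau F a b hx hy) = tt i x * (tt i y)⁻¹ := by
  have hc : Continuous fun z => mt (F z) ((tt i (F z))⁻¹ * tt (ix3 (F z)) (F z)) :=
    continuous_iff_continuousAt.2 fun z0 => c_tot _ _ F.continuous.continuousAt fun k hk => by
      have h := F.continuous.continuousAt.eventually (tt_lc (hF z0) hk)
      refine (continuousAt_const (y := (tt i (F z0))⁻¹ * tt k (F z0))).congr ?_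
      filter_upwards [h] with z hz
      rw [← hz]; change _ = (tt i (F z))⁻¹ * tt (ix3 (F z)) (F z) * _
      change _ = _ * ((tt (ix3 (F z)) (F z))⁻¹ * tt k (F z))
      group
  have := T3.hol_tau F ⟨_, hc⟩ (fun _ => rfl) hx hy (g := (tt i x)⁻¹) (k := (tt i y)⁻¹) (by subst hx; rfl) (by subst hy; rfl)
  rw [this, inv_inv]
def cv : C(K.Y, X3) := ⟨fun q => ⟨q.1.2, fun i => by
  rcases i with _ | s
  · exact q.2 .o
  · exact q.2 (.b s)⟩, by refine Continuous.subtype_mk ?_ _; fun_prop⟩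
def cW : C(Wh, X3) := ⟨fun q => ⟨cF q.1.1 q.1.2, fun i => by
  rcases i with _ | s
  · exact q.2.1
  · exact q.2.2.1 s⟩, by refine Continuous.subtype_mk ?_ _; unfold cF; fun_prop⟩
lemma cv_hol (i : Bool) {Z : Type} [TopologicalSpace Z] [ContractibleSpace Z] (F : C(Z, K.Y)) (hF : ∀ z, cv (F z) ∈ U3 i)
    {a b : Z} {x y : K.Y} (hx : F a = x) (hy : F b = y) :
    T3.hol (mp cv (tau F a b hx hy)) = tt i x.1.2 * (tt i y.1.2)⁻¹ := by
  rw [mp_tau]; exact T3_hol i _ hF _ _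
lemma im3 (i) : |(mk3 i).im| ≤ 1 := by
  rcases i with _ | s
  · simp [mk3]
  · simp [mk3, bim, abs_sg]
lemma ray_hol (b : Bool) {x : ℝ} (h0 : x ≠ 0) (h1 : x ≠ 1/2) (h2 : x ≠ 3/2) (hg : K.RGood b w0 (Marks.thr (1/2) x 0) 0) :
    T3.hol (mp cv (K.ray b w0 (Marks.thr (1/2) x 0) (Marks.thr_c _ _ _) 0 hg)) = tt b (K.pb b).1.2 * (if b then sk x else 1)⁻¹ := by
  unfold Marks.ray
  refine (congrArg T3.hol (mp_comp _ _ _)).trans ((T3.hol_comp _ _).trans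
    ((congrArg₂ (· * ·) (cv_hol b _ (fun z i _ => ?_) _ _) (cv_hol b _ (fun z i hi => ?_) _ _)).trans
      ((mul_assoc _ _ _).symm.trans ((congrArg (· * _) (inv_mul_cancel_right _ _)).trans ?_))))
  rotate_left 2
  · congr 2
    simp [tt, cv, kp, Marks.thr]
  · have hz : K.ρ z.1.1 < sg b * z.1.2.im := z.2
    have h7 : 7 ≤ K.ρ z.1.1 := by simp only [K]; have := norm_nonneg z.1.1; nlinarith [pow_nonneg this 3]
    have := abs_le.1 (im3 i)
    change 0 < sg b * (z.1.2.im - _)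
    cases b <;> simp only [sg_t, sg_f] at hz ⊢ <;> linarith
  · exfalso
    have hz : kp (cv (K.rmap b w0 (Marks.thr (1/2) x 0) (Marks.thr_c _ _ _) 0 hg z)).1 = x := by
      simp only [kp, cv, Marks.rmap, Marks.thr, ContinuousMap.coe_mk]; ring
    have hi' : x = kp (mk3 i) := hz.symm.trans hi
    rcases i with _ | (_ | _)
    · rw [kp0] at hi'; exact h0 hi'
    · rw [kpb, sg_f] at hi'; exact h1 (hi'.trans (by norm_num))
    · rw [kpb, sg_t] at hi'; exact h2 (hi'.trans (by norm_num))
lemma H_hol {x : ℝ} {s : Ix → Bool} {A} (hA : K.GG w0 s A) (hp : K.Pt w0 (Marks.thr (1/2) x 0) s)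
    (h0 : x ≠ 0) (h1 : x ≠ 1/2) (h2 : x ≠ 3/2) : T3.hol (mp cv A) = sk x * (sk (kp (K.pb true).1.2))⁻¹ := by
  rw [← hA.eq (Marks.thr_c _ _ _) hp]
  unfold Marks.H
  rw [mp_comp, mp_inv]
  refine (T3.hol_comp _ _).trans ?_
  rw [T3.hol_inv, ray_hol false h0 h1 h2, ray_hol true h0 h1 h2]
  simp [tt]
abbrev p0 : K.Y := K.pb false
lemma hol_lf {x y : K.Y} {e e' : W0} {m : Hm x y} {ℓ : Hm e e'} (h : Lf Pi0 m ℓ) :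
    T3.hol (mp cW (mp j ℓ)) = T3.hol (mp cv m) := by
  obtain rfl := h.src
  obtain rfl := h.tgt
  obtain ⟨δ, γ, rfl, rfl, h⟩ := h
  refine congrArg T3.hol ?_
  rw [mp_cls, mp_cls, mp_cls]
  refine congrArg cls ?_
  ext t
  exact congrArg (fun q : K.Y => (q.1.2 : ℂ)) (h t)
def R (X : Hm p0 p0) {e e' : W0} (m : Hm (j e) (j e')) : Prop := ∃ ℓ : Hm e e', Lf Pi0 X ℓ ∧ mp j ℓ = m
namespace R
variable {X Y : Hm p0 p0} {a b c : W0}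
lemma mul {m : Hm (j a) (j b)} {n : Hm (j b) (j c)} (h : R X m) (h' : R Y n) : R (X * Y) (m ≫ n) := by
  obtain ⟨ℓ, h1, rfl⟩ := h
  obtain ⟨k, h2, rfl⟩ := h'
  exact ⟨ℓ ≫ k, h1.comp h2, mp_comp _ _ _⟩
lemma ri {m : Hm (j a) (j b)} (h : R X m) : R X⁻¹ (inv m) := by
  obtain ⟨ℓ, h1, rfl⟩ := h
  exact ⟨inv ℓ, h1.inv, mp_inv _ _⟩
lemma one (h : Pi0 a = p0) : R 1 (𝟙 (FundamentalGroupoid.mk (j a))) := ⟨𝟙 _, Lf.one h, mp_id _ _⟩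
lemma ex (X : Hm p0 p0) (h : Pi0 a = p0) : ∃ b, ∃ m : Hm (j a) (j b), R X m := by
  obtain ⟨b, ℓ, h⟩ := Lf.ex Pi0_cov X h
  exact ⟨b, _, ℓ, h, rfl⟩
lemma en {m : Hm (j a) (j b)} {n : Hm (j a) (j c)} (h : R X m) (h' : R X n) : b = c := by
  obtain ⟨ℓ, h1, rfl⟩ := h
  obtain ⟨k, h2, rfl⟩ := h'
  exact h1.end_eq Pi0_cov h2
lemma un {m n : Hm (j a) (j b)} (h : R X m) (h' : R X n) : m = n := by
  obtain ⟨ℓ, h1, rfl⟩ := h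
  obtain ⟨k, h2, rfl⟩ := h'
  rw [h1.uniq Pi0_cov h2]
lemma src {m : Hm (j a) (j b)} (h : R X m) : Pi0 a = p0 := h.choose_spec.1.src
lemma tgt {m : Hm (j a) (j b)} (h : R X m) : Pi0 b = p0 := h.choose_spec.1.tgt
lemma bk {m : Hm (j a) (j c)} {n : Hm (j b) (j c)} (h : R X m) (h' : R X n) : a = b := h.ri.en h'.ri
lemma th {m : Hm (j a) (j b)} (h : R X m) : T3.hol (mp cW m) = T3.hol (mp cv X) := by
  obtain ⟨ℓ, h1, rfl⟩ := h
  exact hol_lf h1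
lemma full (h : Pi0 a = p0) (h' : Pi0 b = p0) (m : Hm (j a) (j b)) : ∃ X, R X m := by
  obtain ⟨ℓ, rfl⟩ := j_full a b m
  have key : ∀ {x y : K.Y}, Pi0 a = x → Pi0 b = y → ∃ X : Hm x y, Lf Pi0 X ℓ := by
    rintro _ _ rfl rfl
    exact ⟨_, Lf.mp (q := ⟨Pi0, Pi0_cov.continuous⟩) ℓ⟩
  obtain ⟨X, hX⟩ := key h h'
  exact ⟨X, ℓ, hX, rfl⟩
end R
def Fil (σ : Bool) (X : Hm p0 p0) (e : W0) : Prop :=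
  Pi0 e = p0 ∧ (∃ A : Hm (j e) (j e), R X A ∧ lh (!σ) A = Multiplicative.ofAdd (-1) ∧ lh σ A = 1) ∧
  ∀ a, Pi0 a = p0 → a ≠ e → ∃ b, b ≠ a ∧ b ≠ e ∧ ∃ m : Hm (j a) (j b), R X m ∧ R X (inv m)
lemma fil (σ : Bool) (X : Hm p0 p0)
    (hX : X = cr σ ≫ tau (cir σ) 0 (2 * Real.pi) rfl (cir_per σ) ≫ inv (cr σ)) : ∃ e, Fil σ X e := by
  obtain ⟨e, h1, ⟨ℓ, h2, h3, h4⟩, h5⟩ := fill σ X hX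
  refine ⟨e, h1, ⟨_, ⟨ℓ, h2, rfl⟩, h3, h4⟩, fun a ha hn => ?_⟩
  obtain ⟨b, hb1, hb2, k, k', hk, hk', e'⟩ := h5 a ha hn
  refine ⟨b, hb1, hb2, _, ⟨k, hk, rfl⟩, k', hk', ?_⟩
  exact (IsIso.inv_eq_of_hom_inv_id e').symm
lemma hol_df {A B : Hm (K.pb false) (K.pb true)} : T3.hol (mp cv (df A B)) = T3.hol (mp cv A) * (T3.hol (mp cv B))⁻¹ := by
  unfold df
  rw [mp_comp, mp_inv]
  exact (T3.hol_comp _ _).trans (by rw [T3.hol_inv])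
lemma hmul (a b : Hm p0 p0) : T3.hol (mp cv (a * b)) = T3.hol (mp cv a) * T3.hol (mp cv b) :=
  (congrArg T3.hol (mp_comp cv a b)).trans (T3.hol_comp _ _)
theorem facts : ∃ (x y : Hm p0 p0) (g : Fin 3 → Hm p0 p0) (e f : W0), Fil false x e ∧ Fil true y f ∧
    (∀ i, Commute x (g i)) ∧ (∀ i, Commute y (g i)) ∧ (x * y) ^ 3 = (y * x) ^ 3 ∧
    (∀ S : Subgroup (Hm p0 p0), x ∈ S → y ∈ S → (∀ i, g i ∈ S) → ∀ m, m ∈ S) ∧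
    T3.hol (mp cv x) = 1 ∧ T3.hol (mp cv y) = 1 ∧ ∀ i, T3.hol (mp cv (g i)) = .of i := by
  obtain ⟨V0, P, Q, V2, V3, Vf, V4, gV0, gP, gQ, gV2, gV3, gVf, gV4, hy, hcm, hbr, hgen⟩ := rels
  have a0 := H_hol gV0 (x := -1) (ptW (by norm_num) (by norm_num) (by norm_num) (by norm_num) (by norm_num)) (by norm_num) (by norm_num) (by norm_num)
  have aQ := H_hol gQ (x := -(3/100)) (ptW (by norm_num) (by norm_num) (by norm_num) (by norm_num) (by norm_num)) (by norm_num) (by norm_num) (by norm_num)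
  have a2 := H_hol gV2 (x := -(1/100)) (ptW (by norm_num) (by norm_num) (by norm_num) (by norm_num) (by norm_num)) (by norm_num) (by norm_num) (by norm_num)
  have a3 := H_hol gV3 (x := 1/4) (ptW (by norm_num) (by norm_num) (by norm_num) (by norm_num) (by norm_num)) (by norm_num) (by norm_num) (by norm_num)
  have af := H_hol gVf (x := 1) (ptW (by norm_num) (by norm_num) (by norm_num) (by norm_num) (by norm_num)) (by norm_num) (by norm_num) (by norm_num)
  have a4 := H_hol gV4 (x := 2) (ptW (by norm_num) (by norm_num) (by norm_num) (by norm_num) (by norm_num)) (by norm_num) (by norm_num) (by norm_num)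
  obtain ⟨f, hf⟩ := fil true (df P V2) (circ gP gV2)
  obtain ⟨e, he⟩ := fil false (df Q V2) (circ (by rw [GW, ← pat_sw'] at gQ; exact gQ) (by rw [GW, ← pat_sw'] at gV2; exact gV2))
  have hc := hcm P (Or.inl rfl)
  have hd := hcm Q (Or.inr rfl)
  generalize sk (kp (K.pb true).1.2) = c at a0 aQ a2 a3 af a4
  have hx1 : T3.hol (mp cv (df Q V2)) = 1 := by
    rw [hol_df, aQ, a2]; norm_num [sk]
  refine ⟨df Q V2, df P V2, ![df V2 V3, df V3 Vf, df Vf V4], e, f, he, hf, ?_, ?_, hbr, ?_, hx1, ?_, ?_⟩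
  · rw [Fin.forall_fin_succ, Fin.forall_fin_two]; exact hd
  · rw [Fin.forall_fin_succ, Fin.forall_fin_two]; exact hc
  · intro S h1 h2 h3
    exact hgen S h2 h1 (h3 0) (h3 1) (h3 2)
  · rw [hy]
    rw [hmul, hmul, hx1, mul_one, inv_d, mp_inv, T3.hol_inv, hx1, inv_one, one_mul, hol_df, a0, aQ]; norm_num [sk]
  · rw [Fin.forall_fin_succ, Fin.forall_fin_two]
    refine ⟨?_, ?_, ?_⟩
    · refine hol_df.trans ?_; rw [a2, a3]; norm_num [sk]
    · refine hol_df.trans ?_; rw [a3, af]; norm_num [sk]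
    · refine hol_df.trans ?_; rw [af, a4]; norm_num [sk]
lemma absg {H : Type} [Group H] (A A' : H) (G : Fin 3 → H) (h1 : Commute A A') (h2 : ∀ i, Commute A (G i))
    (h3 : ∀ i, Commute A' (G i)) (θ : H →* FreeGroup (Fin 3)) (l l' : H →* Multiplicative ℤ) (tA : θ A = 1) (tA' : θ A' = 1)
    (tG : ∀ i, θ (G i) = .of i) (a1 : l A = Multiplicative.ofAdd (-1)) (a2 : l A' = 1) (a3 : l' A = 1)
    (a4 : l' A' = Multiplicative.ofAdd (-1))
    (gen : ∀ S : Subgroup H, A ∈ S → A' ∈ S → (∀ i, G i ∈ S) → ∀ m, m ∈ S) :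
    Nonempty (H ≃* (Multiplicative ℤ × Multiplicative ℤ) × FreeGroup (Fin 3)) := by
  have cl : ∀ B : H, (∀ i, Commute B (G i)) → ∀ w, Commute B (FreeGroup.lift G w) := by
    intro B hB w
    induction w using FreeGroup.induction_on with
    | C1 => simp
    | of i => simpa using hB i
    | inv_of i hi => rw [map_inv]; exact hi.inv_right
    | mul x y hx hy => rw [map_mul]; exact hx.mul_right hy
  let P1 : Multiplicative ℤ × Multiplicative ℤ →* H := (zpowersHom H A).noncommCoprod (zpowersHom H A')
    (fun m n => by simp only [zpowersHom_apply]; exact h1.zpow_zpow _ _)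
  let Ψ : (Multiplicative ℤ × Multiplicative ℤ) × FreeGroup (Fin 3) →* H := P1.noncommCoprod (FreeGroup.lift G)
    (fun m n => by
      simp only [P1, MonoidHom.noncommCoprod_apply, zpowersHom_apply]
      exact ((cl A h2 n).zpow_left _).mul_left ((cl A' h3 n).zpow_left _))
  have hΨ : ∀ p q w, Ψ ((p, q), w) = A ^ p.toAdd * A' ^ q.toAdd * FreeGroup.lift G w := fun p q w => by
    simp only [Ψ, P1, MonoidHom.noncommCoprod_apply, zpowersHom_apply]
  have hl : ∀ w, θ (FreeGroup.lift G w) = w := fun w => by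
    have : θ.comp (FreeGroup.lift G) = MonoidHom.id _ := FreeGroup.ext_hom _ _ (by simpa using tG)
    exact DFunLike.congr_fun this w
  refine ⟨(MulEquiv.ofBijective Ψ ⟨?_, ?_⟩).symm⟩
  · rw [injective_iff_map_eq_one]
    rintro ⟨⟨p, q⟩, w⟩ hp
    rw [hΨ] at hp
    have hw : w = 1 := by simpa [hl, tA, tA'] using congrArg θ hp
    subst hw
    rw [map_one, mul_one] at hp
    have e1 := congrArg l hp
    have e2 := congrArg l' hp
    rw [map_mul, map_zpow, map_zpow, map_one, a1, a2, one_zpow, mul_one, ← ofAdd_zsmul, ofAdd_eq_one] at e1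
    rw [map_mul, map_zpow, map_zpow, map_one, a3, a4, one_zpow, one_mul, ← ofAdd_zsmul, ofAdd_eq_one] at e2
    have : p = 1 := by rw [← toAdd_eq_zero]; simpa using e1
    have : q = 1 := by rw [← toAdd_eq_zero]; simpa using e2
    subst p q; rfl
  · refine fun m => gen Ψ.range ⟨((Multiplicative.ofAdd 1, 1), 1), ?_⟩ ⟨((1, Multiplicative.ofAdd 1), 1), ?_⟩
      (fun i => ⟨((1, 1), .of i), ?_⟩) m <;> rw [hΨ] <;> simp
lemma fixx {σ : Bool} {X Y : Hm p0 p0} {e : W0} (h : Fil σ X e) (c : Commute X Y) : ∃ m : Hm (j e) (j e), R Y m := by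
  obtain ⟨he, ⟨A, hA, -, -⟩, hx⟩ := h
  obtain ⟨b, m, hm⟩ := R.ex Y he
  obtain ⟨b', n, hn⟩ := R.ex X hm.tgt
  obtain rfl := ((congrArg (R · (A ≫ m)) c.eq).mp (hA.mul hm)).en (hm.mul hn)
  by_cases hb : b = e
  · subst hb; exact ⟨m, hm⟩
  · obtain ⟨k, h1, -, m', h2, -⟩ := hx b hm.tgt hb
    exact absurd (h2.en hn) h1
lemma pt3 {e f : W0} (he : Pi0 e = p0) (hf : Pi0 f = p0) : ∃ d, Pi0 d = p0 ∧ d ≠ e ∧ d ≠ f ∧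
    (e ≠ f → ∀ a, Pi0 a = p0 → a = e ∨ a = d ∨ a = f) := by
  obtain ⟨e1, e2, e3, h12, h13, h23, h⟩ := fib3
  simp only [p0, h] at he hf ⊢
  rcases he with rfl | rfl | rfl <;> rcases hf with rfl | rfl | rfl
  · exact ⟨e2, by tauto⟩
  · exact ⟨e3, by tauto⟩
  · exact ⟨e2, by tauto⟩
  · exact ⟨e3, by tauto⟩
  · exact ⟨e1, by tauto⟩
  · exact ⟨e1, by tauto⟩
  · exact ⟨e2, by tauto⟩
  · exact ⟨e1, by tauto⟩
  · exact ⟨e1, by tauto⟩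
lemma fr_ex {e d f : W0} (h1 : d ≠ e) (h2 : d ≠ f) (h3 : e ≠ f) (T : Hm (j e) (j d)) (t : Hm (j e) (j f)) :
    ∃ fr : ∀ a, Hm (j e) (j a), fr e = 𝟙 _ ∧ fr d = T ∧ fr f = t := by
  classical
  refine ⟨Function.update (Function.update (Function.update (fun a => mp j (W0_conn e a).some) e (𝟙 _)) d T) f t, ?_, ?_, ?_⟩
  · rw [Function.update_of_ne h3, Function.update_of_ne h1.symm, Function.update_self]
  · rw [Function.update_of_ne h2, Function.update_self]
  · rw [Function.update_self]
def Sp {e : W0} (fr : ∀ a, Hm (j e) (j a)) (Γ : Subgroup (Hm (j e) (j e))) : Subgroup (Hm p0 p0) where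
  carrier := {X | ∀ a b (m : Hm (j a) (j b)), R X m → fr a ≫ m ≫ inv (fr b) ∈ Γ}
  mul_mem' := by
    intro X Y hX hY a b m hm
    obtain ⟨c, n, hn⟩ := R.ex X hm.src
    obtain ⟨c', k, hk⟩ := R.ex Y hn.tgt
    obtain rfl := hm.en (hn.mul hk)
    obtain rfl := hm.un (hn.mul hk)
    have := Γ.mul_mem (hX _ _ _ hn) (hY _ _ _ hk)
    simpa [mul_d] using this
  one_mem' := by
    intro a b m hm
    obtain rfl := hm.en (R.one hm.src)
    obtain rfl := hm.un (R.one hm.src)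
    have := Γ.one_mem
    simpa [one_d] using this
  inv_mem' := by
    intro X hX a b m hm
    have h := hm.ri
    rw [inv_inv] at h
    have := Γ.inv_mem (hX _ _ _ h)
    simpa [inv_d] using this
lemma Sp_mem {e : W0} {fr : ∀ a, Hm (j e) (j a)} {Γ : Subgroup (Hm (j e) (j e))} {X : Hm p0 p0}
    (h : ∀ a, Pi0 a = p0 → ∃ b, ∃ n : Hm (j a) (j b), R X n ∧ fr a ≫ n ≫ inv (fr b) ∈ Γ) : X ∈ Sp fr Γ := by
  intro a b m hm
  obtain ⟨c, n, hn, h'⟩ := h a hm.src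
  obtain rfl := hm.en hn
  obtain rfl := hm.un hn
  exact h'
theorem big : ∃ e : W0, Nonempty (Hm (j e) (j e) ≃* (Multiplicative ℤ × Multiplicative ℤ) × FreeGroup (Fin 3)) := by
  obtain ⟨x, y, g, e, f, Fx, Fy, cx, cy, br, gen, tx, ty, tg⟩ := facts
  obtain ⟨d, hd, hde, hdf, hall⟩ := pt3 Fx.1 Fy.1
  choose G hG using fun i => fixx Fx (cx i)
  obtain ⟨he, ⟨A, hA, hA1, hA2⟩, hx⟩ := Fx
  obtain ⟨hf, ⟨B, hB, hB1, hB2⟩, hy⟩ := Fy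
  have hef : e ≠ f := by
    rintro rfl
    obtain ⟨X, hX⟩ := R.full he hd (mp j (W0_conn e d).some)
    let S : Subgroup (Hm p0 p0) :=
      { carrier := {X | ∃ m : Hm (j e) (j e), R X m}
        mul_mem' := fun ⟨m, hm⟩ ⟨n, hn⟩ => ⟨_, hm.mul hn⟩
        one_mem' := ⟨_, R.one he⟩
        inv_mem' := fun ⟨m, hm⟩ => ⟨_, hm.ri⟩ }
    obtain ⟨m, hm⟩ := gen S ⟨A, hA⟩ ⟨B, hB⟩ (fun i => ⟨_, hG i⟩) X
    exact hde (hX.en hm)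
  replace hall := hall hef
  obtain ⟨T, hT, hT'⟩ : ∃ T : Hm (j e) (j d), R y T ∧ R y (inv T) := by
    obtain ⟨b, h1, h2, m, h3, h4⟩ := hy e he hef
    obtain rfl : b = d := by have := hall b h3.tgt; tauto
    exact ⟨m, h3, h4⟩
  obtain ⟨V, hV', hV⟩ : ∃ T : Hm (j f) (j d), R x T ∧ R x (inv T) := by
    obtain ⟨b, h1, h2, m, h3, h4⟩ := hx f hf hef.symm
    obtain rfl : b = d := by have := hall b h3.tgt; tauto
    exact ⟨m, h3, h4⟩
  have hG1 : ∀ i, R (g i) (inv T ≫ G i ≫ T) := fun i => by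
    have := (hT'.mul (hG i)).mul hT'.ri
    rw [(cy i).eq, mul_inv_cancel_right] at this
    simpa using this
  have hG2 : ∀ i, R (g i) (V ≫ (inv T ≫ G i ≫ T) ≫ inv V) := fun i => by
    have := (hV'.mul (hG1 i)).mul hV'.ri
    rw [(cx i).eq, mul_inv_cancel_right] at this
    simpa using this
  have c1 : ∀ i, A ≫ G i = G i ≫ A := fun i => (hA.mul (hG i)).un ((cx i).eq ▸ (hG i).mul hA)
  have c2 := fun i => (hB.mul (hG2 i)).un ((cy i).eq ▸ (hG2 i).mul hB)
  let A' : Hm (j e) (j e) := T ≫ inv V ≫ B ≫ V ≫ inv T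
  have hA' : R (y * (x * (y * (x * y)))) A' := hT.mul (hV.mul (hB.mul (hV'.mul hT')))
  have c3 : A ≫ A' = A' ≫ A := by
    have h1 := hA.mul hA'
    have h2 := hA'.mul hA
    have h3 : x * (y * (x * (y * (x * y)))) = y * (x * (y * (x * y))) * x := by
      simpa [pow_succ, mul_assoc] using br
    rw [h3] at h1
    exact h1.un h2
  obtain ⟨fr, f1, f2, f3⟩ := fr_ex hde hdf hef T (T ≫ inv V)
  have lA' : ∀ s, lh s A' = lh s B := fun s => by
    simp only [A', lh_comp, lh_inv]
    rw [mul_comm (lh s B)]; group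
  have c4 : ∀ i, A' ≫ G i = G i ≫ A' := fun i => by
    have := congrArg (fun m => T ≫ inv V ≫ m ≫ V ≫ inv T) (c2 i)
    simpa [A'] using this
  refine ⟨e, absg A A' G c3 c1 c4 (MonoidHom.mk' (fun m => T3.hol (mp cW m)) fun a b =>
    (congrArg T3.hol (mp_comp cW a b)).trans (T3.hol_comp _ _)) (MonoidHom.mk' (lh true) (lh_comp _))
    (MonoidHom.mk' (lh false) (lh_comp _)) (hA.th.trans tx) (hA'.th.trans ?_) (fun i => (hG i).th.trans (tg i)) hA1
    ((lA' _).trans hB2) hA2 ((lA' _).trans hB1) ?_⟩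
  · rw [hmul, hmul, hmul, hmul, tx, ty]; simp
  · intro Γ hΓ hΓ' hΓG m
    have key : ∀ X, X ∈ Sp fr Γ := by
      refine gen _ (Sp_mem fun a ha => ?_) (Sp_mem fun a ha => ?_) (fun i => Sp_mem fun a ha => ?_)
      all_goals rcases hall a ha with rfl | rfl | rfl
      · exact ⟨_, _, hA, by rw [f1]; simpa using hΓ⟩
      · refine ⟨_, _, hV, ?_⟩
        rw [f2, f3]; simpa using Γ.one_mem
      · refine ⟨_, _, hV', ?_⟩
        rw [f2, f3]; simpa using Γ.one_mem
      · refine ⟨_, _, hT, ?_⟩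
        rw [f1, f2]; simpa using Γ.one_mem
      · refine ⟨_, _, hT', ?_⟩
        rw [f1, f2]; simpa using Γ.one_mem
      · refine ⟨_, _, hB, ?_⟩
        rw [f3]; simpa [A'] using hΓ'
      · exact ⟨_, _, hG i, by rw [f1]; simpa using hΓG i⟩
      · refine ⟨_, _, hG1 i, ?_⟩
        rw [f2]; simpa using hΓG i
      · refine ⟨_, _, hG2 i, ?_⟩
        rw [f3]; simpa using hΓG i
    obtain ⟨X, hX⟩ := R.full he he m
    have := key X _ _ m hX
    simpa [f1] using this
lemma tr_h {X Y : Type} [TopologicalSpace X] [TopologicalSpace Y] (φ : X ≃ₜ Y) (x : X) :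
    Function.Bijective (mp (φ : C(X, Y)) : Hm x x → Hm (φ x) (φ x)) := by
  constructor
  · intro m n e
    have e' := congrArg (mp (φ.symm : C(Y, X))) e
    have key : ∀ k : C(X, X), k = ContinuousMap.id X → mp k m = mp k n → m = n := by
      rintro _ rfl hk
      have hi : ∀ m : Hm x x, mp (ContinuousMap.id X) m = m := fun m => by
        obtain ⟨p, rfl⟩ := exists_cls m
        rfl
      exact (hi m).symm.trans (hk.trans (hi n))
    exact key ((φ.symm : C(Y, X)).comp (φ : C(X, Y))) (by ext; simp) (((mp_mp _ _ m).symm.trans e').trans (mp_mp _ _ n))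
  · intro n
    obtain ⟨p, rfl⟩ := exists_cls n
    refine ⟨cls ((p.map φ.symm.continuous).cast (φ.symm_apply_apply x).symm (φ.symm_apply_apply x).symm), ?_⟩
    rw [mp_cls]
    congr 1
    ext t
    exact φ.apply_symm_apply _
lemma fgE {X : Type} [TopologicalSpace X] (x : X) : Nonempty (FundamentalGroup X x ≃* Hm x x) :=
  ⟨{ toFun := fun m => inv (show Hm x x from m)
     invFun := fun m => (inv m : Hm x x)
     left_inv := fun m => IsIso.inv_inv (f := (show Hm x x from m))
     right_inv := fun m => IsIso.inv_inv (f := m)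
     map_mul' := fun a b => IsIso.inv_comp (f := (show Hm x x from b)) (h := (show Hm x x from a)) }⟩
lemma cjE {X : Type} [TopologicalSpace X] {x y : X} (m : Hm x y) : Nonempty (Hm x x ≃* Hm y y) :=
  ⟨{ toFun := fun n => inv m ≫ n ≫ m
     invFun := fun n => m ≫ n ≫ inv m
     left_inv := fun n => by simp
     right_inv := fun n => by simp
     map_mul' := fun a b => by simp [mul_d] }⟩
abbrev V0 : Set (ℂ × ℂ) := W ({0, 4, 4 * Complex.I} : Set ℂ)
lemma I1 : (1 + I : ℂ) ≠ 0 := fun e => by simpa using congrArg Complex.re e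
lemma iffW (w a : ℂ) : ((1 + I) * w, (1 + I) * (a + 2 * w)) ∈ V0 ↔ (w, a) ∈ Wh := by
  have e : h ((1 + I) * w, (1 + I) * (a + 2 * w)) = 2 * (1 + I) * cF w a := by
    simp only [h, cF]
    linear_combination (1 + I) * (a ^ 3 - 3 * a * w ^ 2) * Complex.I_sq
  have h2 : (2 * (1 + I) : ℂ) ≠ 0 := mul_ne_zero two_ne_zero I1
  have e1 : (4 : ℂ) = 2 * (1 + I) * zf (.b true) 0 := by simp [zf]; linear_combination 2 * Complex.I_sq
  have e2 : 4 * I = 2 * (1 + I) * zf (.b false) 0 := by simp [zf]; linear_combination (-2 * Complex.I_sq)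
  have e3 : (1 + I) * (a + 2 * w) = 4 * ((1 + I) * w) ↔ a = 2 * w := by
    rw [show 4 * ((1 + I) * w) = (1 + I) * (4 * w) by ring, mul_right_inj' I1]
    constructor <;> intro h <;> linear_combination h
  have e4 : (1 + I) * (a + 2 * w) = 0 ↔ a = -(2 * w) := by
    rw [mul_eq_zero, or_iff_right I1]
    constructor <;> intro h <;> linear_combination h
  have q1 : h ((1 + I) * w, (1 + I) * (a + 2 * w)) = 4 ↔ cF w a = zf (.b true) 0 := by
    rw [e, e1, mul_right_inj' h2]
  have q2 : h ((1 + I) * w, (1 + I) * (a + 2 * w)) = 4 * I ↔ cF w a = zf (.b false) 0 := by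
    rw [e, e2, mul_right_inj' h2]
  have q0 : h ((1 + I) * w, (1 + I) * (a + 2 * w)) = 0 ↔ cF w a = 0 := by
    rw [e, mul_eq_zero, or_iff_right h2]
  simp only [W, ell₁, ell₂, Wh, Set.mem_ofPred_eq, Set.mem_insert_iff, Set.mem_singleton_iff, Bool.forall_bool, q0, q1, q2, e3, e4]
  simp [sg]
  tauto
def phi : Wh ≃ₜ V0 where
  toFun q := ⟨((1 + I) * q.1.1, (1 + I) * (q.1.2 + 2 * q.1.1)), (iffW _ _).2 q.2⟩
  invFun p := ⟨((1 + I)⁻¹ * p.1.1, (1 + I)⁻¹ * (p.1.2 - 2 * p.1.1)), (iffW _ _).1 (by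
    convert p.2 using 1
    have := I1
    ext <;> field_simp
    ring)⟩
  left_inv q := by
    have := I1
    ext <;> simp <;> field_simp
    ring
  right_inv p := by
    have := I1
    ext <;> simp <;> field_simp
    ring
  continuous_toFun := by fun_prop
  continuous_invFun := by fun_prop
lemma fin (x : V0) : Nonempty (FundamentalGroup V0 x ≃* (Multiplicative ℤ × Multiplicative ℤ) × FreeGroup (Fin 3)) := by
  obtain ⟨q, rfl⟩ := phi.surjective x
  obtain ⟨e, ⟨E⟩⟩ := big
  obtain ⟨m⟩ := Wh_conn e q
  obtain ⟨C⟩ := cjE m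
  obtain ⟨F⟩ := fgE (phi q)
  have D : Hm q q ≃* Hm (phi q) (phi q) := MulEquiv.ofBijective
    (MonoidHom.mk' (mp (phi : C(Wh, V0))) fun a b => mp_comp _ a b) (tr_h phi q)
  exact ⟨F.trans (D.symm.trans (C.symm.trans E))⟩
end P17
end

/-- The fundamental group of `ℂ² \ (H_{B₀} ∪ ℓ₁ ∪ ℓ₂)` with `B₀ = {0, 4, 4i}` (at any
basepoint) is isomorphic to `ℤ² × F₃`. -/
theorem stmt17 (x : W ({0, 4, 4 * Complex.I} : Set ℂ)) :
    Nonempty (FundamentalGroup (W ({0, 4, 4 * Complex.I} : Set ℂ)) x ≃*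
      (Multiplicative ℤ × Multiplicative ℤ) × FreeGroup (Fin 3)) :=
  P17.fin x
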